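/- arXiv:1502.06952 — 2 statements merged into one kernel-verified Lean document; each statement's English description precedes it below -/
import Mathlib

section
/- Fix (θ, β) ∈ (0,1)² and α > 0 such that α > η^clu_θ(β). Suppose the data matrix is X = ℓμ' + A_p Z B_p, where A_p ∈ ℝ^{n×n} and B_p ∈ ℝ^{p×p} are nonrandom invertible matrices whose spectral norms satisfy p^{−δ}·max{‖A_p‖, ‖A_p^{−1}‖, ‖B_p‖, ‖B_p^{−1}‖} → 0 for every fixed δ > 0. Then for every sequence of measurable clustering procedures ℓ̂ : ℝ^{n×p} → {−1,1}^n, liminf_{p→∞} Hamm_p(ℓ̂) ≥ 1/2. -/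
open MeasureTheory ProbabilityTheory Filter
open scoped ENNReal NNReal Classical BigOperators

namespace ARWPaper

/-- `n = ⌈p^θ⌉`. -/
noncomputable def nDim (p : ℕ) (θ : ℝ) : ℕ := ⌈(p : ℝ) ^ θ⌉₊

/-- Law of a single class label: uniform on `{-1, 1}`. -/
noncomputable def signLaw : Measure ℝ :=
  (1 / 2 : ℝ≥0∞) • Measure.dirac (1 : ℝ) + (1 / 2 : ℝ≥0∞) • Measure.dirac (-1 : ℝ)

/-- Law of a single coordinate of `μ`: `τ` w.p. `ε`, `0` w.p. `1 - ε`. -/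
noncomputable def muLaw (ε τ : ℝ) : Measure ℝ :=
  ENNReal.ofReal (1 - ε) • Measure.dirac (0 : ℝ) + ENNReal.ofReal ε • Measure.dirac τ

/-- Standard Gaussian product measure on `ℝ^n`. -/
noncomputable def gaussPi (n : ℕ) : Measure (Fin n → ℝ) :=
  Measure.pi fun _ => gaussianReal 0 1

/-- Law of the noise matrix `Z` (i.i.d. `N(0,1)` entries, rows indexed by `Fin n`). -/
noncomputable def noiseLaw (n p : ℕ) : Measure (Fin n → Fin p → ℝ) :=
  Measure.pi fun _ => gaussPi p

/-- Sample space for `(ℓ, μ, Z)`. -/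
abbrev Omega (n p : ℕ) := (Fin n → ℝ) × (Fin p → ℝ) × (Fin n → Fin p → ℝ)

/-- Joint law of `(ℓ, μ, Z)`. -/
noncomputable def jointLaw (n p : ℕ) (ε τ : ℝ) : Measure (Omega n p) :=
  (Measure.pi fun _ : Fin n => signLaw).prod
    ((Measure.pi fun _ : Fin p => muLaw ε τ).prod (noiseLaw n p))

/-- Data matrix `X = ℓ μ' + Z`. -/
def dataMap {n p : ℕ} (ω : Omega n p) : Fin n → Fin p → ℝ :=
  fun i j => ω.1 i * ω.2.1 j + ω.2.2 i j

/-- Hamming clustering error of a clustering procedure `ell`, where the observed data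
matrix is `D ω`. -/
noncomputable def hammingClu (n p : ℕ) (ε τ : ℝ)
    (D : Omega n p → Fin n → Fin p → ℝ)
    (ell : (Fin n → Fin p → ℝ) → Fin n → ℝ) : ℝ :=
  (n : ℝ)⁻¹ * min
    (∑ i : Fin n, ((jointLaw n p ε τ) {ω | ell (D ω) i ≠ ω.1 i}).toReal)
    (∑ i : Fin n, ((jointLaw n p ε τ) {ω | ell (D ω) i ≠ -ω.1 i}).toReal)

/-- Hamming error for signal (support) recovery. -/
noncomputable def hammingSig (n p : ℕ) (ε τ : ℝ)
    (D : Omega n p → Fin n → Fin p → ℝ)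
    (S : (Fin n → Fin p → ℝ) → Finset (Fin p)) : ℝ :=
  ((p : ℝ) * ε)⁻¹ * ∑ j : Fin p,
    (((jointLaw n p ε τ) {ω | ω.2.1 j = 0 ∧ j ∈ S (D ω)}).toReal +
      ((jointLaw n p ε τ) {ω | ω.2.1 j ≠ 0 ∧ j ∉ S (D ω)}).toReal)

/-- Sum of type I and type II testing errors of the rejection region `R`. -/
noncomputable def testErr (n p : ℕ) (ε τ : ℝ)
    (R : Set (Fin n → Fin p → ℝ)) : ℝ :=
  ((noiseLaw n p) R).toReal + ((jointLaw n p ε τ) {ω | dataMap ω ∉ R}).toReal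

/-- Statistical boundary for clustering. -/
noncomputable def etaClu (θ β : ℝ) : ℝ :=
  if β < (1 - θ) / 2 then (1 - 2 * β) / 2
  else if β < 1 - θ then θ / 2
  else (1 - β) / 2

/-- CTUB boundary for clustering. -/
noncomputable def etaCluT (θ β : ℝ) : ℝ :=
  if β < (1 - θ) / 2 then (1 - 2 * β) / 2
  else if β < 1 / 2 then (1 + θ - 2 * β) / 4
  else if β < 1 - θ / 2 then θ / 4
  else (1 - β) / 2

/-- Statistical boundary for signal recovery. -/
noncomputable def etaSig (θ β : ℝ) : ℝ :=
  if β < 1 - θ then θ / 2 else (1 + θ - β) / 4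

/-- CTUB boundary for signal recovery. -/
noncomputable def etaSigT (θ β : ℝ) : ℝ :=
  if β < (1 - θ) / 2 then θ / 2
  else if β < 1 / 2 then (1 + θ - 2 * β) / 4
  else θ / 4

noncomputable def etaHyp1 (θ β : ℝ) : ℝ := (2 + θ - 4 * β) / 4
noncomputable def etaHyp2 (θ β : ℝ) : ℝ := min (θ / 2) ((1 + θ - β) / 4)
noncomputable def etaHyp (θ β : ℝ) : ℝ := max (etaHyp1 θ β) (etaHyp2 θ β)
noncomputable def etaHypT (θ β : ℝ) : ℝ := max (etaHyp1 θ β) (θ / 4)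

/-- Standard phase function `ρ*`. -/
noncomputable def rhoStar (b : ℝ) : ℝ :=
  if b < 3 / 4 then b - 1 / 2 else (1 - Real.sqrt (1 - b)) ^ 2

/-- Phase function for IF-PCA. -/
noncomputable def rhoStarTheta (θ β : ℝ) : ℝ :=
  (1 - θ) * rhoStar (1 / 2 + (β - 1 / 2) / (1 - θ))

/-- Euclidean norm of a vector. -/
noncomputable def l2 {n : ℕ} (v : Fin n → ℝ) : ℝ := Real.sqrt (∑ i, v i ^ 2)

/-- Entrywise sup-norm of a vector. -/
noncomputable def linf {n : ℕ} (v : Fin n → ℝ) : ℝ := ⨆ i, |v i|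

/-- `cos(x, y) = |⟨x/‖x‖, y/‖y‖⟩|`. -/
noncomputable def cosv {n : ℕ} (x y : Fin n → ℝ) : ℝ :=
  |∑ i, x i * y i| / (l2 x * l2 y)

/-- Spectral (operator) norm of a matrix. -/
noncomputable def specNorm {m k : ℕ} (A : Matrix (Fin m) (Fin k) ℝ) : ℝ :=
  sSup ((fun v => l2 (A.mulVec v)) '' {v | l2 v ≤ 1})

/-- Simple Aggregation clustering: entrywise sign of the sum of all columns. -/
noncomputable def ellSimpleAgg {n p : ℕ} (X : Fin n → Fin p → ℝ) : Fin n → ℝ :=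
  fun i => Real.sign (∑ j, X i j)

/-- `S` picks, for every data matrix, a size-`N` subset maximizing `‖∑_{j ∈ S} x_j‖₁`. -/
def IsSparseAggMaximizer {n p : ℕ} (N : ℕ)
    (S : (Fin n → Fin p → ℝ) → Finset (Fin p)) : Prop :=
  ∀ X, (S X).card = N ∧
    ∀ T : Finset (Fin p), T.card = N →
      ∑ i, |∑ j ∈ T, X i j| ≤ ∑ i, |∑ j ∈ S X, X i j|

/-- Sparse Aggregation clustering. -/
noncomputable def ellSparseAgg {n p : ℕ}
    (S : (Fin n → Fin p → ℝ) → Finset (Fin p)) (X : Fin n → Fin p → ℝ) :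
    Fin n → ℝ :=
  fun i => Real.sign (∑ j ∈ S X, X i j)

/-- Gram matrix `X X'`. -/
def gram {n p : ℕ} (X : Fin n → Fin p → ℝ) : Matrix (Fin n) (Fin n) ℝ :=
  Matrix.of fun i i' => ∑ j, X i j * X i' j

/-- `ξ` is a unit eigenvector of `A` associated with its largest eigenvalue. -/
def IsTopEigenvector {n : ℕ} (A : Matrix (Fin n) (Fin n) ℝ) (ξ : Fin n → ℝ) : Prop :=
  (∑ i, ξ i ^ 2) = 1 ∧
    ∃ lam : ℝ, A.mulVec ξ = lam • ξ ∧
      ∀ (lam' : ℝ) (v : Fin n → ℝ), v ≠ 0 → A.mulVec v = lam' • v → lam' ≤ lam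

/-- χ²-screening: the set of selected features. -/
noncomputable def chiSel {n p : ℕ} (q : ℝ) (X : Fin n → Fin p → ℝ) : Finset (Fin p) :=
  Finset.univ.filter fun j =>
    Real.sqrt (2 * q * Real.log p) ≤ ((∑ i, X i j ^ 2) - n) / Real.sqrt (2 * n)

/-- Post-selection Gram matrix `X^{(q)} (X^{(q)})'`. -/
noncomputable def gramSel {n p : ℕ} (q : ℝ) (X : Fin n → Fin p → ℝ) :
    Matrix (Fin n) (Fin n) ℝ :=
  Matrix.of fun i i' => ∑ j ∈ chiSel q X, X i j * X i' j

/-- IF-PCA calibration `τ_p* = p^{-θ/4} (4 r log p)^{1/4}`. -/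
noncomputable def tauStar (p : ℕ) (θ r : ℝ) : ℝ :=
  (p : ℝ) ^ (-(θ / 4)) * (4 * r * Real.log p) ^ ((1 : ℝ) / 4)

/-- The ideal threshold `q*` of IF-PCA in the Region of Possibility. -/
noncomputable def qStar (θ β r : ℝ) : ℝ :=
  if (β - θ / 2) / 3 < r then (β - θ / 2 + r) ^ 2 / (4 * r) else 4 * r

/-- Support of `μ`. -/
noncomputable def suppSet {p : ℕ} (μ : Fin p → ℝ) : Finset (Fin p) :=
  Finset.univ.filter fun j => μ j ≠ 0

/-- The event `D_p`: `| |S(μ)| - p ε_p | ≤ √(6 p ε_p log p)` with `ε_p = p^{-β}`. -/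
def inDp (β : ℝ) {p : ℕ} (μ : Fin p → ℝ) : Prop :=
  |((suppSet μ).card : ℝ) - (p : ℝ) * (p : ℝ) ^ (-β)| ≤
    Real.sqrt (6 * ((p : ℝ) * (p : ℝ) ^ (-β)) * Real.log p)

/-- Selection threshold `n + 2√(q n log p)` for the squared column norm. -/
noncomputable def thresh (p n : ℕ) (q : ℝ) : ℝ :=
  (n : ℝ) + 2 * Real.sqrt (q * n * Real.log p)

/-- `π₀ = P(‖z‖² > n + 2√(q n log p))`, `z ~ N(0, I_n)`. -/
noncomputable def pi0 (p n : ℕ) (q : ℝ) : ℝ :=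
  ((gaussPi n) {z | thresh p n q < ∑ i, z i ^ 2}).toReal

/-- `π₁ = P(‖z + τ ℓ‖² > n + 2√(q n log p))`, `z ~ N(0, I_n)`. -/
noncomputable def pi1 (p : ℕ) {n : ℕ} (q τ : ℝ) (ℓ : Fin n → ℝ) : ℝ :=
  ((gaussPi n) {z | thresh p n q < ∑ i, (z i + τ * ℓ i) ^ 2}).toReal

/-- Expected number of selected useless features (`s = |S(μ)|`). -/
noncomputable def m0q (p n : ℕ) (q : ℝ) (s : ℕ) : ℝ := ((p : ℝ) - s) * pi0 p n q

/-- Expected number of selected useful features. -/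
noncomputable def m1q (p : ℕ) {n : ℕ} (q τ : ℝ) (ℓ : Fin n → ℝ) (s : ℕ) : ℝ :=
  (s : ℝ) * pi1 p q τ ℓ

/-- `m^{(q)}`. -/
noncomputable def mq (p : ℕ) {n : ℕ} (q τ : ℝ) (ℓ : Fin n → ℝ) (s : ℕ) : ℝ :=
  m0q p n q s + m1q p q τ ℓ s

/-- `m_*^{(q)}`. -/
noncomputable def mstarq (p : ℕ) {n : ℕ} (q τ : ℝ) (ℓ : Fin n → ℝ) (s : ℕ) : ℝ :=
  ((p : ℝ) - s) * (n : ℝ)⁻¹ *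
      (∫ z in {z : Fin n → ℝ | thresh p n q < ∑ i, z i ^ 2}, (∑ i, z i ^ 2) ∂gaussPi n) +
    (s : ℝ) * (n : ℝ)⁻¹ *
      (∫ z in {z : Fin n → ℝ | thresh p n q < ∑ i, (z i + τ * ℓ i) ^ 2},
        (∑ i, z i ^ 2) ∂gaussPi n)

/-- The threshold `q̃(β, θ, r)` separating the "fat" and "skinny" cases. -/
noncomputable def qTilde (β θ r : ℝ) : ℝ :=
  if β < 1 - θ then max (1 - θ) ((Real.sqrt (1 - β - θ) + Real.sqrt r) ^ 2)
  else 1 - θ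

/-- The set of features selected by χ²-screening, in terms of `(ℓ, μ, Z)`. -/
noncomputable def selSet {n p : ℕ} (q : ℝ) (ℓ : Fin n → ℝ) (μ : Fin p → ℝ)
    (Z : Fin n → Fin p → ℝ) : Finset (Fin p) :=
  chiSel q fun i j => ℓ i * μ j + Z i j

/-- `Z^{(q)} (Z^{(q)})'`. -/
noncomputable def gramZq {n p : ℕ} (q : ℝ) (ℓ : Fin n → ℝ) (μ : Fin p → ℝ)
    (Z : Fin n → Fin p → ℝ) : Matrix (Fin n) (Fin n) ℝ :=
  Matrix.of fun i i' => ∑ j ∈ selSet q ℓ μ Z, Z i j * Z i' j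

/-- `X^{(q)} (X^{(q)})'`. -/
noncomputable def gramXq {n p : ℕ} (q : ℝ) (ℓ : Fin n → ℝ) (μ : Fin p → ℝ)
    (Z : Fin n → Fin p → ℝ) : Matrix (Fin n) (Fin n) ℝ :=
  Matrix.of fun i i' =>
    ∑ j ∈ selSet q ℓ μ Z, (ℓ i * μ j + Z i j) * (ℓ i' * μ j + Z i' j)

/-- The matrix `ℓ (μ^{(q)})' (Z^{(q)})' + Z^{(q)} μ^{(q)} ℓ'`. -/
noncomputable def crossMat {n p : ℕ} (q : ℝ) (ℓ : Fin n → ℝ) (μ : Fin p → ℝ)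
    (Z : Fin n → Fin p → ℝ) : Matrix (Fin n) (Fin n) ℝ :=
  Matrix.of fun i i' =>
    ℓ i * (∑ j ∈ selSet q ℓ μ Z, Z i' j * μ j) +
      (∑ j ∈ selSet q ℓ μ Z, Z i j * μ j) * ℓ i'

/-- Colored-noise data matrix `X = ℓ μ' + A Z B`. -/
noncomputable def dataColored {n p : ℕ} (A : Matrix (Fin n) (Fin n) ℝ)
    (B : Matrix (Fin p) (Fin p) ℝ) (ω : Omega n p) : Fin n → Fin p → ℝ :=
  fun i j => ω.1 i * ω.2.1 j + (A * Matrix.of ω.2.2 * B) i j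

/-- Colored-noise data matrix `X = ℓ μ' + Z B`. -/
noncomputable def dataColoredB {n p : ℕ} (B : Matrix (Fin p) (Fin p) ℝ)
    (ω : Omega n p) : Fin n → Fin p → ℝ :=
  fun i j => ω.1 i * ω.2.1 j + (Matrix.of ω.2.2 * B) i j

/-- `y_*^{(sa)} = n^{-1/2} X' ℓ̂_*^{(sa)}`. -/
noncomputable def ySA {n p : ℕ} (X : Fin n → Fin p → ℝ) : Fin p → ℝ :=
  fun j => (Real.sqrt n)⁻¹ * ∑ i, X i j * ellSimpleAgg X i

/-- `Ŝ_*^{(sa)}`: thresholding `y_*^{(sa)}` at the universal threshold. -/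
noncomputable def ShatSA {n p : ℕ} (X : Fin n → Fin p → ℝ) : Finset (Fin p) :=
  Finset.univ.filter fun j => Real.sqrt (2 * Real.log p) ≤ |ySA X j|

/-- `y_*^{(if)} = n^{-1/2} X' sgn(ξ)` for a given vector `ξ`. -/
noncomputable def yIF {n p : ℕ} (ξ : Fin n → ℝ) (X : Fin n → Fin p → ℝ) : Fin p → ℝ :=
  fun j => (Real.sqrt n)⁻¹ * ∑ i, X i j * Real.sign (ξ i)

/-- `Ŝ_*^{(if)}`: thresholding `y_*^{(if)}` at the universal threshold. -/
noncomputable def ShatIF {n p : ℕ} (ξ : Fin n → ℝ) (X : Fin n → Fin p → ℝ) : Finset (Fin p) :=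
  Finset.univ.filter fun j => Real.sqrt (2 * Real.log p) ≤ |yIF ξ X j|

/-- Rejection region of the Simple Aggregation test `T̂_*^{(sa)}`. -/
noncomputable def rejSA {n p : ℕ} : Set (Fin n → Fin p → ℝ) :=
  {X | 2 * Real.sqrt (2 * Real.log p) ≤
    ((p : ℝ) * (∑ i, ((p : ℝ)⁻¹ * ∑ j, X i j) ^ 2) - n) / Real.sqrt (2 * n)}

/-- Rejection region of the Sparse Aggregation test `T̂_N^{(sa)}`. -/
noncomputable def rejSparse {n p : ℕ} (N : ℕ)
    (S : (Fin n → Fin p → ℝ) → Finset (Fin p)) : Set (Fin n → Fin p → ℝ) :=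
  {X | Real.sqrt (2 / Real.pi) * n + Real.sqrt (2 * n * (N + 2) * Real.log p) ≤
    (Real.sqrt N)⁻¹ * ∑ i, |∑ j ∈ S X, X i j|}

/-- χ² P-value of feature `j`. -/
noncomputable def pvalue {n p : ℕ} (X : Fin n → Fin p → ℝ) (j : Fin p) : ℝ :=
  ((gaussPi n) {z | (∑ i, X i j ^ 2) ≤ ∑ i, z i ^ 2}).toReal

/-- Higher Criticism statistic. -/
noncomputable def HCstat {n p : ℕ} (X : Fin n → Fin p → ℝ) : ℝ :=
  sSup {h : ℝ | ∃ i : Fin p, 2 * (i.val + 1) ≤ p ∧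
    h = Real.sqrt p * (((i.val : ℝ) + 1) / p - pvalue X (Tuple.sort (pvalue X) i)) /
      Real.sqrt (pvalue X (Tuple.sort (pvalue X) i) *
        (1 - pvalue X (Tuple.sort (pvalue X) i)))}

/-- Rejection region of the Higher Criticism test. -/
noncomputable def rejHC {n p : ℕ} : Set (Fin n → Fin p → ℝ) :=
  {X | 2 * Real.sqrt (2 * Real.log (Real.log p)) ≤ HCstat X}

/-- Lebesgue measure on the space of `n × p` matrices. -/
noncomputable def lebPi (n p : ℕ) : Measure (Fin n → Fin p → ℝ) :=
  Measure.pi fun _ : Fin n => Measure.pi fun _ : Fin p => (volume : Measure ℝ)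

/-- Law of `X` in Experiment 1 (`X = ℓ μ' + c_p Z`) with `ℓ_i` forced to be `s`. -/
noncomputable def condLaw1 (n p : ℕ) (ε τ cp : ℝ) (i : Fin n) (s : ℝ) :
    Measure (Fin n → Fin p → ℝ) :=
  (jointLaw n p ε τ).map fun ω => fun i' j =>
    Function.update ω.1 i s i' * ω.2.1 j + cp * ω.2.2 i' j

/-- Law of `X` in Experiment 2 (`X = ℓ μ' + c_p Z + W`) with `ℓ_i` forced to be `s`,
where `W ~ ν` is independent of `(ℓ, μ, Z)`. -/
noncomputable def condLaw2 (n p : ℕ) (ε τ cp : ℝ)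
    (ν : Measure (Fin n → Fin p → ℝ)) (i : Fin n) (s : ℝ) :
    Measure (Fin n → Fin p → ℝ) :=
  ((jointLaw n p ε τ).prod ν).map fun ωw => fun i' j =>
    Function.update ωw.1.1 i s i' * ωw.1.2.1 j + cp * ωw.1.2.2 i' j + ωw.2 i' j

end ARWPaper

namespace ARWPaper

instance (n : ℕ) : IsProbabilityMeasure (gaussPi n) := by unfold gaussPi; infer_instance

instance (n p : ℕ) : IsProbabilityMeasure (noiseLaw n p) := by unfold noiseLaw; infer_instance

instance : IsProbabilityMeasure signLaw := by
  constructor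
  simp [signLaw, ENNReal.inv_two_add_inv_two]

lemma isProbabilityMeasure_muLaw {ε τ : ℝ} (h0 : 0 ≤ ε) (h1 : ε ≤ 1) :
    IsProbabilityMeasure (muLaw ε τ) := by
  constructor
  simp [muLaw, ← ENNReal.ofReal_add (sub_nonneg.2 h1) h0]

/-- The characteristic function of a matrix of i.i.d. standard Gaussian entries. -/
lemma charFunDual_noiseLaw {n p : ℕ} (L : StrongDual ℝ (Fin n → Fin p → ℝ)) :
    charFunDual (noiseLaw n p) L =
      Complex.exp (-((∑ i, ∑ j, (L (Pi.single i (Pi.single j 1))) ^ 2 : ℝ) : ℂ) / 2) := by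
  have h1 (l : StrongDual ℝ ℝ) :
      charFunDual (gaussianReal 0 1) l = Complex.exp (-((l 1 : ℝ) ^ 2 : ℂ) / 2) := by
    have hl (x : ℝ) : l x = l 1 * x := by
      have := l.map_smul x 1
      simp only [smul_eq_mul, mul_one] at this
      rw [this, mul_comm]
    generalize l 1 = a at hl
    have := charFun_gaussianReal (μ := 0) (v := 1) a
    rw [charFunDual_apply]
    rw [charFun_apply_real] at this
    simp only [hl]
    convert this using 1
    · simp
    · simp [neg_div]
  rw [noiseLaw, charFunDual_pi]
  simp only [gaussPi, charFunDual_pi, h1]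
  simp_rw [← Complex.exp_sum]
  congr 1
  push_cast
  simp [Finset.sum_div, neg_div]

/-- Transposing a standard Gaussian matrix gives a standard Gaussian matrix. -/
lemma map_swap_noiseLaw (n p : ℕ) :
    (noiseLaw n p).map Function.swap = noiseLaw p n := by
  let T : (Fin n → Fin p → ℝ) →L[ℝ] (Fin p → Fin n → ℝ) :=
    ContinuousLinearMap.pi fun j => ContinuousLinearMap.pi fun i =>
      (ContinuousLinearMap.proj (R := ℝ) (φ := fun _ : Fin p => ℝ) j).comp
        (ContinuousLinearMap.proj (R := ℝ) (φ := fun _ : Fin n => Fin p → ℝ) i)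
  have hT : (Function.swap : (Fin n → Fin p → ℝ) → _) = T := rfl
  have : IsProbabilityMeasure ((noiseLaw n p).map T) :=
    Measure.isProbabilityMeasure_map T.continuous.aemeasurable
  rw [hT]
  refine Measure.ext_of_charFunDual (funext fun L => ?_)
  rw [charFunDual_map, charFunDual_noiseLaw, charFunDual_noiseLaw, Finset.sum_comm]
  have (i : Fin n) (j : Fin p) :
      T (Pi.single i (Pi.single j 1)) = Pi.single j (Pi.single i 1) := by
    ext a b
    simp only [T, ContinuousLinearMap.coe_pi', ContinuousLinearMap.coe_comp, Function.comp,
      ContinuousLinearMap.proj_apply, Pi.single_apply]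
    split_ifs <;> simp_all
  simp [this]

/-- The linear action of a matrix on `n × p` matrices, seen as vectors. -/
noncomputable def flatMul {n p : ℕ} (M : Matrix (Fin n × Fin p) (Fin n × Fin p) ℝ) :
    (Fin n → Fin p → ℝ) →L[ℝ] (Fin n → Fin p → ℝ) :=
  ContinuousLinearMap.pi fun i => ContinuousLinearMap.pi fun j =>
    ∑ k, ∑ l, M (i, j) (k, l) •
      (ContinuousLinearMap.proj (R := ℝ) (φ := fun _ : Fin p => ℝ) l).comp
        (ContinuousLinearMap.proj (R := ℝ) (φ := fun _ : Fin n => Fin p → ℝ) k)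

lemma flatMul_apply {n p : ℕ} (M : Matrix (Fin n × Fin p) (Fin n × Fin p) ℝ)
    (Z : Fin n → Fin p → ℝ) (i : Fin n) (j : Fin p) :
    flatMul M Z i j = ∑ k, ∑ l, M (i, j) (k, l) * Z k l := by
  simp [flatMul]

lemma dual_eq_sum {n p : ℕ} (L : StrongDual ℝ (Fin n → Fin p → ℝ)) (Z : Fin n → Fin p → ℝ) :
    L Z = ∑ k, ∑ l, L (Pi.single k (Pi.single l 1)) * Z k l := by
  conv_lhs => rw [← Finset.univ_sum_single Z]
  rw [map_sum]
  refine Finset.sum_congr rfl fun k _ => ?_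
  conv_lhs => rw [← Finset.univ_sum_single (Z k)]
  have : Pi.single k (∑ l, Pi.single l (Z k l)) =
      ∑ l, Z k l • (Pi.single k (Pi.single l 1) : Fin n → Fin p → ℝ) := by
    ext a b
    simp only [Finset.sum_apply, Pi.smul_apply, Pi.single_apply]
    split_ifs <;> simp [Pi.single_apply]
  rw [this, map_sum]
  simp [mul_comm]

lemma sum_sq_dual_flatMul {n p : ℕ} (M : Matrix (Fin n × Fin p) (Fin n × Fin p) ℝ)
    (L : StrongDual ℝ (Fin n → Fin p → ℝ)) :
    ∑ i, ∑ j, (L (flatMul M (Pi.single i (Pi.single j 1)))) ^ 2 =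
      (fun x : Fin n × Fin p => L (Pi.single x.1 (Pi.single x.2 1))) ⬝ᵥ
        (M * M.transpose).mulVec
          (fun x : Fin n × Fin p => L (Pi.single x.1 (Pi.single x.2 1))) := by
  set v := fun x : Fin n × Fin p => L (Pi.single x.1 (Pi.single x.2 1))
  have h (i : Fin n) (j : Fin p) :
      L (flatMul M (Pi.single i (Pi.single j 1))) = M.transpose.mulVec v (i, j) := by
    rw [dual_eq_sum]
    simp only [flatMul_apply, Matrix.mulVec, dotProduct, Fintype.sum_prod_type]
    refine Finset.sum_congr rfl fun k _ => Finset.sum_congr rfl fun l _ => ?_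
    rw [Finset.sum_eq_single i (by intro b _ hb; simp [Pi.single_eq_of_ne hb]) (by simp),
      Finset.sum_eq_single j (by intro b _ hb; simp [Pi.single_eq_of_ne hb]) (by simp)]
    simp [v, mul_comm]
  simp only [h]
  rw [← Matrix.mulVec_mulVec, Matrix.dotProduct_mulVec, ← Matrix.mulVec_transpose, dotProduct,
    Fintype.sum_prod_type]
  simp [sq]

open scoped MatrixOrder Matrix.Norms.L2Operator in
lemma exists_eq_conjTranspose_mul_self {ι : Type*} [Fintype ι] {M : Matrix ι ι ℝ}
    (hM : M.PosSemidef) : ∃ V : Matrix ι ι ℝ, M = V.conjTranspose * V :=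
  CStarAlgebra.nonneg_iff_eq_star_mul_self.mp hM.nonneg

/-- Gaussian noise `M z` with `M Mᵀ ≥ c² I` is distributed as `c z` plus independent noise. -/
lemma exists_map_flatMul_noiseLaw {n p : ℕ} (M : Matrix (Fin n × Fin p) (Fin n × Fin p) ℝ)
    (c : ℝ) (hM : ∀ v, c ^ 2 * (v ⬝ᵥ v) ≤ v ⬝ᵥ (M * M.transpose).mulVec v) :
    ∃ W : Matrix (Fin n × Fin p) (Fin n × Fin p) ℝ,
      (noiseLaw n p).map (flatMul M) =
        ((noiseLaw n p).prod (noiseLaw n p)).map fun z => c • z.1 + flatMul W z.2 := by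
  have hpsd : (M * M.transpose - c ^ 2 • (1 : Matrix (Fin n × Fin p) (Fin n × Fin p) ℝ)).PosSemidef := by
    refine Matrix.PosSemidef.of_dotProduct_mulVec_nonneg ?_ fun v => ?_
    · ext i j
      simp [Matrix.mul_apply, Matrix.one_apply, mul_comm, eq_comm]
    · have := hM v
      simp only [star_trivial, Matrix.sub_mulVec, dotProduct_sub, Matrix.smul_mulVec,
        Matrix.one_mulVec, dotProduct_smul, smul_eq_mul]
      linarith
  obtain ⟨W, hW⟩ : ∃ W : Matrix (Fin n × Fin p) (Fin n × Fin p) ℝ,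
      M * M.transpose = c ^ 2 • 1 + W * W.transpose := by
    obtain ⟨V, hV⟩ := exists_eq_conjTranspose_mul_self hpsd
    refine ⟨V.transpose, ?_⟩
    simp only [Matrix.conjTranspose_eq_transpose_of_trivial] at hV
    rw [Matrix.transpose_transpose, ← hV]
    abel
  refine ⟨W, ?_⟩
  let S : ((Fin n → Fin p → ℝ) × (Fin n → Fin p → ℝ)) →L[ℝ] (Fin n → Fin p → ℝ) :=
    c • ContinuousLinearMap.fst ℝ _ _ + (flatMul W).comp (ContinuousLinearMap.snd ℝ _ _)
  have hS : (fun z : (Fin n → Fin p → ℝ) × (Fin n → Fin p → ℝ) => c • z.1 + flatMul W z.2) = S :=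
    rfl
  rw [hS]
  have := Measure.isProbabilityMeasure_map (μ := noiseLaw n p) (flatMul M).continuous.aemeasurable
  have := Measure.isProbabilityMeasure_map (μ := (noiseLaw n p).prod (noiseLaw n p))
    S.continuous.aemeasurable
  refine Measure.ext_of_charFunDual (funext fun L => ?_)
  rw [charFunDual_map, charFunDual_map, charFunDual_prod]
  simp only [charFunDual_noiseLaw, ← Complex.exp_add]
  congr 1
  rw [← add_div, ← neg_add, ← Complex.ofReal_add]
  congr 3
  have hl : ∀ Z, S.comp (ContinuousLinearMap.inl ℝ (Fin n → Fin p → ℝ) (Fin n → Fin p → ℝ)) Z = c • Z := by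
    intro Z; simp [S]
  have hr : ∀ Z, S.comp (ContinuousLinearMap.inr ℝ (Fin n → Fin p → ℝ) (Fin n → Fin p → ℝ)) Z = flatMul W Z := by
    intro Z; simp [S]
  simp only [ContinuousLinearMap.comp_assoc, ContinuousLinearMap.comp_apply (g := L), hl, hr]
  rw [sum_sq_dual_flatMul, sum_sq_dual_flatMul, hW]
  simp only [Matrix.add_mulVec, dotProduct_add, Matrix.smul_mulVec,
        Matrix.one_mulVec, dotProduct_smul, smul_eq_mul, add_left_inj, map_smul, mul_pow]
  simp [dotProduct, Fintype.sum_prod_type, Finset.mul_sum, sq]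

lemma sum_sq_mulVec_le {m k : ℕ} (A : Matrix (Fin m) (Fin k) ℝ) {s : ℝ} (hs : specNorm A ≤ s)
    (v : Fin k → ℝ) : ∑ i, (A.mulVec v i) ^ 2 ≤ s ^ 2 * ∑ j, v j ^ 2 := by
  have hbdd : BddAbove ((fun v => l2 (A.mulVec v)) '' {v | l2 v ≤ 1}) := by
    refine ⟨Real.sqrt (∑ i, ∑ j, A i j ^ 2), ?_⟩
    rintro _ ⟨w, hw, rfl⟩
    have hw1 : ∑ j, w j ^ 2 ≤ 1 := by
      have : l2 w ≤ 1 := hw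
      rwa [l2, Real.sqrt_le_one] at this
    refine Real.sqrt_le_sqrt (Finset.sum_le_sum fun i _ => ?_)
    have h := Finset.sum_mul_sq_le_sq_mul_sq Finset.univ (A i) w
    have h0 : 0 ≤ ∑ j, A i j ^ 2 := by positivity
    calc (A.mulVec w i) ^ 2 ≤ (∑ j, A i j ^ 2) * ∑ j, w j ^ 2 := h
      _ ≤ (∑ j, A i j ^ 2) * 1 := by gcongr
      _ = _ := mul_one _
  rcases eq_or_ne (l2 v) 0 with h0 | h0
  · have h1 : ∑ j, v j ^ 2 = 0 := by
      rwa [l2, Real.sqrt_eq_zero (by positivity)] at h0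
    have h2 : v = 0 := by
      ext j
      have := (Finset.sum_eq_zero_iff_of_nonneg (fun j _ => sq_nonneg (v j))).1 h1 j
        (Finset.mem_univ j)
      simpa using this
    simp [h2]
  · have hpos : 0 < l2 v := lt_of_le_of_ne (Real.sqrt_nonneg _) (Ne.symm h0)
    have hsq : l2 v ^ 2 = ∑ j, v j ^ 2 := Real.sq_sqrt (by positivity)
    have hunit : l2 ((l2 v)⁻¹ • v) ≤ 1 := by
      rw [l2, Real.sqrt_le_one]
      simp only [Pi.smul_apply, smul_eq_mul, mul_pow, ← Finset.mul_sum, ← hsq]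
      rw [← mul_pow, inv_mul_cancel₀ h0, one_pow]
    have h := (le_csSup hbdd ⟨_, hunit, rfl⟩).trans hs
    rw [← hsq]
    generalize l2 v = a at *
    simp only [Matrix.mulVec_smul] at h
    have h' : a⁻¹ ^ 2 * ∑ i, (A.mulVec v i) ^ 2 ≤ s ^ 2 := by
      have h3 := (Real.sqrt_le_left ((Real.sqrt_nonneg _).trans h)).1 h
      simpa only [Pi.smul_apply, smul_eq_mul, mul_pow, ← Finset.mul_sum] using h3
    rw [inv_pow, inv_mul_le_iff₀ (by positivity)] at h'
    linarith

lemma sum_sq_le_sum_sq_mulVec {m : ℕ} {A : Matrix (Fin m) (Fin m) ℝ} (hA : IsUnit A) {s : ℝ}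
    (hs : specNorm A⁻¹ ≤ s) (v : Fin m → ℝ) :
    ∑ j, v j ^ 2 ≤ s ^ 2 * ∑ i, (A.mulVec v i) ^ 2 := by
  have h := sum_sq_mulVec_le A⁻¹ hs (A.mulVec v)
  rwa [Matrix.mulVec_mulVec, Matrix.nonsing_inv_mul _ ((Matrix.isUnit_iff_isUnit_det A).1 hA),
    Matrix.one_mulVec] at h

lemma sum_sq_le_sum_sq_transpose_mulVec {m : ℕ} {A : Matrix (Fin m) (Fin m) ℝ} (hA : IsUnit A)
    {s : ℝ} (hs : specNorm A⁻¹ ≤ s) (v : Fin m → ℝ) :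
    ∑ j, v j ^ 2 ≤ s ^ 2 * ∑ i, (A.transpose.mulVec v i) ^ 2 := by
  have h1 := sum_sq_mulVec_le A⁻¹ hs v
  have h2 : ∑ j, v j ^ 2 = ∑ j, A.transpose.mulVec v j * A⁻¹.mulVec v j := by
    have : v ⬝ᵥ v = A.transpose.mulVec v ⬝ᵥ A⁻¹.mulVec v := by
      rw [Matrix.mulVec_transpose, ← Matrix.dotProduct_mulVec, Matrix.mulVec_mulVec,
        Matrix.mul_nonsing_inv _ ((Matrix.isUnit_iff_isUnit_det A).1 hA), Matrix.one_mulVec]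
    simpa [dotProduct, sq] using this
  have h3 := Finset.sum_mul_sq_le_sq_mul_sq Finset.univ (A.transpose.mulVec v) (A⁻¹.mulVec v)
  rw [← h2] at h3
  set Q := ∑ j, v j ^ 2
  set R := ∑ i, (A.transpose.mulVec v i) ^ 2
  have hR : 0 ≤ R := by positivity
  rcases (show 0 ≤ Q by positivity).eq_or_lt with hQ | hQ
  · rw [← hQ]; positivity
  · have : Q * Q ≤ (s ^ 2 * R) * Q := by
      calc Q * Q = Q ^ 2 := (sq Q).symm
        _ ≤ R * ∑ i, (A⁻¹.mulVec v i) ^ 2 := h3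
        _ ≤ R * (s ^ 2 * Q) := by gcongr
        _ = _ := by ring
    exact le_of_mul_le_mul_right this hQ

/-- Colored Gaussian noise `A Z B` dominates white noise: it is distributed as `c Z` plus an
independent noise. -/
lemma exists_map_mul_mul_noiseLaw {n p : ℕ} {A : Matrix (Fin n) (Fin n) ℝ}
    {B : Matrix (Fin p) (Fin p) ℝ} (hA : IsUnit A) (hB : IsUnit B) {s c : ℝ}
    (hAs : specNorm A⁻¹ ≤ s) (hBs : specNorm B⁻¹ ≤ s) (hc : c ^ 2 * s ^ 4 ≤ 1) :
    ∃ W : Matrix (Fin n × Fin p) (Fin n × Fin p) ℝ,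
      (noiseLaw n p).map (fun Z i j => (A * Matrix.of Z * B) i j) =
        ((noiseLaw n p).prod (noiseLaw n p)).map fun z => c • z.1 + flatMul W z.2 := by
  let M : Matrix (Fin n × Fin p) (Fin n × Fin p) ℝ := Matrix.of fun x y => A x.1 y.1 * B y.2 x.2
  have hMZ : (fun (Z : Fin n → Fin p → ℝ) i j => (A * Matrix.of Z * B) i j) = flatMul M := by
    ext Z i j
    rw [flatMul_apply, Matrix.mul_apply, Finset.sum_comm]
    simp only [Matrix.mul_apply, M, Matrix.of_apply, Finset.sum_mul]
    exact Finset.sum_congr rfl fun l _ => Finset.sum_congr rfl fun k _ => by ring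
  rw [hMZ]
  refine exists_map_flatMul_noiseLaw M c fun v => ?_
  let u (k : Fin n) (j : Fin p) : ℝ := A.transpose.mulVec (fun i => v (i, j)) k
  have hMv (k : Fin n) (l : Fin p) : M.transpose.mulVec v (k, l) = B.mulVec (u k) l := by
    simp only [Matrix.mulVec, dotProduct, u, M, Fintype.sum_prod_type, Matrix.transpose_apply,
      Matrix.of_apply, Finset.mul_sum]
    rw [Finset.sum_comm]
    exact Finset.sum_congr rfl fun l _ => Finset.sum_congr rfl fun k _ => by ring
  have hB' (k : Fin n) := sum_sq_le_sum_sq_mulVec hB hBs (u k)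
  have hA' (j : Fin p) := sum_sq_le_sum_sq_transpose_mulVec hA hAs (fun i => v (i, j))
  have e1 : v ⬝ᵥ (M * M.transpose).mulVec v = ∑ k, ∑ l, (B.mulVec (u k) l) ^ 2 := by
    rw [← Matrix.mulVec_mulVec, Matrix.dotProduct_mulVec, ← Matrix.mulVec_transpose, dotProduct,
      Fintype.sum_prod_type]
    simp [hMv, sq]
  have e2 : v ⬝ᵥ v ≤ s ^ 2 * (s ^ 2 * ∑ k, ∑ l, (B.mulVec (u k) l) ^ 2) := by
    calc v ⬝ᵥ v = ∑ j, ∑ i, v (i, j) ^ 2 := by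
          rw [dotProduct, Fintype.sum_prod_type_right]; simp [sq]
      _ ≤ ∑ j, s ^ 2 * ∑ k, u k j ^ 2 := Finset.sum_le_sum fun j _ => hA' j
      _ = s ^ 2 * ∑ k, ∑ j, u k j ^ 2 := by rw [← Finset.mul_sum, Finset.sum_comm]
      _ ≤ s ^ 2 * ∑ k, s ^ 2 * ∑ l, (B.mulVec (u k) l) ^ 2 := by
          gcongr with k _; exact hB' k
      _ = _ := by rw [← Finset.mul_sum]
  rw [e1]
  set R := ∑ k, ∑ l, (B.mulVec (u k) l) ^ 2
  have hR : 0 ≤ R := by positivity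
  calc c ^ 2 * (v ⬝ᵥ v) ≤ c ^ 2 * (s ^ 2 * (s ^ 2 * R)) := by gcongr
    _ = (c ^ 2 * s ^ 4) * R := by ring
    _ ≤ 1 * R := by gcongr
    _ = R := one_mul R

lemma pi_withDensity_ofReal {ι : Type*} [Fintype ι] {E : ι → Type*} [∀ i, MeasurableSpace (E i)]
    (μ : ∀ i, Measure (E i)) [∀ i, SigmaFinite (μ i)] {r : ∀ i, E i → ℝ}
    (hr : ∀ i, Integrable (r i) (μ i)) (hr0 : ∀ i x, 0 ≤ r i x) :
    Measure.pi (fun i => (μ i).withDensity fun x => ENNReal.ofReal (r i x)) =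
      (Measure.pi μ).withDensity fun x => ENNReal.ofReal (∏ i, r i (x i)) := by
  refine Measure.pi_eq fun s hs => ?_
  rw [withDensity_apply _ (MeasurableSet.univ_pi hs), Measure.restrict_pi_pi,
    ← ofReal_integral_eq_lintegral_ofReal, integral_fintype_prod_eq_prod,
    ENNReal.ofReal_prod_of_nonneg (fun i _ => integral_nonneg (hr0 i))]
  · refine Finset.prod_congr rfl fun i _ => ?_
    rw [withDensity_apply _ (hs i), ofReal_integral_eq_lintegral_ofReal (hr i).restrict
      (ae_of_all _ (hr0 i))]
  · exact Integrable.fintype_prod_dep fun i => (hr i).restrict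
  · exact ae_of_all _ fun x => Finset.prod_nonneg fun i _ => hr0 i _

/-- A tensorized `χ²` bound for the total variation distance between product measures. -/
lemma abs_pi_sub_pi_le {E : Type*} [MeasurableSpace E] {P Q : Measure E} [IsProbabilityMeasure P]
    [IsProbabilityMeasure Q]
    {r : E → ℝ} (hr0 : ∀ x, 0 ≤ r x) (hr : Integrable r P) (hr2 : Integrable (fun x => r x ^ 2) P)
    (hQ : Q = P.withDensity fun x => ENNReal.ofReal (r x)) {C κ : ℝ}
    (hC : ∫ x, r x ^ 2 ∂P ≤ 1 + C) (p : ℕ) (hκ : 0 < κ) (hpC : Real.exp (p * C) - 1 ≤ κ ^ 2)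
    {S : Set (Fin p → E)} (hS : MeasurableSet S) :
    |(Measure.pi fun _ : Fin p => Q).real S - (Measure.pi fun _ : Fin p => P).real S| ≤ κ := by
  set PP := Measure.pi fun _ : Fin p => P with hPP
  set R : (Fin p → E) → ℝ := fun x => ∏ j, r (x j)
  have hR0 (x) : 0 ≤ R x := Finset.prod_nonneg fun _ _ => hr0 _
  have hRi : Integrable R PP := Integrable.fintype_prod_dep fun _ => hr
  have hR2 : ∀ x, R x ^ 2 = ∏ j, r (x j) ^ 2 := fun x => (Finset.prod_pow _ _ _).symm
  have hR2i : Integrable (fun x => R x ^ 2) PP := by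
    simp only [hR2]
    exact Integrable.fintype_prod_dep fun _ => hr2
  have hQQ : (Measure.pi fun _ : Fin p => Q) = PP.withDensity fun x => ENNReal.ofReal (R x) := by
    rw [hQ]
    exact pi_withDensity_ofReal (fun _ => P) (fun _ => hr) (fun _ => hr0)
  have hr1 : ∫ x, r x ∂P = 1 := by
    have h : Q Set.univ = 1 := measure_univ
    rw [hQ, withDensity_apply _ MeasurableSet.univ, Measure.restrict_univ,
      ← ofReal_integral_eq_lintegral_ofReal hr (ae_of_all _ hr0)] at h
    simpa using congrArg ENNReal.toReal h |>.symm.trans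
      (ENNReal.toReal_ofReal (integral_nonneg hr0)) |>.symm
  have hR1 : ∫ x, R x ∂PP = 1 := by
    rw [integral_fintype_prod_eq_prod]; simp [hr1]
  have hQS : (Measure.pi fun _ : Fin p => Q).real S = ∫ x in S, R x ∂PP := by
    rw [hQQ, measureReal_def, withDensity_apply _ hS,
      ← ofReal_integral_eq_lintegral_ofReal hRi.restrict (ae_of_all _ hR0),
      ENNReal.toReal_ofReal (integral_nonneg hR0)]
  have hPS : PP.real S = ∫ x in S, (1 : ℝ) ∂PP := by simp
  have hint : ∫ x, (R x - 1) ^ 2 ∂PP ≤ κ ^ 2 := by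
    have e : ∀ x, (R x - 1) ^ 2 = R x ^ 2 - 2 * R x + 1 := fun x => by ring
    simp only [e]
    have hsub2 : Integrable (fun x => R x ^ 2 - 2 * R x) PP := hR2i.sub (hRi.const_mul 2)
    rw [integral_add hsub2 (integrable_const _),
      integral_sub hR2i (hRi.const_mul 2), integral_const_mul, hR1]
    simp only [hR2]
    rw [hPP, integral_fintype_prod_eq_prod (fun _ x => r x ^ 2)]
    have h0 : 0 ≤ ∫ x, r x ^ 2 ∂P := integral_nonneg fun x => sq_nonneg _
    have h1 : (∫ x, r x ^ 2 ∂P) ^ p ≤ Real.exp (p * C) := by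
      rw [Real.exp_nat_mul]
      refine pow_le_pow_left₀ h0 (hC.trans ?_) p
      linarith [Real.add_one_le_exp C]
    simp only [Finset.prod_const, Finset.card_univ, Fintype.card_fin, integral_const,
      probReal_univ, smul_eq_mul]
    linarith
  have hsq : Integrable (fun x => (R x - 1) ^ 2) PP := by
    have e : ∀ x, (R x - 1) ^ 2 = R x ^ 2 - 2 * R x + 1 := fun x => by ring
    simp only [e]
    exact (hR2i.sub (hRi.const_mul 2)).add (integrable_const _)
  have hsub : Integrable (fun x => R x - 1) PP := hRi.sub (integrable_const _)
  rw [hQS, hPS, ← integral_sub hRi.restrict (integrable_const _)]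
  calc |∫ x in S, (R x - 1) ∂PP| ≤ ∫ x in S, |R x - 1| ∂PP := abs_integral_le_integral_abs
    _ ≤ ∫ x, |R x - 1| ∂PP :=
        setIntegral_le_integral hsub.abs (ae_of_all _ fun x => abs_nonneg _)
    _ ≤ ∫ x, (κ / 2 + (2 * κ)⁻¹ * (R x - 1) ^ 2) ∂PP := by
        refine integral_mono hsub.abs ((integrable_const _).add (hsq.const_mul _)) fun x => ?_
        have h2 : κ / 2 + (2 * κ)⁻¹ * (R x - 1) ^ 2 - |R x - 1| =
            (2 * κ)⁻¹ * (|R x - 1| - κ) ^ 2 := by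
          rw [← sq_abs (R x - 1)]; field_simp; ring
        have h3 : 0 ≤ (2 * κ)⁻¹ * (|R x - 1| - κ) ^ 2 := by positivity
        simp only
        linarith
    _ = κ / 2 + (2 * κ)⁻¹ * ∫ x, (R x - 1) ^ 2 ∂PP := by
        rw [integral_add (integrable_const _) (hsq.const_mul _), integral_const_mul]; simp
    _ ≤ κ / 2 + (2 * κ)⁻¹ * κ ^ 2 := by gcongr
    _ = κ := by field_simp; ring

/-- The likelihood ratio of `N(a, I)` with respect to `N(0, I)`. -/
noncomputable def gaussLR {n : ℕ} (a x : Fin n → ℝ) : ℝ :=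
  Real.exp (∑ i, a i * x i - (∑ i, a i ^ 2) / 2)

lemma measurable_gaussLR {n : ℕ} (a : Fin n → ℝ) : Measurable (gaussLR a) := by
  unfold gaussLR; fun_prop

lemma gaussLR_pos {n : ℕ} (a x : Fin n → ℝ) : 0 < gaussLR a x := Real.exp_pos _

lemma integrable_exp_gaussPi {n : ℕ} (b : Fin n → ℝ) :
    Integrable (fun x => Real.exp (∑ i, b i * x i)) (gaussPi n) := by
  simp only [Real.exp_sum]
  exact Integrable.fintype_prod_dep fun i => integrable_exp_mul_gaussianReal (b i)

lemma integral_exp_gaussPi {n : ℕ} (b : Fin n → ℝ) :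
    ∫ x, Real.exp (∑ i, b i * x i) ∂gaussPi n = Real.exp ((∑ i, b i ^ 2) / 2) := by
  simp only [Real.exp_sum]
  rw [gaussPi, integral_fintype_prod_eq_prod (fun i x => Real.exp (b i * x)), Finset.sum_div,
    Real.exp_sum]
  refine Finset.prod_congr rfl fun i _ => ?_
  have := congrFun (mgf_fun_id_gaussianReal (μ := 0) (v := 1)) (b i)
  simpa [mgf] using this

lemma integrable_gaussLR {n : ℕ} (a : Fin n → ℝ) : Integrable (gaussLR a) (gaussPi n) := by
  unfold gaussLR
  simp only [Real.exp_sub]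
  exact (integrable_exp_gaussPi a).div_const _

lemma gaussianReal_eq_withDensity (m : ℝ) :
    gaussianReal m 1 = (gaussianReal 0 1).withDensity
      fun x => ENNReal.ofReal (Real.exp (m * x - m ^ 2 / 2)) := by
  rw [gaussianReal_of_var_ne_zero _ one_ne_zero, gaussianReal_of_var_ne_zero _ one_ne_zero,
    ← withDensity_mul _ (measurable_gaussianPDF _ _) (by fun_prop)]
  congr 1
  ext x
  rw [Pi.mul_apply, gaussianPDF, gaussianPDF, ← ENNReal.ofReal_mul (gaussianPDFReal_nonneg _ _ _)]
  simp only [gaussianPDFReal, mul_assoc, ← Real.exp_add]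
  congr 4
  simp; ring

lemma map_add_gaussPi {n : ℕ} (a : Fin n → ℝ) :
    (gaussPi n).map (fun z i => a i + z i) =
      (gaussPi n).withDensity fun x => ENNReal.ofReal (gaussLR a x) := by
  rw [gaussPi, Measure.pi_map_pi (f := fun i z => a i + z) (fun i => by fun_prop)]
  simp only [gaussianReal_map_const_add, zero_add]
  conv_lhs => enter [1, i]; rw [gaussianReal_eq_withDensity]
  rw [pi_withDensity_ofReal]
  · congr 1; ext x
    rw [← Real.exp_sum, gaussLR, Finset.sum_sub_distrib, Finset.sum_div]
  · intro i
    simp only [Real.exp_sub]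
    exact (integrable_exp_mul_gaussianReal (a i)).div_const _
  · intro i x; positivity

/-- The likelihood ratio, with respect to `N(0, I)`, of the mixture
`(1 - ε) N(0, I) + ε N(a, I)`. -/
noncomputable def mixLR (ε : ℝ) {n : ℕ} (a x : Fin n → ℝ) : ℝ := 1 - ε + ε * gaussLR a x

lemma measurable_mixLR (ε : ℝ) {n : ℕ} (a : Fin n → ℝ) : Measurable (mixLR ε a) :=
  measurable_const.add (measurable_const.mul (measurable_gaussLR a))

lemma integrable_mixLR (ε : ℝ) {n : ℕ} (a : Fin n → ℝ) : Integrable (mixLR ε a) (gaussPi n) :=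
  (integrable_const _).add ((integrable_gaussLR a).const_mul _)

lemma mixLR_pos {ε : ℝ} (h0 : 0 ≤ ε) (h1 : ε < 1) {n : ℕ} (a x : Fin n → ℝ) : 0 < mixLR ε a x := by
  have := gaussLR_pos a x
  have : 0 ≤ ε * gaussLR a x := by positivity
  unfold mixLR; linarith

/-- The law of a column `w m + z` of the data matrix, with `m` the column mean level. -/
lemma map_column {ε τ : ℝ} (h0 : 0 ≤ ε) (h1 : ε ≤ 1) {n : ℕ} (w : Fin n → ℝ) :
    ((muLaw ε τ).prod (gaussPi n)).map (fun mz i => w i * mz.1 + mz.2 i) =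
      (gaussPi n).withDensity fun x => ENNReal.ofReal (mixLR ε (fun i => w i * τ) x) := by
  have hmeas : Measurable fun (mz : ℝ × (Fin n → ℝ)) (i : Fin n) => w i * mz.1 + mz.2 i := by
    fun_prop
  have hd (m : ℝ) : ((Measure.dirac m).prod (gaussPi n)).map
      (fun mz i => w i * mz.1 + mz.2 i) =
        (gaussPi n).withDensity fun x => ENNReal.ofReal (gaussLR (fun i => w i * m) x) := by
    rw [Measure.dirac_prod, Measure.map_map hmeas (by fun_prop), ← map_add_gaussPi]
    rfl
  have h00 : (fun x : Fin n → ℝ => ENNReal.ofReal (gaussLR (fun i => w i * 0) x)) = 1 := by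
    ext x; simp [gaussLR]
  rw [muLaw, Measure.add_prod, Measure.prod_smul_left, Measure.prod_smul_left,
    Measure.map_add _ _ hmeas, Measure.map_smul, Measure.map_smul, hd, hd, h00,
    ← withDensity_smul _ measurable_one,
    ← withDensity_smul _ (measurable_gaussLR _).ennreal_ofReal,
    ← withDensity_add_left (measurable_one.const_smul _)]
  congr 1; ext x
  simp only [Pi.add_apply, Pi.smul_apply, smul_eq_mul, Pi.one_apply, mul_one, mixLR]
  rw [← ENNReal.ofReal_mul h0, ← ENNReal.ofReal_add (by linarith)
    (mul_nonneg h0 (gaussLR_pos _ _).le)]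

lemma integrable_gaussLR_mul {n : ℕ} (a b : Fin n → ℝ) :
    Integrable (fun x => gaussLR a x * gaussLR b x) (gaussPi n) := by
  have e (x) : gaussLR a x * gaussLR b x = Real.exp (-((∑ i, a i ^ 2) + ∑ i, b i ^ 2) / 2) *
      Real.exp (∑ i, (a i + b i) * x i) := by
    simp only [gaussLR, ← Real.exp_add, add_mul, Finset.sum_add_distrib]
    congr 1; ring
  simp only [e]
  exact (integrable_exp_gaussPi _).const_mul _

lemma integral_gaussLR_mul {n : ℕ} (a b : Fin n → ℝ) :
    ∫ x, gaussLR a x * gaussLR b x ∂gaussPi n = Real.exp (∑ i, a i * b i) := by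
  have e (x) : gaussLR a x * gaussLR b x = Real.exp (-((∑ i, a i ^ 2) + ∑ i, b i ^ 2) / 2) *
      Real.exp (∑ i, (a i + b i) * x i) := by
    simp only [gaussLR, ← Real.exp_add, add_mul, Finset.sum_add_distrib]
    congr 1; ring
  simp only [e]
  rw [integral_const_mul, integral_exp_gaussPi, ← Real.exp_add]
  congr 1
  simp only [add_sq, Finset.sum_add_distrib, mul_assoc, ← Finset.mul_sum]
  ring

lemma gaussLR_sq_div {n : ℕ} (a b x : Fin n → ℝ) :
    gaussLR b x ^ 2 / gaussLR a x =
      Real.exp (-(∑ i, b i ^ 2) + (∑ i, a i ^ 2) / 2) * Real.exp (∑ i, (2 * b i - a i) * x i) := by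
  simp only [gaussLR, ← Real.exp_add, ← Real.exp_nat_mul, ← Real.exp_sub, sub_mul,
    Finset.sum_sub_distrib, mul_assoc, ← Finset.mul_sum]
  congr 1; push_cast; ring

lemma integrable_gaussLR_sq_div {n : ℕ} (a b : Fin n → ℝ) :
    Integrable (fun x => gaussLR b x ^ 2 / gaussLR a x) (gaussPi n) := by
  simp only [gaussLR_sq_div]
  exact (integrable_exp_gaussPi _).const_mul _

lemma integral_gaussLR_sq_div {n : ℕ} (a b : Fin n → ℝ) :
    ∫ x, gaussLR b x ^ 2 / gaussLR a x ∂gaussPi n = Real.exp (∑ i, (a i - b i) ^ 2) := by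
  simp only [gaussLR_sq_div]
  rw [integral_const_mul, integral_exp_gaussPi, ← Real.exp_add]
  congr 1
  simp only [sub_sq, mul_pow, Finset.sum_add_distrib, Finset.sum_sub_distrib, mul_assoc,
    ← Finset.mul_sum, mul_comm (b _)]
  ring

lemma integral_gaussLR {n : ℕ} (a : Fin n → ℝ) : ∫ x, gaussLR a x ∂gaussPi n = 1 := by
  have := integral_gaussLR_mul a 0
  simpa [gaussLR] using this

lemma integral_mixLR (ε : ℝ) {n : ℕ} (a : Fin n → ℝ) : ∫ x, mixLR ε a x ∂gaussPi n = 1 := by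
  unfold mixLR
  rw [integral_add (integrable_const _) ((integrable_gaussLR a).const_mul _), integral_const_mul,
    integral_gaussLR]
  simp

/-- A bound for the `χ²` divergence between two mixtures, given an integrable majorant. -/
lemma chiSq_mixLR_le {ε : ℝ} (h0 : 0 ≤ ε) (h1 : ε < 1) {n : ℕ} (a b : Fin n → ℝ)
    {g : (Fin n → ℝ) → ℝ} (hg : Integrable g (gaussPi n))
    (hle : ∀ x, (ε * (gaussLR b x - gaussLR a x)) ^ 2 / mixLR ε a x ≤ g x) :
    let P := (gaussPi n).withDensity fun x => ENNReal.ofReal (mixLR ε a x)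
    Integrable (fun x => (mixLR ε b x / mixLR ε a x) ^ 2) P ∧
      ∫ x, (mixLR ε b x / mixLR ε a x) ^ 2 ∂P ≤ 1 + ∫ x, g x ∂gaussPi n := by
  intro P
  have hma := measurable_mixLR ε a
  have hmb := measurable_mixLR ε b
  have hpa := mixLR_pos h0 h1 a
  have e (x) : mixLR ε a x • (mixLR ε b x / mixLR ε a x) ^ 2 =
      (ε * (gaussLR b x - gaussLR a x)) ^ 2 / mixLR ε a x + (2 * mixLR ε b x - mixLR ε a x) := by
    have h := (hpa x).ne'
    have : ε * (gaussLR b x - gaussLR a x) = mixLR ε b x - mixLR ε a x := by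
      unfold mixLR; ring
    rw [this, smul_eq_mul]; field_simp; ring
  have hlin : Integrable (fun x => 2 * mixLR ε b x - mixLR ε a x) (gaussPi n) :=
    ((integrable_mixLR ε b).const_mul 2).sub (integrable_mixLR ε a)
  have hq : Integrable (fun x => (ε * (gaussLR b x - gaussLR a x)) ^ 2 / mixLR ε a x)
      (gaussPi n) := by
    refine hg.mono' ?_ (ae_of_all _ fun x => ?_)
    · have := measurable_gaussLR a
      have := measurable_gaussLR b
      exact Measurable.aestronglyMeasurable (by fun_prop)
    · rw [Real.norm_of_nonneg (div_nonneg (sq_nonneg _) (hpa x).le)]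
      exact hle x
  constructor
  · rw [integrable_withDensity_iff_integrable_smul' hma.ennreal_ofReal (by simp)]
    simp only [fun x => ENNReal.toReal_ofReal (hpa x).le, e]
    exact hq.add hlin
  · rw [integral_withDensity_eq_integral_toReal_smul hma.ennreal_ofReal (by simp)]
    simp only [fun x => ENNReal.toReal_ofReal (hpa x).le, e]
    rw [integral_add hq hlin, integral_sub ((integrable_mixLR ε b).const_mul 2)
      (integrable_mixLR ε a), integral_const_mul, integral_mixLR, integral_mixLR]
    linarith [integral_mono hq hg hle]

/-- A `χ²` bound for two mixtures which is effective for weak signals. -/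
lemma chiSq_mixLR_le_weak {ε : ℝ} (h0 : 0 ≤ ε) (h1 : ε < 1) {n : ℕ} {a b : Fin n → ℝ}
    (hab : ∑ i, b i ^ 2 = ∑ i, a i ^ 2) :
    let P := (gaussPi n).withDensity fun x => ENNReal.ofReal (mixLR ε a x)
    Integrable (fun x => (mixLR ε b x / mixLR ε a x) ^ 2) P ∧
      ∫ x, (mixLR ε b x / mixLR ε a x) ^ 2 ∂P ≤
        1 + ε ^ 2 / (1 - ε) * (Real.exp (∑ i, a i ^ 2) * ∑ i, (a i - b i) ^ 2) := by
  have h1' : 0 < 1 - ε := by linarith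
  have hg : Integrable (fun x => ε ^ 2 / (1 - ε) * (gaussLR b x * gaussLR b x -
      2 * (gaussLR b x * gaussLR a x) + gaussLR a x * gaussLR a x)) (gaussPi n) :=
    (((integrable_gaussLR_mul b b).sub ((integrable_gaussLR_mul b a).const_mul 2)).add
      (integrable_gaussLR_mul a a)).const_mul _
  have h := chiSq_mixLR_le h0 h1 a b hg fun x => by
    have hx : 1 - ε ≤ mixLR ε a x := by
      have := mul_nonneg h0 (gaussLR_pos a x).le
      unfold mixLR; linarith
    calc _ ≤ (ε * (gaussLR b x - gaussLR a x)) ^ 2 / (1 - ε) := by gcongr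
      _ = _ := by ring
  refine ⟨h.1, h.2.trans ?_⟩
  have hs : Integrable (fun x => gaussLR b x * gaussLR b x - 2 * (gaussLR b x * gaussLR a x))
      (gaussPi n) := (integrable_gaussLR_mul b b).sub ((integrable_gaussLR_mul b a).const_mul 2)
  rw [integral_const_mul, integral_add hs (integrable_gaussLR_mul a a),
    integral_sub (integrable_gaussLR_mul b b) ((integrable_gaussLR_mul b a).const_mul 2),
    integral_const_mul, integral_gaussLR_mul, integral_gaussLR_mul, integral_gaussLR_mul]
  gcongr
  simp only [← sq, hab]
  have e1 : ∑ i, (a i - b i) ^ 2 = 2 * ∑ i, a i ^ 2 - 2 * ∑ i, b i * a i := by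
    simp only [sub_sq, Finset.sum_add_distrib, Finset.sum_sub_distrib, mul_assoc,
      ← Finset.mul_sum, hab, mul_comm (b _)]
    ring
  rw [e1]
  set u := ∑ i, a i ^ 2
  set v := ∑ i, b i * a i
  have h2 : Real.exp v = Real.exp u * Real.exp (v - u) := by rw [← Real.exp_add]; ring_nf
  have h3 := Real.add_one_le_exp (v - u)
  rw [h2]
  nlinarith [Real.exp_pos u]

/-- A `χ²` bound for two mixtures which is effective for sparse signals. -/
lemma chiSq_mixLR_le_sparse {ε : ℝ} (h0 : 0 < ε) (h1 : ε < 1) {n : ℕ} (a b : Fin n → ℝ) :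
    let P := (gaussPi n).withDensity fun x => ENNReal.ofReal (mixLR ε a x)
    Integrable (fun x => (mixLR ε b x / mixLR ε a x) ^ 2) P ∧
      ∫ x, (mixLR ε b x / mixLR ε a x) ^ 2 ∂P ≤
        1 + ε * (Real.exp (∑ i, (a i - b i) ^ 2) - 1) := by
  have hg : Integrable (fun x => ε * (gaussLR b x ^ 2 / gaussLR a x -
      2 * gaussLR b x + gaussLR a x)) (gaussPi n) :=
    (((integrable_gaussLR_sq_div a b).sub ((integrable_gaussLR b).const_mul 2)).add
      (integrable_gaussLR a)).const_mul _
  have h := chiSq_mixLR_le h0.le h1 a b hg fun x => by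
    have ha := gaussLR_pos a x
    have hx : ε * gaussLR a x ≤ mixLR ε a x := by
      unfold mixLR; linarith
    calc _ ≤ (ε * (gaussLR b x - gaussLR a x)) ^ 2 / (ε * gaussLR a x) := by gcongr
      _ = _ := by field_simp; ring
  refine ⟨h.1, h.2.trans ?_⟩
  have hs : Integrable (fun x => gaussLR b x ^ 2 / gaussLR a x - 2 * gaussLR b x) (gaussPi n) :=
    (integrable_gaussLR_sq_div a b).sub ((integrable_gaussLR b).const_mul 2)
  rw [integral_const_mul, integral_add hs (integrable_gaussLR a),
    integral_sub (integrable_gaussLR_sq_div a b) ((integrable_gaussLR b).const_mul 2),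
    integral_const_mul, integral_gaussLR_sq_div, integral_gaussLR, integral_gaussLR]
  apply le_of_eq; ring

lemma map_columns {ε τ : ℝ} (h0 : 0 ≤ ε) (hε1 : ε ≤ 1) (n p : ℕ) (w : Fin n → ℝ) :
    ((Measure.pi fun _ : Fin p => muLaw ε τ).prod (noiseLaw n p)).map
        (fun mz j i => w i * mz.1 j + mz.2 i j) =
      Measure.pi fun _ : Fin p => (gaussPi n).withDensity
        fun x => ENNReal.ofReal (mixLR ε (fun i => w i * τ) x) := by
  have := isProbabilityMeasure_muLaw (τ := τ) h0 hε1
  have hsw : MeasurePreserving (Function.swap : (Fin n → Fin p → ℝ) → (Fin p → Fin n → ℝ))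
      (noiseLaw n p) (noiseLaw p n) := ⟨by unfold Function.swap; fun_prop, map_swap_noiseLaw n p⟩
  have h1 := (MeasurePreserving.id (Measure.pi fun _ : Fin p => muLaw ε τ)).prod hsw
  have h2 := measurePreserving_arrowProdEquivProdArrow ℝ (Fin n → ℝ) (Fin p)
    (fun _ => muLaw ε τ) (fun _ => gaussPi n)
  have hm : Measurable fun (mz : ℝ × (Fin n → ℝ)) (i : Fin n) => w i * mz.1 + mz.2 i := by
    fun_prop
  have hcol : Measurable fun (mz : (Fin p → ℝ) × (Fin p → Fin n → ℝ)) (j : Fin p) (i : Fin n) =>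
      w i * mz.1 j + mz.2 j i := by fun_prop
  calc _ = (((Measure.pi fun _ : Fin p => muLaw ε τ).prod (noiseLaw n p)).map
        (Prod.map id Function.swap)).map (fun mz j i => w i * mz.1 j + mz.2 j i) := by
        rw [Measure.map_map hcol h1.measurable]; rfl
    _ = ((Measure.pi fun _ : Fin p => (muLaw ε τ).prod (gaussPi n)).map
        (MeasurableEquiv.arrowProdEquivProdArrow ℝ (Fin n → ℝ) (Fin p))).map
          (fun mz j i => w i * mz.1 j + mz.2 j i) := by
        rw [h1.map_eq, h2.map_eq]; rfl
    _ = (Measure.pi fun _ : Fin p => (muLaw ε τ).prod (gaussPi n)).map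
          (fun x j i => w i * (x j).1 + (x j).2 i) := by
        rw [Measure.map_map hcol h2.measurable]; rfl
    _ = _ := by
        have : IsProbabilityMeasure (((muLaw ε τ).prod (gaussPi n)).map
            fun mz i => w i * mz.1 + mz.2 i) := Measure.isProbabilityMeasure_map hm.aemeasurable
        refine (Measure.pi_map_pi (μ := fun _ : Fin p => (muLaw ε τ).prod (gaussPi n))
          (f := fun _ mz i => w i * mz.1 + mz.2 i) fun _ => hm.aemeasurable).trans ?_
        congr 1; ext j : 1
        exact map_column h0 hε1 w

/-- The column-wise `χ²` bound under which the data laws for `w` and `w'` are close. -/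
def ChiSqLE (ε τ : ℝ) {n : ℕ} (w w' : Fin n → ℝ) (C : ℝ) : Prop :=
  let P := (gaussPi n).withDensity fun x => ENNReal.ofReal (mixLR ε (fun i => w i * τ) x)
  let r := fun x => mixLR ε (fun i => w' i * τ) x / mixLR ε (fun i => w i * τ) x
  Integrable (fun x => r x ^ 2) P ∧ ∫ x, r x ^ 2 ∂P ≤ 1 + C

lemma isProbabilityMeasure_mix {ε : ℝ} (h0 : 0 ≤ ε) (h1 : ε < 1) {n : ℕ} (a : Fin n → ℝ) :
    IsProbabilityMeasure
      ((gaussPi n).withDensity fun x => ENNReal.ofReal (mixLR ε a x)) := by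
  constructor
  rw [withDensity_apply _ MeasurableSet.univ, Measure.restrict_univ,
    ← ofReal_integral_eq_lintegral_ofReal (integrable_mixLR ε a)
      (ae_of_all _ fun x => (mixLR_pos h0 h1 a x).le), integral_mixLR, ENNReal.ofReal_one]

lemma white_measure_le {ε τ C κ : ℝ} (h0 : 0 < ε) (h1 : ε < 1) {n p : ℕ} {w w' : Fin n → ℝ}
    (hχ : ChiSqLE ε τ w w' C) (hκ : 0 < κ) (hpC : Real.exp (p * C) - 1 ≤ κ ^ 2)
    {S : Set (Fin n → Fin p → ℝ)} (hS : MeasurableSet S) :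
    let ν := (Measure.pi fun _ : Fin p => muLaw ε τ).prod (noiseLaw n p)
    ν {mz | (fun i j => w i * mz.1 j + mz.2 i j) ∈ S} ≤
      ν {mz | (fun i j => w' i * mz.1 j + mz.2 i j) ∈ S} + ENNReal.ofReal κ := by
  intro ν
  set a : Fin n → ℝ := fun i => w i * τ
  set b : Fin n → ℝ := fun i => w' i * τ
  set P := (gaussPi n).withDensity fun x => ENNReal.ofReal (mixLR ε a x) with hP
  set Q := (gaussPi n).withDensity fun x => ENNReal.ofReal (mixLR ε b x) with hQ
  have : IsProbabilityMeasure P := isProbabilityMeasure_mix h0.le h1 a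
  have : IsProbabilityMeasure Q := isProbabilityMeasure_mix h0.le h1 b
  have hsw : Measurable (Function.swap : (Fin p → Fin n → ℝ) → (Fin n → Fin p → ℝ)) := by
    unfold Function.swap; fun_prop
  have hS' : MeasurableSet (Function.swap ⁻¹' S : Set (Fin p → Fin n → ℝ)) := hsw hS
  have key (u : Fin n → ℝ) : ν {mz | (fun i j => u i * mz.1 j + mz.2 i j) ∈ S} =
      (Measure.pi fun _ : Fin p => (gaussPi n).withDensity
        fun x => ENNReal.ofReal (mixLR ε (fun i => u i * τ) x)) (Function.swap ⁻¹' S) := by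
    rw [← map_columns h0.le h1.le, Measure.map_apply (by fun_prop) hS']
    rfl
  have hQP : Q = P.withDensity fun x => ENNReal.ofReal (mixLR ε b x / mixLR ε a x) := by
    have hma := measurable_mixLR ε a
    have hmb := measurable_mixLR ε b
    rw [hP, hQ, ← withDensity_mul _ hma.ennreal_ofReal (by fun_prop)]
    congr 1; ext x
    have hx := mixLR_pos h0.le h1 a x
    rw [Pi.mul_apply, ← ENNReal.ofReal_mul hx.le, mul_div_cancel₀ _ hx.ne']
  have hr0 (x) : 0 ≤ mixLR ε b x / mixLR ε a x :=
    div_nonneg (mixLR_pos h0.le h1 b x).le (mixLR_pos h0.le h1 a x).le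
  have hr : Integrable (fun x => mixLR ε b x / mixLR ε a x) P := by
    have hma := measurable_mixLR ε a
    have hmb := measurable_mixLR ε b
    refine (memLp_two_iff_integrable_sq ?_).2 hχ.1 |>.integrable (by norm_num)
    exact Measurable.aestronglyMeasurable (by fun_prop)
  have hle := abs_pi_sub_pi_le hr0 hr hχ.1 hQP hχ.2 p hκ hpC hS'
  rw [key, key]
  rw [← ofReal_measureReal, ← ofReal_measureReal, ← ENNReal.ofReal_add measureReal_nonneg hκ.le]
  refine ENNReal.ofReal_le_ofReal ?_
  have := (abs_le.1 hle).1
  linarith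

/-- Flipping `w` into `w'` changes the law of the data matrix by at most `κ` in total variation. -/
lemma colored_measure_le {ε τ C κ c s : ℝ} (h0 : 0 < ε) (h1 : ε < 1) {n p : ℕ}
    {A : Matrix (Fin n) (Fin n) ℝ} {B : Matrix (Fin p) (Fin p) ℝ}
    (hA : IsUnit A) (hB : IsUnit B) (hAs : specNorm A⁻¹ ≤ s) (hBs : specNorm B⁻¹ ≤ s)
    (hc0 : 0 < c) (hc : c ^ 2 * s ^ 4 ≤ 1) {w w' : Fin n → ℝ}
    (hχ : ChiSqLE ε τ (fun i => w i / c) (fun i => w' i / c) C)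
    (hκ : 0 < κ) (hpC : Real.exp (p * C) - 1 ≤ κ ^ 2)
    {S : Set (Fin n → Fin p → ℝ)} (hS : MeasurableSet S) :
    let ν := (Measure.pi fun _ : Fin p => muLaw ε τ).prod (noiseLaw n p)
    ν {mz | (fun i j => w i * mz.1 j + (A * Matrix.of mz.2 * B) i j) ∈ S} ≤
      ν {mz | (fun i j => w' i * mz.1 j + (A * Matrix.of mz.2 * B) i j) ∈ S} +
        ENNReal.ofReal κ := by
  intro ν
  have := isProbabilityMeasure_muLaw (τ := τ) h0.le h1.le
  set M := Measure.pi fun _ : Fin p => muLaw ε τ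
  obtain ⟨W, hW⟩ := exists_map_mul_mul_noiseLaw hA hB hAs hBs hc
  have hAB : Measurable fun (Z : Fin n → Fin p → ℝ) i j => (A * Matrix.of Z * B) i j := by
    simp only [Matrix.mul_apply, Matrix.of_apply]; fun_prop
  have hg : Measurable fun z : (Fin n → Fin p → ℝ) × (Fin n → Fin p → ℝ) =>
      c • z.1 + flatMul W z.2 := by fun_prop
  have hu (u : Fin n → ℝ) : Measurable
      fun (mz : (Fin p → ℝ) × (Fin n → Fin p → ℝ)) i j => u i * mz.1 j + mz.2 i j := by fun_prop
  have huS (u : Fin n → ℝ) : MeasurableSet {mz : (Fin p → ℝ) × (Fin n → Fin p → ℝ) |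
      (fun i j => u i * mz.1 j + mz.2 i j) ∈ S} := hu u hS
  have hT (u : Fin n → ℝ) : MeasurableSet {q : ((Fin p → ℝ) × (Fin n → Fin p → ℝ)) ×
      (Fin n → Fin p → ℝ) |
        (fun i j => u i * q.1.1 j + (c • q.1.2 + flatMul W q.2) i j) ∈ S} := by
    refine ((hu u).comp (g := fun mz => _) (f := fun q : ((Fin p → ℝ) × (Fin n → Fin p → ℝ)) ×
      (Fin n → Fin p → ℝ) => (q.1.1, c • q.1.2 + flatMul W q.2)) ?_) hS
    fun_prop
  have key (u : Fin n → ℝ) :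
      ν {mz | (fun i j => u i * mz.1 j + (A * Matrix.of mz.2 * B) i j) ∈ S} =
        ∫⁻ z, ν {mz | (fun i j => u i / c * mz.1 j + mz.2 i j) ∈
          {Y : Fin n → Fin p → ℝ | c • Y + flatMul W z ∈ S}} ∂noiseLaw n p := by
    calc _ = (ν.map (Prod.map id fun Z i j => (A * Matrix.of Z * B) i j))
          {mz | (fun i j => u i * mz.1 j + mz.2 i j) ∈ S} := by
          rw [Measure.map_apply (measurable_id.prodMap hAB) (huS u)]; rfl
      _ = (M.prod ((noiseLaw n p).prod (noiseLaw n p))).map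
          (Prod.map id fun z => c • z.1 + flatMul W z.2)
            {mz | (fun i j => u i * mz.1 j + mz.2 i j) ∈ S} := by
          rw [← Measure.map_prod_map _ _ measurable_id hAB, hW,
            Measure.map_prod_map _ _ measurable_id hg]
      _ = (M.prod ((noiseLaw n p).prod (noiseLaw n p))) (MeasurableEquiv.prodAssoc.symm ⁻¹'
            {q | (fun i j => u i * q.1.1 j + (c • q.1.2 + flatMul W q.2) i j) ∈ S}) := by
          rw [Measure.map_apply (measurable_id.prodMap hg) (huS u)]; rfl
      _ = (ν.prod (noiseLaw n p))
            {q | (fun i j => u i * q.1.1 j + (c • q.1.2 + flatMul W q.2) i j) ∈ S} := by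
          rw [← (measurePreserving_prodAssoc M (noiseLaw n p) (noiseLaw n p)).symm
            |>.measure_preimage (hT u).nullMeasurableSet]
      _ = _ := by
          rw [Measure.prod_apply_symm (hT u)]
          refine lintegral_congr fun z => ?_
          congr 1
          ext mz
          simp only [Set.mem_preimage, Set.mem_ofPred_eq]
          refine iff_of_eq (congrArg (· ∈ S) ?_)
          ext i j
          simp only [Pi.add_apply, Pi.smul_apply, smul_eq_mul]
          field_simp
          ring
  rw [key, key]
  calc _ ≤ ∫⁻ z, (ν {mz | (fun i j => w' i / c * mz.1 j + mz.2 i j) ∈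
          {Y : Fin n → Fin p → ℝ | c • Y + flatMul W z ∈ S}} + ENNReal.ofReal κ) ∂noiseLaw n p := by
        refine lintegral_mono fun z => white_measure_le h0 h1 hχ hκ hpC ?_
        have : Measurable fun Y : Fin n → Fin p → ℝ => c • Y + flatMul W z := by fun_prop
        exact this hS
    _ = _ := by
        rw [lintegral_add_right _ measurable_const]; simp

/-- Flip the sign of the `i`-th coordinate. -/
def flipAt {n : ℕ} (i : Fin n) (l : Fin n → ℝ) : Fin n → ℝ := fun j => if j = i then -l j else l j

lemma measurePreserving_flipAt {n : ℕ} (i : Fin n) :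
    MeasurePreserving (flipAt i) (Measure.pi fun _ : Fin n => signLaw)
      (Measure.pi fun _ : Fin n => signLaw) := by
  have hneg : MeasurePreserving (fun x : ℝ => -x) signLaw signLaw := by
    refine ⟨measurable_neg, ?_⟩
    rw [signLaw, Measure.map_add _ _ measurable_neg, Measure.map_smul, Measure.map_smul,
      Measure.map_dirac' measurable_neg, Measure.map_dirac' measurable_neg, neg_neg, add_comm]
  have h := measurePreserving_pi (fun _ : Fin n => signLaw) (fun _ : Fin n => signLaw)
    (f := fun j x => if j = i then -x else x) fun j => by
      by_cases hj : j = i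
      · simpa [hj] using hneg
      · simpa [hj, Function.id_def] using MeasurePreserving.id signLaw
  exact h

lemma ae_sign {n : ℕ} :
    ∀ᵐ l ∂(Measure.pi fun _ : Fin n => signLaw), ∀ i, l i = 1 ∨ l i = -1 := by
  rw [ae_all_iff]
  intro i
  have h : ∀ᵐ x ∂signLaw, x = 1 ∨ x = -1 := by
    have hm : MeasurableSet {x : ℝ | x = 1 ∨ x = -1} := by measurability
    rw [signLaw, ae_add_measure_iff]
    constructor <;> refine Measure.ae_smul_measure ?_ _ <;> rw [ae_dirac_iff hm] <;> simp
  exact (measurePreserving_eval (fun _ : Fin n => signLaw) i).quasiMeasurePreserving.ae h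

lemma measurable_dataColored {n p : ℕ} (A : Matrix (Fin n) (Fin n) ℝ)
    (B : Matrix (Fin p) (Fin p) ℝ) : Measurable (dataColored A B) := by
  unfold dataColored
  simp only [Matrix.mul_apply, Matrix.of_apply]; fun_prop

lemma one_le_two_mul_error {ε τ κ : ℝ} (h0 : 0 ≤ ε) (h1 : ε ≤ 1) {n p : ℕ}
    {A : Matrix (Fin n) (Fin n) ℝ} {B : Matrix (Fin p) (Fin p) ℝ}
    (hflip : ∀ l : Fin n → ℝ, (∀ i, l i = 1 ∨ l i = -1) → ∀ i,
      ∀ S : Set (Fin n → Fin p → ℝ), MeasurableSet S →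
      let ν := (Measure.pi fun _ : Fin p => muLaw ε τ).prod (noiseLaw n p)
      ν {mz | dataColored A B (l, mz) ∈ S} ≤
        ν {mz | dataColored A B (flipAt i l, mz) ∈ S} + ENNReal.ofReal κ)
    {ell : (Fin n → Fin p → ℝ) → Fin n → ℝ} (hmeas : Measurable ell) {s : ℝ} (hs : s ≠ 0)
    (i : Fin n) :
    1 ≤ 2 * jointLaw n p ε τ {ω | ell (dataColored A B ω) i ≠ s * ω.1 i} + ENNReal.ofReal κ := by
  have := isProbabilityMeasure_muLaw (τ := τ) h0 h1
  set ν := (Measure.pi fun _ : Fin p => muLaw ε τ).prod (noiseLaw n p) with hν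
  set π := Measure.pi fun _ : Fin n => signLaw
  have hD := measurable_dataColored A B
  have hell : Measurable fun X => ell X i := (measurable_pi_apply i).comp hmeas
  have hE : MeasurableSet {ω : Omega n p | ell (dataColored A B ω) i ≠ s * ω.1 i} := by
    refine (measurableSet_eq_fun (hell.comp hD) ?_).compl
    fun_prop
  set h : (Fin n → ℝ) → ℝ≥0∞ := fun l => ν {mz | ell (dataColored A B (l, mz)) i ≠ s * l i}
  have hh : Measurable h := measurable_measure_prodMk_left hE
  have hJ : jointLaw n p ε τ {ω | ell (dataColored A B ω) i ≠ s * ω.1 i} = ∫⁻ l, h l ∂π := by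
    rw [jointLaw, Measure.prod_apply hE]; rfl
  have hJ' : ∫⁻ l, h (flipAt i l) ∂π = ∫⁻ l, h l ∂π :=
    (measurePreserving_flipAt i).lintegral_comp hh
  have key : ∀ᵐ l ∂π, 1 ≤ h l + h (flipAt i l) + ENNReal.ofReal κ := by
    filter_upwards [ae_sign] with l hl
    have hS : MeasurableSet {X : Fin n → Fin p → ℝ | ell X i = s * l i} :=
      measurableSet_eq_fun hell measurable_const
    have hDl : Measurable fun mz => dataColored A B (l, mz) := hD.comp measurable_prodMk_left
    have hle := hflip l hl i _ hS
    have hsub : ν {mz | dataColored A B (flipAt i l, mz) ∈ {X | ell X i = s * l i}} ≤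
        h (flipAt i l) := by
      refine measure_mono fun mz hmz => ?_
      simp only [Set.mem_ofPred_eq, flipAt, if_true] at hmz ⊢
      rw [hmz]
      intro hc
      rcases hl i with h' | h' <;> rw [h'] at hc <;> exact hs (by linarith)
    have hone : (1 : ℝ≥0∞) = ν {mz | dataColored A B (l, mz) ∈ {X | ell X i = s * l i}} + h l := by
      rw [← prob_add_prob_compl (μ := ν) (hDl hS)]; rfl
    calc (1 : ℝ≥0∞) = _ := hone
      _ ≤ h (flipAt i l) + ENNReal.ofReal κ + h l := by gcongr; exact hle.trans (by gcongr)
      _ = _ := by ring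
  calc (1 : ℝ≥0∞) = ∫⁻ _, 1 ∂π := by simp
    _ ≤ ∫⁻ l, (h l + h (flipAt i l) + ENNReal.ofReal κ) ∂π := lintegral_mono_ae key
    _ = _ := by
      rw [lintegral_add_right _ measurable_const, lintegral_add_left hh, hJ', hJ]
      simp [two_mul]

lemma le_hammingClu {ε τ κ : ℝ} (h0 : 0 ≤ ε) (h1 : ε ≤ 1) (hκ : 0 ≤ κ) {n p : ℕ} (hn : 0 < n)
    {A : Matrix (Fin n) (Fin n) ℝ} {B : Matrix (Fin p) (Fin p) ℝ}
    (hflip : ∀ l : Fin n → ℝ, (∀ i, l i = 1 ∨ l i = -1) → ∀ i,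
      ∀ S : Set (Fin n → Fin p → ℝ), MeasurableSet S →
      let ν := (Measure.pi fun _ : Fin p => muLaw ε τ).prod (noiseLaw n p)
      ν {mz | dataColored A B (l, mz) ∈ S} ≤
        ν {mz | dataColored A B (flipAt i l, mz) ∈ S} + ENNReal.ofReal κ)
    {ell : (Fin n → Fin p → ℝ) → Fin n → ℝ} (hmeas : Measurable ell) :
    (1 - κ) / 2 ≤ hammingClu n p ε τ (dataColored A B) ell := by
  have := isProbabilityMeasure_muLaw (τ := τ) h0 h1
  have : IsProbabilityMeasure (jointLaw n p ε τ) := by unfold jointLaw; infer_instance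
  have hn' : (0 : ℝ) < n := Nat.cast_pos.2 hn
  have key (s : ℝ) (hs : s ≠ 0) : n * ((1 - κ) / 2) ≤
      ∑ i : Fin n, (jointLaw n p ε τ {ω | ell (dataColored A B ω) i ≠ s * ω.1 i}).toReal := by
    have : ∀ i ∈ Finset.univ, (1 - κ) / 2 ≤
        (jointLaw n p ε τ {ω | ell (dataColored A B ω) i ≠ s * ω.1 i}).toReal := by
      intro i _
      have h := one_le_two_mul_error h0 h1 hflip hmeas hs i
      rw [← ENNReal.ofReal_toReal (measure_ne_top (jointLaw n p ε τ) _),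
        ← ENNReal.ofReal_ofNat 2, ← ENNReal.ofReal_mul (by norm_num),
        ← ENNReal.ofReal_add (by positivity) hκ, ENNReal.one_le_ofReal] at h
      linarith
    simpa using Finset.card_nsmul_le_sum _ _ _ this
  rw [hammingClu, ← div_eq_inv_mul, le_div_iff₀ hn', mul_comm]
  refine le_min ?_ ?_
  · simpa using key 1 one_ne_zero
  · simpa using key (-1) (by norm_num)

lemma hammingClu_le_one {ε τ : ℝ} (h0 : 0 ≤ ε) (h1 : ε ≤ 1) {n p : ℕ} (hn : 0 < n)
    (D : Omega n p → Fin n → Fin p → ℝ) (ell : (Fin n → Fin p → ℝ) → Fin n → ℝ) :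
    hammingClu n p ε τ D ell ≤ 1 := by
  have := isProbabilityMeasure_muLaw (τ := τ) h0 h1
  have : IsProbabilityMeasure (jointLaw n p ε τ) := by unfold jointLaw; infer_instance
  have hn' : (0 : ℝ) < n := Nat.cast_pos.2 hn
  rw [hammingClu, ← div_eq_inv_mul, div_le_one hn']
  refine (min_le_left _ _).trans ?_
  have := Finset.sum_le_card_nsmul Finset.univ
    (fun i : Fin n => (jointLaw n p ε τ {ω | ell (D ω) i ≠ ω.1 i}).toReal) 1
    fun i _ => measureReal_le_one
  simpa using this

/-- Lower bound on the clustering error in terms of the `χ²` constant `C`. -/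
lemma le_hammingClu_of_chiSq {ε τ C κ c s : ℝ} (h0 : 0 < ε) (h1 : ε < 1) {n p : ℕ} (hn : 0 < n)
    {A : Matrix (Fin n) (Fin n) ℝ} {B : Matrix (Fin p) (Fin p) ℝ}
    (hA : IsUnit A) (hB : IsUnit B) (hAs : specNorm A⁻¹ ≤ s) (hBs : specNorm B⁻¹ ≤ s)
    (hc0 : 0 < c) (hc : c ^ 2 * s ^ 4 ≤ 1)
    (hC : ε * (Real.exp (4 * (τ / c) ^ 2) - 1) ≤ C ∨
      ε ^ 2 / (1 - ε) * (Real.exp (n * (τ / c) ^ 2) * (4 * (τ / c) ^ 2)) ≤ C)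
    (hκ : 0 < κ) (hpC : Real.exp (p * C) - 1 ≤ κ ^ 2)
    {ell : (Fin n → Fin p → ℝ) → Fin n → ℝ} (hmeas : Measurable ell) :
    (1 - κ) / 2 ≤ hammingClu n p ε τ (dataColored A B) ell := by
  refine le_hammingClu h0.le h1.le hκ.le hn (fun l hl i S hS => ?_) hmeas
  refine colored_measure_le h0 h1 hA hB hAs hBs hc0 hc ?_ hκ hpC hS
  have hsq (j) : l j ^ 2 = 1 := by rcases hl j with h | h <;> rw [h] <;> norm_num
  have hdiff : ∑ j, (l j / c * τ - flipAt i l j / c * τ) ^ 2 = 4 * (τ / c) ^ 2 := by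
    rw [Finset.sum_eq_single i]
    · simp only [flipAt, if_true]
      linear_combination 4 * (τ / c) ^ 2 * hsq i
    · intro j _ hj; simp [flipAt, hj]
    · simp
  have hnorm : ∑ j, (l j / c * τ) ^ 2 = n * (τ / c) ^ 2 := by
    have e (j) : (l j / c * τ) ^ 2 = (τ / c) ^ 2 := by linear_combination (τ / c) ^ 2 * hsq j
    simp [e]
  have hnorm' : ∑ j, (flipAt i l j / c * τ) ^ 2 = ∑ j, (l j / c * τ) ^ 2 := by
    refine Finset.sum_congr rfl fun j _ => ?_
    unfold flipAt; split_ifs <;> ring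
  rcases hC with hC | hC
  · have h := chiSq_mixLR_le_sparse h0 h1 (fun j => l j / c * τ) fun j => flipAt i l j / c * τ
    rw [hdiff] at h
    exact ⟨h.1, h.2.trans (by linarith)⟩
  · have h := chiSq_mixLR_le_weak h0.le h1 (a := fun j => l j / c * τ)
      (b := fun j => flipAt i l j / c * τ) hnorm'
    rw [hdiff, hnorm] at h
    exact ⟨h.1, h.2.trans (by linarith)⟩

lemma eventually_exp_sub_one_le {γ K κ : ℝ} (hγ : 0 < γ) (hκ : 0 < κ) :
    ∀ᶠ p : ℕ in atTop, Real.exp (K * (p : ℝ) ^ (-γ)) - 1 ≤ κ ^ 2 := by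
  have h1 : Tendsto (fun p : ℕ => Real.exp (K * (p : ℝ) ^ (-γ)) - 1) atTop (nhds 0) := by
    have h := ((tendsto_rpow_neg_atTop hγ).comp tendsto_natCast_atTop_atTop).const_mul K
    rw [mul_zero] at h
    simpa using ((Real.continuous_exp.tendsto 0).comp h).sub_const 1
  exact h1.eventually_le_const (by positivity)

lemma eventually_chiSq_le {θ β α κ : ℝ} (hθ0 : 0 < θ) (hβ0 : 0 < β) (hα : 0 < α)
    (hmain : etaClu θ β < α) (hκ : 0 < κ) :
    ∀ᶠ p : ℕ in atTop, ∃ C : ℝ,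
      ((p : ℝ) ^ (-β) * (Real.exp (4 * ((p : ℝ) ^ (-α)) ^ 2) - 1) ≤ C ∨
        ((p : ℝ) ^ (-β)) ^ 2 / (1 - (p : ℝ) ^ (-β)) *
          (Real.exp (nDim p θ * ((p : ℝ) ^ (-α)) ^ 2) * (4 * ((p : ℝ) ^ (-α)) ^ 2)) ≤ C) ∧
      Real.exp (p * C) - 1 ≤ κ ^ 2 := by
  rcases lt_or_ge β (1 - θ) with hβ | hβ
  · have hαθ : θ < 2 * α := by
      unfold etaClu at hmain; split_ifs at hmain <;> linarith
    have hγ : 0 < 2 * β + 2 * α - 1 := by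
      unfold etaClu at hmain; split_ifs at hmain <;> linarith
    have hε := (((tendsto_rpow_neg_atTop hβ0).comp
      tendsto_natCast_atTop_atTop).eventually_le_const (show (0 : ℝ) < 1 / 2 by norm_num))
    filter_upwards [eventually_exp_sub_one_le (K := 8 * Real.exp 2) hγ hκ, hε,
      eventually_ge_atTop 1] with p hp hε hp1
    simp only [Function.comp_apply] at hε
    have hp0 : (0 : ℝ) < p := by exact_mod_cast hp1
    have hp1' : (1 : ℝ) ≤ p := by exact_mod_cast hp1
    refine ⟨2 * ((p : ℝ) ^ (-β)) ^ 2 * (Real.exp 2 * (4 * ((p : ℝ) ^ (-α)) ^ 2)), Or.inr ?_, ?_⟩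
    · have h1 : (nDim p θ : ℝ) * ((p : ℝ) ^ (-α)) ^ 2 ≤ 2 := by
        have hn : (nDim p θ : ℝ) ≤ 2 * (p : ℝ) ^ θ := by
          have := (Nat.ceil_lt_add_one (Real.rpow_nonneg hp0.le θ)).le
          have := Real.one_le_rpow hp1' hθ0.le
          unfold nDim; linarith
        have h2 : (p : ℝ) ^ θ * ((p : ℝ) ^ (-α)) ^ 2 ≤ 1 := by
          rw [← Real.rpow_natCast, ← Real.rpow_mul hp0.le, ← Real.rpow_add hp0]
          exact Real.rpow_le_one_of_one_le_of_nonpos hp1' (by push_cast; linarith)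
        calc _ ≤ 2 * (p : ℝ) ^ θ * ((p : ℝ) ^ (-α)) ^ 2 := by gcongr
          _ ≤ 2 := by linarith
      have h2 : ((p : ℝ) ^ (-β)) ^ 2 / (1 - (p : ℝ) ^ (-β)) ≤ 2 * ((p : ℝ) ^ (-β)) ^ 2 := by
        rw [div_le_iff₀ (by linarith)]
        nlinarith [sq_nonneg ((p : ℝ) ^ (-β))]
      gcongr
    · convert hp using 3
      have : (p : ℝ) * (((p : ℝ) ^ (-β)) ^ 2 * ((p : ℝ) ^ (-α)) ^ 2) =
          (p : ℝ) ^ (-(2 * β + 2 * α - 1)) := by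
        rw [← Real.rpow_natCast, ← Real.rpow_natCast, ← Real.rpow_mul hp0.le,
          ← Real.rpow_mul hp0.le, ← Real.rpow_add hp0]
        nth_rw 1 [← Real.rpow_one (p : ℝ)]
        rw [← Real.rpow_add hp0]
        congr 1; push_cast; ring
      rw [← this]; ring
  · have hγ : 0 < β + 2 * α - 1 := by
      unfold etaClu at hmain; split_ifs at hmain <;> linarith
    have ht := (((tendsto_rpow_neg_atTop hα).comp
      tendsto_natCast_atTop_atTop).eventually_le_const (show (0 : ℝ) < 1 / 2 by norm_num))
    filter_upwards [eventually_exp_sub_one_le (K := 8) hγ hκ, ht, eventually_ge_atTop 1]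
      with p hp ht hp1
    simp only [Function.comp_apply] at ht
    have hp0 : (0 : ℝ) < p := by exact_mod_cast hp1
    have ht0 : 0 < (p : ℝ) ^ (-α) := Real.rpow_pos_of_pos hp0 _
    refine ⟨(p : ℝ) ^ (-β) * (8 * ((p : ℝ) ^ (-α)) ^ 2), Or.inl ?_, ?_⟩
    · have hx : |4 * ((p : ℝ) ^ (-α)) ^ 2| ≤ 1 := by
        rw [abs_of_nonneg (by positivity)]; nlinarith
      have h := (abs_le.1 (Real.abs_exp_sub_one_le hx)).2
      rw [abs_of_nonneg (by positivity)] at h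
      gcongr
      linarith
    · convert hp using 3
      have : (p : ℝ) * ((p : ℝ) ^ (-β) * ((p : ℝ) ^ (-α)) ^ 2) =
          (p : ℝ) ^ (-(β + 2 * α - 1)) := by
        rw [← Real.rpow_natCast, ← Real.rpow_mul hp0.le, ← Real.rpow_add hp0]
        nth_rw 1 [← Real.rpow_one (p : ℝ)]
        rw [← Real.rpow_add hp0]
        congr 1; push_cast; ring
      rw [← this]; ring

end ARWPaper

open ARWPaper Filter in
/-- statistical lower bound for clustering with colored noise
`X = ℓ μ' + A_p Z B_p`, where `A_p, B_p` are nonrandom invertible matrices whose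
spectral norms (and those of their inverses) are `L_p` (multi-log) terms. -/
theorem clustering_lower_bound_colored
    (θ β α : ℝ) (hθ0 : 0 < θ) (hθ1 : θ < 1) (hβ0 : 0 < β) (hβ1 : β < 1)
    (hα : 0 < α) (hmain : etaClu θ β < α)
    (A : (p : ℕ) → Matrix (Fin (nDim p θ)) (Fin (nDim p θ)) ℝ)
    (B : (p : ℕ) → Matrix (Fin p) (Fin p) ℝ)
    (hAinv : ∀ p, IsUnit (A p))
    (hBinv : ∀ p, IsUnit (B p))
    (hnorm : ∀ δ : ℝ, 0 < δ →
      Tendsto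
        (fun p : ℕ => (p : ℝ) ^ (-δ) *
          max (max (specNorm (A p)) (specNorm (A p)⁻¹))
            (max (specNorm (B p)) (specNorm (B p)⁻¹)))
        atTop (nhds 0))
    (ell : (p : ℕ) → (Fin (nDim p θ) → Fin p → ℝ) → Fin (nDim p θ) → ℝ)
    (hmeas : ∀ p, Measurable (ell p))
    (hval : ∀ p X i, ell p X i = 1 ∨ ell p X i = -1) :
    (1 / 2 : ℝ) ≤ Filter.liminf
      (fun p : ℕ =>
        hammingClu (nDim p θ) p ((p : ℝ) ^ (-β)) ((p : ℝ) ^ (-α))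
          (dataColored (A p) (B p)) (ell p))
      Filter.atTop := by
  have hn (p : ℕ) (hp : 1 ≤ p) : 0 < nDim p θ :=
    Nat.ceil_pos.2 (Real.rpow_pos_of_pos (by exact_mod_cast hp) θ)
  have hε (p : ℕ) (hp : 2 ≤ p) : 0 < (p : ℝ) ^ (-β) ∧ (p : ℝ) ^ (-β) < 1 :=
    ⟨Real.rpow_pos_of_pos (by positivity) _,
      Real.rpow_lt_one_of_one_lt_of_neg (by exact_mod_cast hp) (by linarith)⟩
  have hcob : IsCoboundedUnder (· ≥ ·) atTop fun p : ℕ =>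
      hammingClu (nDim p θ) p ((p : ℝ) ^ (-β)) ((p : ℝ) ^ (-α))
        (dataColored (A p) (B p)) (ell p) := by
    refine IsBoundedUnder.isCoboundedUnder_ge (isBoundedUnder_of_eventually_le (a := 1) ?_)
    filter_upwards [eventually_ge_atTop 2] with p hp
    exact hammingClu_le_one (hε p hp).1.le (hε p hp).2.le (hn p (by lia)) _ _
  obtain ⟨α', hα', hα'α⟩ := exists_between (max_lt hα hmain)
  have hδ : 0 < α - α' := by linarith
  have key (κ : ℝ) (hκ : 0 < κ) : (1 - κ) / 2 ≤ Filter.liminf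
      (fun p : ℕ =>
        hammingClu (nDim p θ) p ((p : ℝ) ^ (-β)) ((p : ℝ) ^ (-α))
          (dataColored (A p) (B p)) (ell p)) atTop := by
    refine le_liminf_of_le hcob ?_
    filter_upwards [eventually_ge_atTop 2,
      (hnorm ((α - α') / 2) (by linarith)).eventually_le_const one_pos,
      eventually_chiSq_le hθ0 hβ0 (lt_of_le_of_lt (le_max_left _ _) hα')
        (lt_of_le_of_lt (le_max_right _ _) hα') hκ] with p hp hs ⟨C, hC, hpC⟩
    have hp0 : (0 : ℝ) < p := by positivity
    have hs' : max (max (specNorm (A p)) (specNorm (A p)⁻¹))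
        (max (specNorm (B p)) (specNorm (B p)⁻¹)) ≤ (p : ℝ) ^ ((α - α') / 2) := by
      rwa [Real.rpow_neg hp0.le, ← div_eq_inv_mul,
        div_le_one (Real.rpow_pos_of_pos hp0 _)] at hs
    have hτ : (p : ℝ) ^ (-α) / (p : ℝ) ^ (-(α - α')) = (p : ℝ) ^ (-α') := by
      rw [← Real.rpow_sub hp0]; congr 1; ring
    refine le_hammingClu_of_chiSq (C := C) (c := (p : ℝ) ^ (-(α - α')))
      (s := (p : ℝ) ^ ((α - α') / 2)) (hε p hp).1 (hε p hp).2 (hn p (by lia)) (hAinv p) (hBinv p)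
      (((le_max_right _ _).trans (le_max_left _ _)).trans hs')
      (((le_max_right _ _).trans (le_max_right _ _)).trans hs')
      (Real.rpow_pos_of_pos hp0 _) ?_ ?_ hκ hpC (hmeas p)
    · rw [← Real.rpow_natCast, ← Real.rpow_natCast, ← Real.rpow_mul hp0.le,
        ← Real.rpow_mul hp0.le, ← Real.rpow_add hp0]
      refine (congrArg _ ?_).trans (Real.rpow_zero _) |>.le
      push_cast; ring
    · rwa [hτ]
  refine le_of_forall_pos_le_add fun κ hκ => ?_
  linarith [key (2 * κ) (by linarith)]
end

section
/- Fix (α, β, θ) ∈ (0,1)³ with α < η^sig_θ(β). Then as p → ∞: (i) if 0 < β < (1−θ)/2, then Hamm_p(Ŝ_*^{(sa)}) → 0; (ii) if (1−θ)/2 < β < 1 and N = ⌈pε_p⌉, then Hamm_p(Ŝ_N^{(sa)}) → 0. -/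
open MeasureTheory ProbabilityTheory Filter
open scoped ENNReal NNReal Classical BigOperators

namespace ARWPaper

instance instIsProbabilityMeasureGaussPi (n : ℕ) : IsProbabilityMeasure (gaussPi n) := by
  unfold gaussPi; infer_instance

instance instIsProbabilityMeasureNoiseLaw (n p : ℕ) : IsProbabilityMeasure (noiseLaw n p) := by
  unfold noiseLaw; infer_instance

instance instIsProbabilityMeasureSignLaw : IsProbabilityMeasure signLaw := by
  refine ⟨?_⟩
  simp [signLaw, ENNReal.inv_two_add_inv_two]

lemma gaussPi_map_linear (p : ℕ) (w : Fin p → ℝ) :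
    (gaussPi p).map (fun z => ∑ j, w j * z j) = gaussianReal 0 (∑ j, ‖w j‖₊ ^ 2) := by
  have hm : Measurable (fun z : Fin p → ℝ => ∑ j, w j * z j) := by fun_prop
  have := Measure.isProbabilityMeasure_map (μ := gaussPi p) hm.aemeasurable
  apply Measure.ext_of_charFun
  funext t
  rw [charFun_gaussianReal, charFun_apply_real,
    integral_map hm.aemeasurable (by fun_prop)]
  have h : ∀ z : Fin p → ℝ,
      Complex.exp (t * ((∑ j, w j * z j : ℝ) : ℂ) * Complex.I)
        = ∏ j, Complex.exp (((t * w j : ℝ) : ℂ) * z j * Complex.I) := by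
    intro z
    rw [← Complex.exp_sum]
    congr 1
    push_cast
    rw [Finset.mul_sum, Finset.sum_mul]
    exact Finset.sum_congr rfl fun j _ => by ring
  simp_rw [h]
  rw [gaussPi, integral_fintype_prod_eq_prod
    (fun j (x : ℝ) => Complex.exp (((t * w j : ℝ) : ℂ) * x * Complex.I))]
  have h2 : ∀ j, ∫ x : ℝ, Complex.exp (((t * w j : ℝ) : ℂ) * x * Complex.I) ∂gaussianReal 0 1
      = Complex.exp (- (w j : ℂ) ^ 2 * t ^ 2 / 2) := by
    intro j
    rw [← charFun_apply_real, charFun_gaussianReal]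
    congr 1
    push_cast
    ring
  simp_rw [h2]
  rw [← Complex.exp_sum]
  congr 1
  push_cast
  have h3 : ∀ j, ((‖w j‖ : ℝ) : ℂ) ^ 2 = (w j : ℂ) ^ 2 := by
    intro j
    rw [← Complex.ofReal_pow, ← Complex.ofReal_pow, Real.norm_eq_abs, sq_abs]
  simp_rw [h3]
  rw [mul_zero, zero_mul, zero_sub, Finset.sum_mul, Finset.sum_div, ← Finset.sum_neg_distrib]
  exact Finset.sum_congr rfl fun j _ => by ring

lemma gaussPi_map_sum (p : ℕ) (S : Finset (Fin p)) :
    (gaussPi p).map (fun z => ∑ j ∈ S, z j) = gaussianReal 0 (S.card : ℝ≥0) := by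
  have h := gaussPi_map_linear p (fun j => if j ∈ S then 1 else 0)
  have h1 : (fun z : Fin p → ℝ => ∑ j, (if j ∈ S then (1 : ℝ) else 0) * z j)
      = fun z => ∑ j ∈ S, z j := by
    funext z; simp [Finset.sum_ite_mem]
  have h2 : (∑ j : Fin p, ‖(if j ∈ S then (1 : ℝ) else 0)‖₊ ^ 2) = (S.card : ℝ≥0) := by
    have : ∀ j : Fin p, ‖(if j ∈ S then (1 : ℝ) else 0)‖₊ ^ 2 = if j ∈ S then 1 else 0 := by
      intro j; split_ifs <;> simp
    simp_rw [this]
    simp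
  rw [← h1, h, h2]

lemma hasSubgaussianMGF_id_gaussianReal (v : ℝ≥0) :
    HasSubgaussianMGF id v (gaussianReal 0 v) where
  integrable_exp_mul t := by
    simpa using integrable_exp_mul_gaussianReal t
  mgf_le t := by
    rw [mgf_id_gaussianReal]; simp

lemma hasSubgaussianMGF_linear (p : ℕ) (w : Fin p → ℝ) :
    HasSubgaussianMGF (fun z => ∑ j, w j * z j) (∑ j, ‖w j‖₊ ^ 2) (gaussPi p) := by
  have hm : Measurable (fun z : Fin p → ℝ => ∑ j, w j * z j) := by fun_prop
  have h := hasSubgaussianMGF_id_gaussianReal (∑ j, ‖w j‖₊ ^ 2)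
  rw [← gaussPi_map_linear] at h
  exact (HasSubgaussianMGF.id_map_iff hm.aemeasurable).1 h

/-- Two-sided Hoeffding bound for a sum of sub-Gaussian functionals of the noise rows. -/
lemma noiseLaw_real_abs_sum_ge_le {n p : ℕ} {f : Fin n → (Fin p → ℝ) → ℝ} {c : Fin n → ℝ≥0}
    (hf : ∀ i, HasSubgaussianMGF (f i) (c i) (gaussPi p)) {t : ℝ} (ht : 0 ≤ t) :
    (noiseLaw n p).real {Z | t ≤ |∑ i, f i (Z i)|}
      ≤ 2 * Real.exp (-t ^ 2 / (2 * ∑ i, (c i : ℝ))) := by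
  have hind : iIndepFun (fun i (Z : Fin n → Fin p → ℝ) => f i (Z i)) (noiseLaw n p) :=
    iIndepFun_pi (μ := fun _ : Fin n => gaussPi p) fun i => (hf i).aemeasurable
  have hrow : ∀ i ∈ (Finset.univ : Finset (Fin n)),
      HasSubgaussianMGF (fun Z : Fin n → Fin p → ℝ => f i (Z i)) (c i) (noiseLaw n p) := by
    intro i _
    have hmp : MeasurePreserving (Function.eval i) (noiseLaw n p) (gaussPi p) :=
      measurePreserving_eval (fun _ : Fin n => gaussPi p) i
    exact ⟨fun t => hmp.integrable_comp_of_integrable ((hf i).integrable_exp_mul t), fun t => by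
      have := (hf i).mgf_le t
      refine le_trans (le_of_eq ?_) this
      rw [mgf, mgf, ← hmp.map_eq, integral_map hmp.measurable.aemeasurable
        (by rw [hmp.map_eq]; exact ((hf i).integrable_exp_mul t).aestronglyMeasurable)]⟩
  have hsum := HasSubgaussianMGF.sum_of_iIndepFun hind hrow
  have h1 := hsum.measure_ge_le ht
  have h2 := hsum.neg.measure_ge_le ht
  have hsub : {Z : Fin n → Fin p → ℝ | t ≤ |∑ i, f i (Z i)|}
      ⊆ {Z | t ≤ ∑ i, f i (Z i)} ∪ {Z | t ≤ (-fun Z : Fin n → Fin p → ℝ => ∑ i, f i (Z i)) Z} := by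
    intro Z hZ
    exact le_abs.1 (Set.mem_ofPred_eq ▸ hZ)
  refine (measureReal_mono hsub).trans ((measureReal_union_le _ _).trans ?_)
  push_cast at h1 h2
  rw [two_mul]
  exact add_le_add h1 h2

/-- The mean `E|c + W|` with `W ~ N(0, v)`. -/
noncomputable def absMean (v : ℝ≥0) (c : ℝ) : ℝ := ∫ x, |c + x| ∂gaussianReal 0 v

lemma integrable_abs_add_gaussianReal (v : ℝ≥0) (c : ℝ) :
    Integrable (fun x => |c + x|) (gaussianReal 0 v) :=
  ((integrable_const c).add
    ((memLp_id_gaussianReal (μ := 0) (v := v) 1).integrable le_rfl)).abs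

lemma absMean_neg (v : ℝ≥0) (c : ℝ) : absMean v (-c) = absMean v c := by
  have h : gaussianReal 0 v = (gaussianReal 0 v).map (fun x => -x) := by
    rw [gaussianReal_map_neg, neg_zero]
  unfold absMean
  conv_rhs => rw [h]
  rw [integral_map (by fun_prop) (by fun_prop)]
  refine integral_congr_ae (ae_of_all _ fun x => ?_)
  simp only
  rw [← abs_neg]
  congr 1
  ring

lemma absMean_convex (v : ℝ≥0) (c : ℝ) {δ : ℝ} (h0 : 0 ≤ δ) (h1 : δ ≤ 1) :
    absMean v ((1 - δ) * c) ≤ (1 - δ) * absMean v c + δ * absMean v 0 := by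
  unfold absMean
  rw [← integral_const_mul, ← integral_const_mul, ← integral_add
    ((integrable_abs_add_gaussianReal v c).const_mul _)
    ((integrable_abs_add_gaussianReal v 0).const_mul _)]
  refine integral_mono (integrable_abs_add_gaussianReal v _)
    (((integrable_abs_add_gaussianReal v c).const_mul _).add
    ((integrable_abs_add_gaussianReal v 0).const_mul _)) fun x => ?_
  simp only
  calc |(1 - δ) * c + x| = |(1 - δ) * (c + x) + δ * (0 + x)| := by ring_nf
    _ ≤ |(1 - δ) * (c + x)| + |δ * (0 + x)| := abs_add_le _ _
    _ = _ := by rw [abs_mul, abs_mul, abs_of_nonneg h0, abs_of_nonneg (sub_nonneg.2 h1)]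

lemma gaussianReal_real_Icc_ge {v : ℝ≥0} (hv : v ≠ 0) {r : ℝ} (hr : 0 ≤ r)
    (hrv : r ≤ Real.sqrt v) :
    2 * r * ((Real.sqrt (2 * Real.pi * v))⁻¹ * Real.exp (-1 / 2))
      ≤ (gaussianReal 0 v).real (Set.Icc (-r) r) := by
  have hv' : (0 : ℝ) < v := by positivity
  rw [measureReal_def, gaussianReal_apply_eq_integral _ hv, ENNReal.toReal_ofReal
    (setIntegral_nonneg measurableSet_Icc fun x _ => gaussianPDFReal_nonneg _ _ _)]
  have h := setIntegral_ge_of_const_le_real (μ := volume) (s := Set.Icc (-r) r)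
    (f := gaussianPDFReal 0 v) (c := (Real.sqrt (2 * Real.pi * v))⁻¹ * Real.exp (-1 / 2))
    measurableSet_Icc (by simp) (fun x hx => by
      unfold gaussianPDFReal
      refine mul_le_mul_of_nonneg_left (Real.exp_le_exp.2 ?_) (by positivity)
      rw [sub_zero, div_le_div_iff₀ (by norm_num) (by positivity)]
      have : x ^ 2 ≤ v := by
        rw [← Real.sq_sqrt hv'.le]
        exact sq_le_sq' (by linarith [hx.1]) (by linarith [hx.2])
      linarith) (integrable_gaussianPDFReal 0 v).integrableOn
  refine le_trans (le_of_eq ?_) h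
  rw [measureReal_def, Real.volume_Icc, ENNReal.toReal_ofReal (by linarith)]
  ring

/-- The constant in the lower bound on the growth of `absMean`. -/
noncomputable def absMeanConst : ℝ := (Real.sqrt (2 * Real.pi))⁻¹ * Real.exp (-1 / 2) / 2

lemma absMeanConst_pos : 0 < absMeanConst := by
  unfold absMeanConst; positivity

lemma absMean_gap {v : ℝ≥0} (hv : v ≠ 0) {c : ℝ} (hc : 0 ≤ c) :
    absMeanConst * c * min (c / Real.sqrt v) 1 ≤ absMean v c - absMean v 0 := by
  have hv' : (0 : ℝ) < v := by positivity
  have hs : 0 < Real.sqrt v := Real.sqrt_pos.2 hv'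
  set r := min (c / 2) (Real.sqrt v) with hr
  have hr0 : 0 ≤ r := le_min (by linarith) hs.le
  have h1 := gaussianReal_real_Icc_ge hv hr0 (min_le_right _ _)
  have hint : Integrable (fun x => (|c + x| + |-c + x|) / 2) (gaussianReal 0 v) :=
    ((integrable_abs_add_gaussianReal v c).add
      (integrable_abs_add_gaussianReal v (-c))).div_const 2
  have h2 : (c / 2) * (gaussianReal 0 v).real (Set.Icc (-r) r) ≤ absMean v c - absMean v 0 := by
    have e1 : absMean v c - absMean v 0
        = ∫ x, ((|c + x| + |-c + x|) / 2 - |0 + x|) ∂gaussianReal 0 v := by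
      rw [integral_sub hint
        (integrable_abs_add_gaussianReal v 0), integral_div,
        integral_add (integrable_abs_add_gaussianReal v c)
        (integrable_abs_add_gaussianReal v (-c))]
      have := absMean_neg v c
      unfold absMean at this ⊢
      rw [this]; ring
    rw [e1, mul_comm, ← smul_eq_mul, ← integral_indicator_const _ measurableSet_Icc]
    refine integral_mono ((integrable_const _).indicator measurableSet_Icc)
      (hint.sub (integrable_abs_add_gaussianReal v 0)) fun x => ?_
    simp only [Set.indicator_apply]
    have a1 := le_abs_self (c + x)
    have a2 := neg_le_abs (c + x)
    have a3 := le_abs_self (-c + x)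
    have a4 := neg_le_abs (-c + x)
    rw [zero_add]
    split_ifs with hx
    · have : |x| ≤ c / 2 := abs_le.2 ⟨by linarith [hx.1, min_le_left (c / 2) (Real.sqrt v)],
        by linarith [hx.2, min_le_left (c / 2) (Real.sqrt v)]⟩
      linarith
    · have : |x| ≤ (|c + x| + |-c + x|) / 2 := abs_le.2 ⟨by linarith, by linarith⟩
      linarith
  refine le_trans ?_ h2
  refine le_trans ?_ (mul_le_mul_of_nonneg_left h1 (by linarith))
  have h3 : min (c / Real.sqrt v) 1 / 2 ≤ r / Real.sqrt v := by
    rw [hr, ← min_div_div_right hs.le, div_self hs.ne']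
    refine le_min ?_ ?_
    · have := min_le_left (c / Real.sqrt v) 1
      calc _ ≤ c / Real.sqrt v / 2 := by linarith
        _ = _ := by ring
    · have := min_le_right (c / Real.sqrt v) 1
      linarith
  have h4 : (Real.sqrt (2 * Real.pi * v))⁻¹ = (Real.sqrt (2 * Real.pi))⁻¹ * (Real.sqrt v)⁻¹ := by
    rw [Real.sqrt_mul (by positivity), mul_inv]
  rw [h4]
  unfold absMeanConst
  have h5 : 0 ≤ (Real.sqrt (2 * Real.pi))⁻¹ * Real.exp (-1 / 2) * c := by positivity
  calc _ = (Real.sqrt (2 * Real.pi))⁻¹ * Real.exp (-1 / 2) * c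
        * (min (c / Real.sqrt v) 1 / 2) := by ring
    _ ≤ (Real.sqrt (2 * Real.pi))⁻¹ * Real.exp (-1 / 2) * c * (r / Real.sqrt v) :=
      mul_le_mul_of_nonneg_left h3 h5
    _ = _ := by ring

lemma integrable_exp_mul_abs_add (v : ℝ≥0) (c m t : ℝ) :
    Integrable (fun x => Real.exp (t * (|c + x| - m))) (gaussianReal 0 v) := by
  have h : ∀ s : ℝ, Integrable (fun x => Real.exp (s * (c + x) - t * m)) (gaussianReal 0 v) := by
    intro s
    have := (integrable_exp_mul_gaussianReal (μ := 0) (v := v) s).const_mul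
      (Real.exp (s * c - t * m))
    refine this.congr (ae_of_all _ fun x => ?_)
    simp only
    rw [← Real.exp_add]
    congr 1
    ring
  refine ((h t).add (h (-t))).mono' (by fun_prop) (ae_of_all _ fun x => ?_)
  rw [Real.norm_of_nonneg (Real.exp_pos _).le, Pi.add_apply]
  have p1 := Real.exp_pos (t * (c + x) - t * m)
  have p2 := Real.exp_pos (-t * (c + x) - t * m)
  rcases abs_cases (c + x) with ⟨h1, _⟩ | ⟨h1, _⟩
  · rw [h1, mul_sub]; linarith
  · rw [h1, mul_sub, mul_neg, ← neg_mul]; linarith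

/-- Sub-Gaussianity of `|c + W|`, `W ~ N(0, v)`, by symmetrization. -/
lemma hasSubgaussianMGF_abs_add (v : ℝ≥0) (c : ℝ) :
    HasSubgaussianMGF (fun x => |c + x| - absMean v c) (2 * v) (gaussianReal 0 v) where
  integrable_exp_mul t := integrable_exp_mul_abs_add v c _ t
  mgf_le t := by
    set γ := gaussianReal 0 v
    set f : ℝ → ℝ := fun x => |c + x| - absMean v c with hf
    have hI : ∀ s, Integrable (fun x => Real.exp (s * f x)) γ :=
      fun s => integrable_exp_mul_abs_add v c _ s
    have hG : ∀ s : ℝ, ∫ x, Real.exp (s * x) ∂γ = Real.exp (v * s ^ 2 / 2) := by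
      intro s
      have := congrFun (mgf_id_gaussianReal (μ := 0) (v := v)) s
      simpa [mgf] using this
    have hGi : ∀ s : ℝ, Integrable (fun x => Real.exp (s * x)) γ :=
      fun s => integrable_exp_mul_gaussianReal s
    have hfi : Integrable f γ := (integrable_abs_add_gaussianReal v c).sub (integrable_const _)
    have hf0 : ∫ x, f x ∂γ = 0 := by
      rw [hf, integral_sub (integrable_abs_add_gaussianReal v c) (integrable_const _)]
      simp [absMean]
    have hone : 1 ≤ ∫ x, Real.exp (-t * f x) ∂γ := by
      have : ∫ x, (-t * f x + 1) ∂γ ≤ ∫ x, Real.exp (-t * f x) ∂γ :=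
        integral_mono ((hfi.const_mul _).add (integrable_const _)) (hI _)
          fun x => Real.add_one_le_exp _
      rw [integral_add (hfi.const_mul _) (integrable_const _), integral_const_mul, hf0] at this
      simpa using this
    have hnn : 0 ≤ ∫ x, Real.exp (t * f x) ∂γ := integral_nonneg fun x => (Real.exp_pos _).le
    have hmul : ∀ (g : ℝ → ℝ), ∫ z : ℝ × ℝ, (Real.exp (t * g z.1) * Real.exp (-t * g z.2)
          + Real.exp (-t * g z.1) * Real.exp (t * g z.2)) / 2 ∂(γ.prod γ)
        = ∫ z : ℝ × ℝ, Real.cosh (t * (g z.1 - g z.2)) ∂(γ.prod γ) := by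
      intro g
      refine integral_congr_ae (ae_of_all _ fun z => ?_)
      simp only
      rw [Real.cosh_eq, ← Real.exp_add, ← Real.exp_add]
      congr 3 <;> ring
    have hval : ∀ (g : ℝ → ℝ), (∀ s, Integrable (fun x => Real.exp (s * g x)) γ) →
        Integrable (fun z : ℝ × ℝ => (Real.exp (t * g z.1) * Real.exp (-t * g z.2)
          + Real.exp (-t * g z.1) * Real.exp (t * g z.2)) / 2) (γ.prod γ) ∧
        ∫ z : ℝ × ℝ, (Real.exp (t * g z.1) * Real.exp (-t * g z.2)
          + Real.exp (-t * g z.1) * Real.exp (t * g z.2)) / 2 ∂(γ.prod γ)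
        = (∫ x, Real.exp (t * g x) ∂γ) * ∫ x, Real.exp (-t * g x) ∂γ := by
      intro g hg
      have i1 := (hg t).mul_prod (hg (-t))
      have i2 := (hg (-t)).mul_prod (hg t)
      refine ⟨(i1.add i2).div_const 2, ?_⟩
      rw [integral_div, integral_add i1 i2,
        integral_prod_mul (fun x => Real.exp (t * g x)) (fun x => Real.exp (-t * g x)),
        integral_prod_mul (fun x => Real.exp (-t * g x)) (fun x => Real.exp (t * g x))]
      ring
    have hci : ∀ (g : ℝ → ℝ), (∀ s, Integrable (fun x => Real.exp (s * g x)) γ) →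
        Integrable (fun z : ℝ × ℝ => Real.cosh (t * (g z.1 - g z.2))) (γ.prod γ) := by
      intro g hg
      refine (hval g hg).1.congr (ae_of_all _ fun z => ?_)
      simp only
      rw [Real.cosh_eq, ← Real.exp_add, ← Real.exp_add]
      congr 3 <;> ring
    calc mgf f γ t = ∫ x, Real.exp (t * f x) ∂γ := rfl
      _ ≤ (∫ x, Real.exp (t * f x) ∂γ) * ∫ x, Real.exp (-t * f x) ∂γ :=
        le_mul_of_one_le_right hnn hone
      _ = ∫ z : ℝ × ℝ, Real.cosh (t * (f z.1 - f z.2)) ∂(γ.prod γ) := by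
        rw [← (hval f hI).2, hmul]
      _ ≤ ∫ z : ℝ × ℝ, Real.cosh (t * (z.1 - z.2)) ∂(γ.prod γ) := by
        refine integral_mono (hci f hI) (hci id hGi) fun z => ?_
        simp only
        rw [Real.cosh_le_cosh, abs_mul, abs_mul]
        refine mul_le_mul_of_nonneg_left ?_ (abs_nonneg _)
        have : f z.1 - f z.2 = |c + z.1| - |c + z.2| := by simp [hf]
        rw [this]
        refine (abs_abs_sub_abs_le _ _).trans (le_of_eq ?_)
        congr 1
        ring
      _ = (∫ x, Real.exp (t * x) ∂γ) * ∫ x, Real.exp (-t * x) ∂γ := by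
        have := (hval id hGi).2
        rw [hmul id] at this
        simpa using this
      _ = _ := by
        rw [hG, hG, ← Real.exp_add]
        congr 1
        push_cast
        ring

/-- Law of the feature vector `μ`. -/
noncomputable def meanLaw (p : ℕ) (ε τ : ℝ) : Measure (Fin p → ℝ) :=
  Measure.pi fun _ => muLaw ε τ

lemma isProbabilityMeasure_meanLaw (p : ℕ) {ε τ : ℝ} (h0 : 0 ≤ ε) (h1 : ε ≤ 1) :
    IsProbabilityMeasure (meanLaw p ε τ) := by
  have := isProbabilityMeasure_muLaw (τ := τ) h0 h1
  unfold meanLaw; infer_instance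

lemma isProbabilityMeasure_jointLaw (n p : ℕ) {ε τ : ℝ} (h0 : 0 ≤ ε) (h1 : ε ≤ 1) :
    IsProbabilityMeasure (jointLaw n p ε τ) := by
  have := isProbabilityMeasure_muLaw (τ := τ) h0 h1
  unfold jointLaw; infer_instance

lemma measurePreserving_mean (n p : ℕ) {ε τ : ℝ} (h0 : 0 ≤ ε) (h1 : ε ≤ 1) :
    MeasurePreserving (fun ω : Omega n p => ω.2.1) (jointLaw n p ε τ) (meanLaw p ε τ) := by
  have := isProbabilityMeasure_muLaw (τ := τ) h0 h1
  have := isProbabilityMeasure_meanLaw p (τ := τ) h0 h1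
  exact (measurePreserving_fst (μ := meanLaw p ε τ) (ν := noiseLaw n p)).comp
    (measurePreserving_snd (μ := Measure.pi fun _ : Fin n => signLaw))

lemma ae_signLaw (n : ℕ) :
    ∀ᵐ ℓ ∂(Measure.pi fun _ : Fin n => signLaw), ∀ i, ℓ i = 1 ∨ ℓ i = -1 := by
  rw [ae_all_iff]
  intro i
  have h : ∀ᵐ x ∂signLaw, x = 1 ∨ x = -1 := by
    unfold signLaw
    rw [ae_add_measure_iff]
    constructor <;> refine Measure.ae_smul_measure ?_ _ <;> rw [ae_dirac_iff (by measurability)] <;>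
      simp
  exact (measurePreserving_eval (fun _ : Fin n => signLaw) i).quasiMeasurePreserving.ae h

lemma ae_meanLaw (p : ℕ) {ε τ : ℝ} (h0 : 0 ≤ ε) (h1 : ε ≤ 1) :
    ∀ᵐ m ∂(meanLaw p ε τ), ∀ j, m j = 0 ∨ m j = τ := by
  have := isProbabilityMeasure_muLaw (τ := τ) h0 h1
  rw [ae_all_iff]
  intro j
  have h : ∀ᵐ x ∂(muLaw ε τ), x = 0 ∨ x = τ := by
    unfold muLaw
    rw [ae_add_measure_iff]
    constructor <;> refine Measure.ae_smul_measure ?_ _ <;> rw [ae_dirac_iff (by measurability)] <;>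
      simp
  exact (measurePreserving_eval (fun _ : Fin p => muLaw ε τ) j).quasiMeasurePreserving.ae h

/-- A bound on the conditional noise probability given `(ℓ, μ)` transfers to the joint law. -/
lemma jointLaw_real_le {n p : ℕ} {ε τ : ℝ} (h0 : 0 ≤ ε) (h1 : ε ≤ 1) {E : Set (Omega n p)}
    (hE : MeasurableSet E) {G : Set (Fin p → ℝ)} (hG : MeasurableSet G)
    (hEG : ∀ ω ∈ E, ω.2.1 ∈ G) {c : ℝ} (hc : 0 ≤ c)
    (h : ∀ ℓ : Fin n → ℝ, (∀ i, ℓ i = 1 ∨ ℓ i = -1) → ∀ m ∈ G, (∀ j, m j = 0 ∨ m j = τ) →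
      (noiseLaw n p).real {Z | (ℓ, m, Z) ∈ E} ≤ c) :
    (jointLaw n p ε τ).real E ≤ c * (meanLaw p ε τ).real G := by
  have := isProbabilityMeasure_muLaw (τ := τ) h0 h1
  have := isProbabilityMeasure_meanLaw p (τ := τ) h0 h1
  have key : (jointLaw n p ε τ) E ≤ ENNReal.ofReal c * meanLaw p ε τ G := by
    have hj : jointLaw n p ε τ = (Measure.pi fun _ : Fin n => signLaw).prod
      ((meanLaw p ε τ).prod (noiseLaw n p)) := rfl
    rw [hj, Measure.prod_apply hE]
    calc ∫⁻ ℓ, ((meanLaw p ε τ).prod (noiseLaw n p)) (Prod.mk ℓ ⁻¹' E)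
          ∂(Measure.pi fun _ : Fin n => signLaw)
        ≤ ∫⁻ _, ENNReal.ofReal c * meanLaw p ε τ G ∂(Measure.pi fun _ : Fin n => signLaw) := by
          refine lintegral_mono_ae ((ae_signLaw n).mono fun ℓ hℓ => ?_)
          rw [Measure.prod_apply (measurable_prodMk_left hE),
            ← lintegral_indicator_const hG]
          refine lintegral_mono_ae ((ae_meanLaw p h0 h1).mono fun m hm => ?_)
          rw [Set.indicator_apply]
          split_ifs with hmG
          · have h2 := h ℓ hℓ m hmG hm
            rw [measureReal_def] at h2
            exact (ENNReal.le_ofReal_iff_toReal_le (measure_ne_top _ _) hc).2 h2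
          · have : Prod.mk m ⁻¹' (Prod.mk ℓ ⁻¹' E) = ∅ := by
              ext Z
              simp only [Set.mem_preimage, Set.mem_empty_iff_false, iff_false]
              exact fun hZ => hmG (hEG _ hZ)
            rw [this]; simp
      _ = _ := by simp
  rw [measureReal_def, measureReal_def, ← ENNReal.toReal_ofReal hc, ← ENNReal.toReal_mul]
  exact ENNReal.toReal_mono (ENNReal.mul_ne_top ENNReal.ofReal_ne_top (measure_ne_top _ _)) key

lemma muLaw_real_ne_zero {ε τ : ℝ} (h0 : 0 ≤ ε) (hτ : τ ≠ 0) :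
    (muLaw ε τ).real {x | x ≠ 0} = ε := by
  rw [measureReal_def, muLaw, Measure.add_apply, Measure.smul_apply, Measure.smul_apply,
    Measure.dirac_apply' _ (by measurability), Measure.dirac_apply' _ (by measurability)]
  simp [hτ, h0]

lemma meanLaw_real_ne_zero {p : ℕ} {ε τ : ℝ} (h0 : 0 ≤ ε) (h1 : ε ≤ 1) (hτ : τ ≠ 0) (j : Fin p) :
    (meanLaw p ε τ).real {m | m j ≠ 0} = ε := by
  have := isProbabilityMeasure_muLaw (τ := τ) h0 h1
  have h := (measurePreserving_eval (fun _ : Fin p => muLaw ε τ) j).measureReal_preimage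
    (s := {x : ℝ | x ≠ 0}) (MeasurableSet.nullMeasurableSet (by measurability))
  rw [muLaw_real_ne_zero h0 hτ] at h
  exact h

lemma card_suppSet_eq_sum {p : ℕ} (m : Fin p → ℝ) :
    ((suppSet m).card : ℝ) = ∑ j, Set.indicator {x : ℝ | x ≠ 0} (fun _ => (1 : ℝ)) (m j) := by
  rw [suppSet, Finset.card_filter]
  push_cast
  refine Finset.sum_congr rfl fun j _ => ?_
  by_cases h : m j = 0 <;> simp [h]

lemma measurable_card_suppSet (p : ℕ) :
    Measurable (fun m : Fin p → ℝ => ((suppSet m).card : ℝ)) := by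
  simp_rw [card_suppSet_eq_sum]
  have : Measurable (Set.indicator {x : ℝ | x ≠ 0} (fun _ => (1 : ℝ))) :=
    measurable_const.indicator (by measurability)
  fun_prop

lemma memLp_card_suppSet (p : ℕ) {ε τ : ℝ} (h0 : 0 ≤ ε) (h1 : ε ≤ 1) :
    MemLp (fun m : Fin p → ℝ => ((suppSet m).card : ℝ)) 2 (meanLaw p ε τ) := by
  have := isProbabilityMeasure_meanLaw p (τ := τ) h0 h1
  refine MemLp.of_bound (measurable_card_suppSet p).aestronglyMeasurable p (ae_of_all _ fun m => ?_)
  simpa using (Finset.card_le_univ (suppSet m))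

lemma integral_card_suppSet (p : ℕ) {ε τ : ℝ} (h0 : 0 ≤ ε) (h1 : ε ≤ 1) (hτ : τ ≠ 0) :
    ∫ m, ((suppSet m).card : ℝ) ∂meanLaw p ε τ = p * ε := by
  have := isProbabilityMeasure_meanLaw p (τ := τ) h0 h1
  have hs : ∀ j : Fin p, MeasurableSet {m : Fin p → ℝ | m j ≠ 0} := fun j => by measurability
  have he : ∀ m : Fin p → ℝ, ((suppSet m).card : ℝ)
      = ∑ j, Set.indicator {m : Fin p → ℝ | m j ≠ 0} (fun _ => (1 : ℝ)) m := fun m => by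
    rw [card_suppSet_eq_sum]; rfl
  simp_rw [he]
  rw [integral_finsetSum _ fun j _ => (integrable_const _).indicator (hs j)]
  simp_rw [integral_indicator_const _ (hs _), meanLaw_real_ne_zero h0 h1 hτ]
  simp

lemma variance_card_suppSet_le (p : ℕ) {ε τ : ℝ} (h0 : 0 ≤ ε) (h1 : ε ≤ 1) (hτ : τ ≠ 0) :
    Var[fun m : Fin p → ℝ => ((suppSet m).card : ℝ); meanLaw p ε τ] ≤ p * ε := by
  have := isProbabilityMeasure_muLaw (τ := τ) h0 h1
  have hm : MeasurableSet {x : ℝ | x ≠ 0} := by measurability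
  have hL : MemLp (Set.indicator {x : ℝ | x ≠ 0} (fun _ => (1 : ℝ))) 2 (muLaw ε τ) :=
    (memLp_const 1).indicator hm
  have h := variance_sum_pi (μ := fun _ : Fin p => muLaw ε τ)
    (X := fun _ => Set.indicator {x : ℝ | x ≠ 0} (fun _ => (1 : ℝ))) (fun _ => hL)
  have e : (fun m : Fin p → ℝ => ((suppSet m).card : ℝ))
      = ∑ j, fun m => Set.indicator {x : ℝ | x ≠ 0} (fun _ => (1 : ℝ)) (m j) := by
    funext m
    rw [card_suppSet_eq_sum, Finset.sum_apply]
  rw [e, meanLaw, h]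
  have h2 : Var[Set.indicator {x : ℝ | x ≠ 0} (fun _ => (1 : ℝ)); muLaw ε τ] ≤ ε := by
    refine (variance_le_expectation_sq hL.aestronglyMeasurable).trans (le_of_eq ?_)
    have : (Set.indicator {x : ℝ | x ≠ 0} (fun _ => (1 : ℝ))) ^ 2
        = Set.indicator {x : ℝ | x ≠ 0} (fun _ => (1 : ℝ)) := by
      funext x
      by_cases hx : x = 0 <;> simp [hx]
    rw [this, integral_indicator_const _ hm, muLaw_real_ne_zero h0 hτ]
    simp
  calc _ ≤ ∑ _j : Fin p, ε := Finset.sum_le_sum fun j _ => h2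
    _ = _ := by simp

lemma meanLaw_real_card_suppSet_le {p : ℕ} {ε τ : ℝ} (h0 : 0 ≤ ε) (h1 : ε ≤ 1) (hτ : τ ≠ 0)
    (hpe : 0 < p * ε) :
    (meanLaw p ε τ).real {m | ((suppSet m).card : ℝ) ≤ p * ε / 2} ≤ 4 / (p * ε) := by
  have := isProbabilityMeasure_meanLaw p (τ := τ) h0 h1
  have h := meas_ge_le_variance_div_sq (memLp_card_suppSet p (τ := τ) h0 h1)
    (c := p * ε / 2) (by linarith)
  rw [integral_card_suppSet p h0 h1 hτ] at h
  have hsub : {m : Fin p → ℝ | ((suppSet m).card : ℝ) ≤ p * ε / 2}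
      ⊆ {m | p * ε / 2 ≤ |((suppSet m).card : ℝ) - p * ε|} := by
    intro m hm
    rw [Set.mem_ofPred_eq] at hm ⊢
    rw [abs_sub_comm]
    exact le_trans (by linarith) (le_abs_self _)
  refine (measureReal_mono hsub).trans ?_
  have hv := variance_card_suppSet_le p (τ := τ) h0 h1 hτ
  have hd : Var[fun m : Fin p → ℝ => ((suppSet m).card : ℝ); meanLaw p ε τ] / (p * ε / 2) ^ 2
      ≤ 4 / (p * ε) := by
    rw [div_le_div_iff₀ (by positivity) hpe]
    nlinarith
  exact (ENNReal.toReal_le_of_le_ofReal (div_nonneg (variance_nonneg _ _) (by positivity)) h).trans hd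

lemma integral_abs_card_suppSet_sub_le {p : ℕ} {ε τ : ℝ} (h0 : 0 ≤ ε) (h1 : ε ≤ 1) (hτ : τ ≠ 0)
    (hpe : 0 < p * ε) :
    ∫ m, |((suppSet m).card : ℝ) - p * ε| ∂meanLaw p ε τ ≤ Real.sqrt (p * ε) := by
  have := isProbabilityMeasure_meanLaw p (τ := τ) h0 h1
  set s := Real.sqrt (p * ε) with hs
  have hs0 : 0 < s := Real.sqrt_pos.2 hpe
  have hss : s * s = p * ε := Real.mul_self_sqrt hpe.le
  have hL := (memLp_card_suppSet p (τ := τ) h0 h1).sub (memLp_const (p * ε))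
  have hv := variance_card_suppSet_le p (τ := τ) h0 h1 hτ
  rw [variance_eq_integral (measurable_card_suppSet p).aemeasurable,
    integral_card_suppSet p h0 h1 hτ] at hv
  have hsq : Integrable (fun m : Fin p → ℝ => (((suppSet m).card : ℝ) - p * ε) ^ 2)
    (meanLaw p ε τ) := hL.integrable_sq
  calc ∫ m, |((suppSet m).card : ℝ) - p * ε| ∂meanLaw p ε τ
      ≤ ∫ m, ((((suppSet m).card : ℝ) - p * ε) ^ 2 / (2 * s) + s / 2) ∂meanLaw p ε τ := by
        refine integral_mono ((hL.integrable (by norm_num)).abs)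
          ((hsq.div_const _).add (integrable_const _)) fun m => ?_
        simp only
        rw [← sq_abs]
        set y := |((suppSet m).card : ℝ) - p * ε|
        rw [← sub_nonneg]
        have : y ^ 2 / (2 * s) + s / 2 - y = (y - s) ^ 2 / (2 * s) := by field_simp; ring
        rw [this]; positivity
    _ = (∫ m, (((suppSet m).card : ℝ) - p * ε) ^ 2 ∂meanLaw p ε τ) / (2 * s) + s / 2 := by
        rw [integral_add (hsq.div_const _) (integrable_const _), integral_div]; simp
    _ ≤ (p * ε) / (2 * s) + s / 2 := by gcongr
    _ = s := by rw [← hss]; field_simp; ring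

lemma noiseLaw_real_abs_linear_ge_le {n p : ℕ} (w : Fin n → Fin p → ℝ) {t : ℝ} (ht : 0 ≤ t) :
    (noiseLaw n p).real {Z | t ≤ |∑ i, ∑ j, w i j * Z i j|}
      ≤ 2 * Real.exp (-t ^ 2 / (2 * ∑ i, ∑ j, w i j ^ 2)) := by
  have h := noiseLaw_real_abs_sum_ge_le (fun i => hasSubgaussianMGF_linear p (w i)) ht
  push_cast at h
  simpa only [Real.norm_eq_abs, sq_abs] using h

/-- Exceptional event for Simple Aggregation: too few signals, or too much noise in a row sum. -/
def simpleAggBad (n p : ℕ) (ε τ : ℝ) : Set (Omega n p) :=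
  {ω | ((suppSet ω.2.1).card : ℝ) ≤ p * ε / 2} ∪ ⋃ i, {ω | τ * (p * ε / 2) ≤ |∑ j, ω.2.2 i j|}

lemma noiseLaw_real_abs_row_sum_ge_le {n p : ℕ} (i : Fin n) {t : ℝ} (ht : 0 ≤ t) :
    (noiseLaw n p).real {Z | t ≤ |∑ j, Z i j|} ≤ 2 * Real.exp (-t ^ 2 / (2 * p)) := by
  have h := noiseLaw_real_abs_linear_ge_le (n := n) (p := p) (fun k _ => if k = i then 1 else 0) ht
  simpa using h

lemma noiseLaw_real_abs_col_sum_ge_le {n p : ℕ} (hn : 0 < n) {ℓ : Fin n → ℝ}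
    (hℓ : ∀ i, ℓ i = 1 ∨ ℓ i = -1) (j : Fin p) {t : ℝ} (ht : 0 ≤ t) :
    (noiseLaw n p).real {Z | t ≤ |(Real.sqrt n)⁻¹ * ∑ i, ℓ i * Z i j|}
      ≤ 2 * Real.exp (-t ^ 2 / 2) := by
  have h := noiseLaw_real_abs_linear_ge_le (n := n) (p := p)
    (fun i k => if k = j then (Real.sqrt n)⁻¹ * ℓ i else 0) ht
  have h1 : ∀ i, ℓ i ^ 2 = 1 := fun i => by rcases hℓ i with h | h <;> rw [h] <;> norm_num
  have hn' : (n : ℝ) ≠ 0 := by positivity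
  have h2 : ∑ i : Fin n, ∑ k : Fin p, (if k = j then (Real.sqrt n)⁻¹ * ℓ i else 0) ^ 2 = 1 := by
    simp [ite_pow, mul_pow, h1, hn']
  rw [h2, mul_one] at h
  refine le_trans (le_of_eq ?_) h
  congr 1
  ext Z
  simp [Finset.mul_sum, mul_assoc]

lemma jointLaw_real_simpleAggBad_le {n p : ℕ} {ε τ : ℝ} (h0 : 0 ≤ ε) (h1 : ε ≤ 1) (hτ : 0 < τ)
    (hpe : 0 < p * ε) :
    (jointLaw n p ε τ).real (simpleAggBad n p ε τ)
      ≤ 4 / (p * ε) + n * (2 * Real.exp (-(τ * (p * ε / 2)) ^ 2 / (2 * p))) := by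
  have := isProbabilityMeasure_jointLaw n p (τ := τ) h0 h1
  have := isProbabilityMeasure_meanLaw p (τ := τ) h0 h1
  refine (measureReal_union_le _ _).trans (add_le_add ?_ ?_)
  · refine le_trans (le_of_eq ?_) (meanLaw_real_card_suppSet_le h0 h1 hτ.ne' hpe)
    exact (measurePreserving_mean n p h0 h1).measureReal_preimage
      (measurableSet_le (measurable_card_suppSet p) measurable_const).nullMeasurableSet
  · refine (measureReal_iUnion_fintype_le _).trans ?_
    refine (Finset.sum_le_sum (g := fun _ => 2 * Real.exp (-(τ * (p * ε / 2)) ^ 2 / (2 * p)))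
      fun i _ => ?_).trans (by simp)
    refine (jointLaw_real_le h0 h1 (measurableSet_le measurable_const (by fun_prop))
      MeasurableSet.univ (fun _ _ => Set.mem_univ _)
      (c := 2 * Real.exp (-(τ * (p * ε / 2)) ^ 2 / (2 * p))) (by positivity)
      fun ℓ _ m _ _ => ?_).trans (by simp)
    exact noiseLaw_real_abs_row_sum_ge_le i (by positivity)

/-- The statistic of Simple Aggregation splits into signal plus noise off the exceptional event. -/
lemma ySA_dataMap {n p : ℕ} {ε τ : ℝ} (hτ : 0 < τ) {ω : Omega n p}
    (hω : ω ∉ simpleAggBad n p ε τ) (hℓ : ∀ i, ω.1 i = 1 ∨ ω.1 i = -1)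
    (hm : ∀ j, ω.2.1 j = 0 ∨ ω.2.1 j = τ) (j : Fin p) :
    ySA (dataMap ω) j
      = Real.sqrt n * ω.2.1 j + (Real.sqrt n)⁻¹ * ∑ i, ω.1 i * ω.2.2 i j := by
  simp only [simpleAggBad, Set.mem_union, Set.mem_iUnion, Set.mem_ofPred_eq, not_or, not_exists,
    not_le] at hω
  obtain ⟨hS, hZ⟩ := hω
  have hsum : ∑ j, ω.2.1 j = τ * (suppSet ω.2.1).card := by
    rw [suppSet, Finset.card_filter]
    push_cast
    rw [Finset.mul_sum]
    refine Finset.sum_congr rfl fun k _ => ?_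
    rcases hm k with h | h <;> simp [h, hτ.ne']
  have hell : ∀ i, ellSimpleAgg (dataMap ω) i = ω.1 i := by
    intro i
    have hlt : |∑ j, ω.2.2 i j| < ∑ j, ω.2.1 j := by
      rw [hsum]
      exact (hZ i).trans (mul_lt_mul_of_pos_left hS hτ)
    rw [abs_lt] at hlt
    have e : ∑ j, dataMap ω i j = ω.1 i * (∑ j, ω.2.1 j) + ∑ j, ω.2.2 i j := by
      simp [dataMap, Finset.sum_add_distrib, Finset.mul_sum]
    rw [ellSimpleAgg, e]
    rcases hℓ i with h | h <;> rw [h]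
    · rw [Real.sign_of_pos (by linarith)]
    · rw [Real.sign_of_neg (by linarith)]
  have hterm : ∀ i, dataMap ω i j * ω.1 i = ω.2.1 j + ω.1 i * ω.2.2 i j := by
    intro i
    have : ω.1 i ^ 2 = 1 := by rcases hℓ i with h | h <;> rw [h] <;> norm_num
    rw [dataMap]
    linear_combination ω.2.1 j * this
  simp only [ySA, hell, hterm, Finset.sum_add_distrib]
  rw [mul_add, Finset.sum_const, Finset.card_univ, Fintype.card_fin, nsmul_eq_mul]
  congr 1
  rcases Nat.eq_zero_or_pos n with h | h
  · simp [h]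
  · have : (0 : ℝ) < n := by positivity
    have h2 := Real.mul_self_sqrt this.le
    have h3 : 0 < Real.sqrt n := Real.sqrt_pos.2 this
    field_simp
    rw [sq, h2]

lemma ae_jointLaw (n p : ℕ) {ε τ : ℝ} (h0 : 0 ≤ ε) (h1 : ε ≤ 1) :
    ∀ᵐ ω ∂jointLaw n p ε τ, (∀ i, ω.1 i = 1 ∨ ω.1 i = -1) ∧ ∀ j, ω.2.1 j = 0 ∨ ω.2.1 j = τ := by
  have := isProbabilityMeasure_muLaw (τ := τ) h0 h1
  have := isProbabilityMeasure_meanLaw p (τ := τ) h0 h1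
  have hfst : MeasurePreserving (fun ω : Omega n p => ω.1) (jointLaw n p ε τ)
      (Measure.pi fun _ : Fin n => signLaw) :=
    measurePreserving_fst (ν := (meanLaw p ε τ).prod (noiseLaw n p))
  exact (hfst.quasiMeasurePreserving.ae (ae_signLaw n)).and
    ((measurePreserving_mean n p h0 h1).quasiMeasurePreserving.ae (ae_meanLaw p h0 h1))

lemma hammingSig_ShatSA_le {n p : ℕ} (hn : 0 < n) (hp : 0 < p) {ε τ : ℝ} (h0 : 0 < ε) (h1 : ε ≤ 1)
    (hτ : 0 < τ) (hsep : 2 * Real.sqrt (2 * Real.log p) ≤ Real.sqrt n * τ) :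
    hammingSig n p ε τ dataMap ShatSA
      ≤ 2 / ε * (4 / (p * ε) + n * (2 * Real.exp (-(τ * (p * ε / 2)) ^ 2 / (2 * p))))
        + 2 / (p * ε) + 2 / p := by
  have := isProbabilityMeasure_jointLaw n p (τ := τ) h0.le h1
  have := isProbabilityMeasure_meanLaw p (τ := τ) h0.le h1
  have hp' : (1 : ℝ) ≤ p := by exact_mod_cast hp
  have hpe : 0 < p * ε := by positivity
  set b := 4 / (p * ε) + n * (2 * Real.exp (-(τ * (p * ε / 2)) ^ 2 / (2 * p))) with hb
  have hbad := jointLaw_real_simpleAggBad_le (n := n) h0.le h1 hτ hpe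
  rw [← hb] at hbad
  set t := Real.sqrt (2 * Real.log p) with ht
  have ht0 : 0 ≤ t := Real.sqrt_nonneg _
  have hexp : Real.exp (-t ^ 2 / 2) = 1 / p := by
    rw [ht, Real.sq_sqrt (by have := Real.log_nonneg hp'; positivity)]
    rw [show -(2 * Real.log p) / 2 = -Real.log p by ring, Real.exp_neg, Real.exp_log (by linarith),
      one_div]
  have hW : ∀ j : Fin p, Measurable fun ω : Omega n p =>
      |(Real.sqrt n)⁻¹ * ∑ i, ω.1 i * ω.2.2 i j| := fun j => by fun_prop
  have hnull : ∀ j : Fin p, ((jointLaw n p ε τ) {ω | ω.2.1 j = 0 ∧ j ∈ ShatSA (dataMap ω)}).toReal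
      ≤ b + 2 / p := by
    intro j
    have hsub : {ω | ω.2.1 j = 0 ∧ j ∈ ShatSA (dataMap ω)} ≤ᵐ[jointLaw n p ε τ]
        (simpleAggBad n p ε τ ∪ {ω | t ≤ |(Real.sqrt n)⁻¹ * ∑ i, ω.1 i * ω.2.2 i j|} : Set _) := by
      filter_upwards [ae_jointLaw n p h0.le h1] with ω hω hmem
      obtain ⟨hj, hmem⟩ := hmem
      by_cases hB : ω ∈ simpleAggBad n p ε τ
      · exact Or.inl hB
      · refine Or.inr ?_
        have hy := ySA_dataMap hτ hB hω.1 hω.2 j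
        rw [hj, mul_zero, zero_add] at hy
        rw [ShatSA, Finset.mem_filter, hy] at hmem
        exact hmem.2
    refine (ENNReal.toReal_mono (measure_ne_top _ _) (measure_mono_ae hsub)).trans
      ((measureReal_union_le _ _).trans (add_le_add hbad ?_))
    refine (jointLaw_real_le h0.le h1 (measurableSet_le measurable_const (hW j))
      MeasurableSet.univ (fun _ _ => Set.mem_univ _) (c := 2 / p) (by positivity)
      fun ℓ hℓ m _ _ => ?_).trans (by simp)
    refine (noiseLaw_real_abs_col_sum_ge_le hn hℓ j ht0).trans (le_of_eq ?_)
    rw [hexp]; ring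
  have hsig : ∀ j : Fin p, ((jointLaw n p ε τ) {ω | ω.2.1 j ≠ 0 ∧ j ∉ ShatSA (dataMap ω)}).toReal
      ≤ b + 2 / p * ε := by
    intro j
    have hG : MeasurableSet {m : Fin p → ℝ | m j ≠ 0} := by measurability
    have hsub : {ω | ω.2.1 j ≠ 0 ∧ j ∉ ShatSA (dataMap ω)} ≤ᵐ[jointLaw n p ε τ]
        (simpleAggBad n p ε τ ∪ ({ω | t ≤ |(Real.sqrt n)⁻¹ * ∑ i, ω.1 i * ω.2.2 i j|} ∩
          (fun ω => ω.2.1) ⁻¹' {m | m j ≠ 0}) : Set _) := by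
      filter_upwards [ae_jointLaw n p h0.le h1] with ω hω hmem
      obtain ⟨hj, hmem⟩ := hmem
      by_cases hB : ω ∈ simpleAggBad n p ε τ
      · exact Or.inl hB
      · refine Or.inr ⟨?_, hj⟩
        have hy := ySA_dataMap hτ hB hω.1 hω.2 j
        rw [(hω.2 j).resolve_left hj] at hy
        have hlt : |ySA (dataMap ω) j| < t := by
          by_contra hcon
          exact hmem (Finset.mem_filter.2 ⟨Finset.mem_univ _, not_lt.1 hcon⟩)
        rw [hy] at hlt
        rw [Set.mem_ofPred_eq]
        have h3 := (abs_lt.1 hlt).2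
        refine le_trans ?_ (neg_le_abs _)
        linarith
    refine (ENNReal.toReal_mono (measure_ne_top _ _) (measure_mono_ae hsub)).trans
      ((measureReal_union_le _ _).trans (add_le_add hbad ?_))
    refine (jointLaw_real_le h0.le h1
      ((measurableSet_le measurable_const (hW j)).inter ((by fun_prop : Measurable
        fun ω : Omega n p => ω.2.1) hG))
      hG (fun _ hω => hω.2) (c := 2 / p) (by positivity)
      fun ℓ hℓ m _ _ => ?_).trans (by rw [meanLaw_real_ne_zero h0.le h1 hτ.ne'])
    refine (measureReal_mono (fun Z hZ => hZ.1)).trans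
      ((noiseLaw_real_abs_col_sum_ge_le hn hℓ j ht0).trans (le_of_eq ?_))
    rw [hexp]; ring
  have hsum := Finset.sum_le_sum fun (j : Fin p) (_ : j ∈ Finset.univ) =>
    add_le_add (hnull j) (hsig j)
  rw [hammingSig]
  refine (mul_le_mul_of_nonneg_left hsum (by positivity)).trans (le_of_eq ?_)
  rw [Finset.sum_const, Finset.card_univ, Fintype.card_fin, nsmul_eq_mul]
  field_simp
  ring

lemma noiseLaw_linear_eq_null {n p : ℕ} {w : Fin n → Fin p → ℝ} {i₀ : Fin n} {j₀ : Fin p}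
    (hw : w i₀ j₀ ≠ 0) (c : ℝ) : (noiseLaw n p) {Z | ∑ i, ∑ j, w i j * Z i j = c} = 0 := by
  have hmeas : ∀ i, Measurable (fun z : Fin p → ℝ => ∑ j, w i j * z j) := fun i => by fun_prop
  have hrow : ∀ i, HasGaussianLaw (fun z : Fin p → ℝ => ∑ j, w i j * z j) (gaussPi p) := fun i =>
    ⟨by rw [gaussPi_map_linear]; infer_instance⟩
  have hvar : ∀ i, Var[fun z : Fin p → ℝ => ∑ j, w i j * z j; gaussPi p] = ∑ j, w i j ^ 2 := by
    intro i
    rw [← variance_id_map (hmeas i).aemeasurable, gaussPi_map_linear, variance_id_gaussianReal]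
    push_cast
    simp only [Real.norm_eq_abs, sq_abs]
  have hind : iIndepFun (fun i (Z : Fin n → Fin p → ℝ) => ∑ j, w i j * Z i j) (noiseLaw n p) :=
    iIndepFun_pi (μ := fun _ : Fin n => gaussPi p)
      (X := fun i (z : Fin p → ℝ) => ∑ j, w i j * z j) fun i => (hmeas i).aemeasurable
  have hlaw : ∀ i, HasGaussianLaw (fun Z : Fin n → Fin p → ℝ => ∑ j, w i j * Z i j)
      (noiseLaw n p) := by
    intro i
    have hmp : MeasurePreserving (Function.eval i) (noiseLaw n p) (gaussPi p) :=
      measurePreserving_eval (fun _ : Fin n => gaussPi p) i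
    refine ⟨?_⟩
    have h := (hrow i).isGaussian_map
    rwa [← hmp.map_eq, Measure.map_map (hmeas i) hmp.measurable] at h
  have hG := iIndepFun.hasGaussianLaw_fun_sum hlaw hind
  have hV := variance_sum_pi (μ := fun _ : Fin n => gaussPi p)
    (X := fun i (z : Fin p → ℝ) => ∑ j, w i j * z j) fun i => (hrow i).memLp (by norm_num)
  have e : (∑ i, fun Z : Fin n → Fin p → ℝ => ∑ j, w i j * Z i j)
      = fun Z => ∑ i, ∑ j, w i j * Z i j := by
    funext Z; simp
  simp only [hvar] at hV
  rw [e] at hV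
  have hpos : 0 < ∑ i, ∑ j, w i j ^ 2 := by
    refine Finset.sum_pos' (fun i _ => Finset.sum_nonneg fun j _ => sq_nonneg _)
      ⟨i₀, Finset.mem_univ _, Finset.sum_pos' (fun j _ => sq_nonneg _)
        ⟨j₀, Finset.mem_univ _, by positivity⟩⟩
  have hmap := hG.map_eq_gaussianReal
  have hV' : Var[fun Z : Fin n → Fin p → ℝ => ∑ i, ∑ j, w i j * Z i j; noiseLaw n p]
      = ∑ i, ∑ j, w i j ^ 2 := hV
  rw [hV'] at hmap
  have hns := nullSingletonClass_gaussianReal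
    (μ := (noiseLaw n p)[fun Z => ∑ i, ∑ j, w i j * Z i j]) (Real.toNNReal_pos.2 hpos).ne'
  have h0 := hns.measure_singleton c
  rw [← hmap, Measure.map_apply (by fun_prop) (measurableSet_singleton c)] at h0
  exact h0

/-- The objective `‖∑_{j ∈ S} x_j‖₁` of Sparse Aggregation. -/
def aggNorm {n p : ℕ} (S : Finset (Fin p)) (X : Fin n → Fin p → ℝ) : ℝ := ∑ i, |∑ j ∈ S, X i j|

lemma noiseLaw_aggNorm_eq_null {n p : ℕ} (hn : 0 < n) {S T : Finset (Fin p)}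
    (hST : ¬ S ⊆ T) (A : Fin n → Fin p → ℝ) :
    (noiseLaw n p) {Z | aggNorm S (A + Z) = aggNorm T (A + Z)} = 0 := by
  obtain ⟨j₀, hjS, hjT⟩ := Finset.not_subset.1 hST
  let s : Bool → ℝ := fun b => if b then 1 else -1
  let w : (Fin n → Bool) × (Fin n → Bool) → Fin n → Fin p → ℝ := fun b i j =>
    s (b.1 i) * (if j ∈ S then 1 else 0) - s (b.2 i) * (if j ∈ T then 1 else 0)
  have hw : ∀ b i (x : Fin p → ℝ), ∑ j, w b i j * x j
      = s (b.1 i) * ∑ j ∈ S, x j - s (b.2 i) * ∑ j ∈ T, x j := by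
    intro b i x
    simp [w, sub_mul, Finset.sum_sub_distrib, ← Finset.mul_sum]
  have habs : ∀ x : ℝ, |x| = s (decide (0 ≤ x)) * x := by
    intro x
    by_cases h : 0 ≤ x
    · simp [s, h, abs_of_nonneg h]
    · simp [s, h, abs_of_neg (not_le.1 h)]
  refine measure_mono_null (t := ⋃ b, {Z : Fin n → Fin p → ℝ | ∑ i, ∑ j, w b i j * Z i j
    = -∑ i, ∑ j, w b i j * A i j}) ?_ (measure_iUnion_null fun b => ?_)
  · intro Z hZ
    rw [Set.mem_ofPred_eq] at hZ
    refine Set.mem_iUnion.2 ⟨⟨fun i => decide (0 ≤ ∑ j ∈ S, (A + Z) i j),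
      fun i => decide (0 ≤ ∑ j ∈ T, (A + Z) i j)⟩, ?_⟩
    rw [Set.mem_ofPred_eq, ← sub_eq_zero, sub_neg_eq_add, ← Finset.sum_add_distrib]
    rw [← sub_eq_zero, aggNorm, aggNorm, ← Finset.sum_sub_distrib] at hZ
    refine Eq.trans ?_ hZ
    refine Finset.sum_congr rfl fun i _ => ?_
    rw [habs, habs, hw, hw]
    simp only [Pi.add_apply, Finset.sum_add_distrib]
    ring
  · refine noiseLaw_linear_eq_null (i₀ := ⟨0, hn⟩) (j₀ := j₀) ?_ _
    by_cases h : b.1 ⟨0, hn⟩ <;> simp [w, s, hjS, hjT, h]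

/-- Concentration of the Sparse Aggregation objective around its conditional mean. -/
lemma noiseLaw_real_aggNorm_dev_le {n p : ℕ} {τ : ℝ} {ℓ : Fin n → ℝ} {m : Fin p → ℝ}
    (hℓ : ∀ i, ℓ i = 1 ∨ ℓ i = -1) (hm : ∀ j, m j = 0 ∨ m j = τ) (hτ : τ ≠ 0)
    (S : Finset (Fin p)) {t : ℝ} (ht : 0 ≤ t) :
    (noiseLaw n p).real {Z | t ≤ |aggNorm S (dataMap (ℓ, m, Z))
        - n * absMean S.card (τ * ((S ∩ suppSet m).card : ℝ))|}
      ≤ 2 * Real.exp (-t ^ 2 / (4 * n * S.card)) := by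
  set c := τ * ((S ∩ suppSet m).card : ℝ) with hc
  have hrow : ∀ i, HasSubgaussianMGF
      (fun z : Fin p → ℝ => |ℓ i * c + ∑ j ∈ S, z j| - absMean S.card c)
      (2 * S.card) (gaussPi p) := by
    intro i
    have h := hasSubgaussianMGF_abs_add (S.card : ℝ≥0) (ℓ i * c)
    have he : absMean S.card (ℓ i * c) = absMean S.card c := by
      rcases hℓ i with h | h <;> simp [h, absMean_neg]
    rw [he, ← gaussPi_map_sum, ← HasSubgaussianMGF.id_map_iff (by fun_prop),
      Measure.map_map (by fun_prop) (by fun_prop)] at h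
    rw [← HasSubgaussianMGF.id_map_iff (by fun_prop)]
    exact h
  have h := noiseLaw_real_abs_sum_ge_le (n := n) hrow ht
  have e1 : ∑ j ∈ S, m j = c := by
    rw [hc, Finset.card_eq_sum_ones]
    push_cast
    rw [Finset.mul_sum, ← Finset.filter_mem_eq_inter, Finset.sum_filter]
    refine Finset.sum_congr rfl fun j _ => ?_
    rcases hm j with h | h <;> simp [suppSet, h, hτ]
  refine le_trans (le_of_eq ?_) (h.trans (le_of_eq ?_))
  · congr 1
    ext Z
    simp [aggNorm, dataMap, Finset.sum_add_distrib, ← Finset.mul_sum, e1]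
  · congr 3
    push_cast
    simp
    ring

@[fun_prop]
lemma measurable_dataMap (n p : ℕ) : Measurable (dataMap : Omega n p → Fin n → Fin p → ℝ) := by
  unfold dataMap
  fun_prop

@[fun_prop]
lemma measurable_aggNorm {n p : ℕ} (S : Finset (Fin p)) :
    Measurable (aggNorm S : (Fin n → Fin p → ℝ) → ℝ) := by
  unfold aggNorm
  simp only [← Real.norm_eq_abs]
  fun_prop

lemma measurable_card_inter_suppSet {p : ℕ} (S : Finset (Fin p)) :
    Measurable fun m : Fin p → ℝ => (S ∩ suppSet m).card := by
  have e : (fun m : Fin p → ℝ => (S ∩ suppSet m).card)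
      = fun m => ∑ j ∈ S, if m j = 0 then 0 else 1 := by
    funext m
    rw [Finset.card_eq_sum_ones, ← Finset.filter_mem_eq_inter, Finset.sum_filter]
    refine Finset.sum_congr rfl fun j _ => ?_
    by_cases h : m j = 0 <;> simp [suppSet, h]
  rw [e]
  refine Finset.measurable_fun_sum _ fun j _ => ?_
  exact Measurable.ite (measurableSet_eq_fun (by fun_prop) measurable_const) measurable_const
    measurable_const

/-- Exceptional event for Sparse Aggregation: some objective value is off its conditional mean. -/
def sparseAggBad (n p N : ℕ) (τ t : ℝ) : Set (Omega n p) :=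
  ⋃ S ∈ Finset.powersetCard N (Finset.univ : Finset (Fin p)),
    {ω | t ≤ |aggNorm S (dataMap ω) - n * absMean N (τ * ((S ∩ suppSet ω.2.1).card : ℝ))|}

lemma measurableSet_aggNorm_dev {n p : ℕ} (N : ℕ) (τ t : ℝ) (S : Finset (Fin p)) :
    MeasurableSet {ω : Omega n p |
      t ≤ |aggNorm S (dataMap ω) - n * absMean N (τ * ((S ∩ suppSet ω.2.1).card : ℝ))|} := by
  have h : Measurable fun ω : Omega n p =>
      absMean N (τ * ((S ∩ suppSet ω.2.1).card : ℝ)) :=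
    (measurable_from_nat (f := fun k : ℕ => absMean N (τ * (k : ℝ)))).comp
      ((measurable_card_inter_suppSet S).comp (by fun_prop))
  have h2 : Measurable fun ω : Omega n p => aggNorm S (dataMap ω) := by fun_prop
  refine measurableSet_le measurable_const ?_
  simp only [← Real.norm_eq_abs]
  fun_prop

lemma measurableSet_sparseAggBad (n p N : ℕ) (τ t : ℝ) :
    MeasurableSet (sparseAggBad n p N τ t) :=
  Finset.measurableSet_biUnion _ fun S _ => measurableSet_aggNorm_dev N τ t S

lemma jointLaw_real_sparseAggBad_le {n p N : ℕ} {ε τ t : ℝ} (h0 : 0 ≤ ε) (h1 : ε ≤ 1) (hτ : τ ≠ 0)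
    (ht : 0 ≤ t) :
    (jointLaw n p ε τ).real (sparseAggBad n p N τ t)
      ≤ p ^ N * (2 * Real.exp (-t ^ 2 / (4 * n * N))) := by
  have := isProbabilityMeasure_jointLaw n p (τ := τ) h0 h1
  have := isProbabilityMeasure_meanLaw p (τ := τ) h0 h1
  refine (measureReal_biUnion_finset_le _ _).trans ?_
  refine (Finset.sum_le_sum (g := fun _ => 2 * Real.exp (-t ^ 2 / (4 * n * N)))
    fun S hS => ?_).trans ?_
  · have hc := (Finset.mem_powersetCard.1 hS).2
    refine (jointLaw_real_le h0 h1 (measurableSet_aggNorm_dev N τ t S)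
      MeasurableSet.univ (fun _ _ => Set.mem_univ _)
      (c := 2 * Real.exp (-t ^ 2 / (4 * n * N))) (by positivity)
      fun ℓ hℓ m _ hm => ?_).trans (by simp)
    have h := noiseLaw_real_aggNorm_dev_le (n := n) hℓ hm hτ S ht
    rw [hc] at h
    exact h
  · rw [Finset.sum_const, Finset.card_powersetCard, Finset.card_univ, Fintype.card_fin,
      nsmul_eq_mul]
    gcongr
    exact_mod_cast Nat.choose_le_pow p N

/-- Off the exceptional event, a maximizer misses few of the attainable true signals. -/
lemma card_inter_suppSet_ge {n p N : ℕ} (hn : 0 < n) (hN : 0 < N) {τ t : ℝ} (hτ : 0 < τ)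
    {ω : Omega n p} (hω : ω ∉ sparseAggBad n p N τ t)
    (hM : (N : ℝ) ≤ 4 * (suppSet ω.2.1).card) {S : Finset (Fin p)} (hS : S.card = N)
    (hmax : ∀ T : Finset (Fin p), T.card = N →
      aggNorm T (dataMap ω) ≤ aggNorm S (dataMap ω)) :
    min ((suppSet ω.2.1).card : ℝ) N - ((S ∩ suppSet ω.2.1).card : ℝ)
      ≤ 2 * t / (n * absMeanConst * τ * min (τ * Real.sqrt N / 4) 1) := by
  set U := suppSet ω.2.1 with hU
  set a : ℝ := min (U.card : ℝ) N with ha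
  set b : ℝ := ((S ∩ U).card : ℝ) with hb
  have hn' : (0 : ℝ) < n := by positivity
  have hN' : (0 : ℝ) < N := by positivity
  have hκ := absMeanConst_pos
  have hdev : ∀ T : Finset (Fin p), T.card = N →
      |aggNorm T (dataMap ω) - n * absMean N (τ * ((T ∩ U).card : ℝ))| < t := by
    intro T hT
    by_contra hcon
    exact hω (Set.mem_iUnion₂.2 ⟨T, Finset.mem_powersetCard.2 ⟨Finset.subset_univ _, hT⟩,
      not_lt.1 hcon⟩)
  obtain ⟨T, hT, hTa⟩ : ∃ T : Finset (Fin p), T.card = N ∧ ((T ∩ U).card : ℝ) = a := by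
    rcases le_total N U.card with h | h
    · obtain ⟨T, hTU, hT⟩ := Finset.exists_subset_card_eq h
      refine ⟨T, hT, ?_⟩
      rw [Finset.inter_eq_left.2 hTU, hT, ha, min_eq_right (by exact_mod_cast h)]
    · obtain ⟨T, hUT, -, hT⟩ := Finset.exists_subsuperset_card_eq (Finset.subset_univ U) h
        (by rw [← hS]; exact Finset.card_le_univ S)
      refine ⟨T, hT, ?_⟩
      rw [Finset.inter_eq_right.2 hUT, ha, min_eq_left (by exact_mod_cast h)]
  have haN : (N : ℝ) / 4 ≤ a := le_min (by linarith) (by linarith)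
  have ha0 : 0 < a := by linarith
  have hb0 : 0 ≤ b := by positivity
  have hba : b ≤ a := by
    refine le_min ?_ ?_
    · exact Nat.cast_le.2 (Finset.card_le_card Finset.inter_subset_right)
    · rw [← hS]; exact Nat.cast_le.2 (Finset.card_le_card Finset.inter_subset_left)
  have hdT := (abs_lt.1 (hdev T hT)).1
  have hdS := (abs_lt.1 (hdev S hS)).2
  rw [hTa] at hdT
  have hcmp : n * (absMean N (τ * a) - absMean N (τ * b)) ≤ 2 * t := by
    have := hmax T hT
    linarith
  have hconv := absMean_convex (N : ℝ≥0) (τ * a) (δ := 1 - b / a)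
    (sub_nonneg.2 ((div_le_one ha0).2 hba)) (by have : 0 ≤ b / a := by positivity
                                                linarith)
  have hba' : (1 - (1 - b / a)) * (τ * a) = τ * b := by field_simp; ring
  rw [hba'] at hconv
  have hgap := absMean_gap (v := (N : ℝ≥0)) (by exact_mod_cast hN.ne') (c := τ * a) (by positivity)
  have hq : min (τ * Real.sqrt N / 4) 1 ≤ min (τ * a / Real.sqrt N) 1 := by
    refine min_le_min_right _ ?_
    rw [le_div_iff₀ (by positivity)]
    have := Real.mul_self_sqrt hN'.le
    nlinarith
  set q := min (τ * Real.sqrt N / 4) 1 with hqd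
  have hq0 : 0 < q := lt_min (by positivity) one_pos
  rw [le_div_iff₀ (by positivity)]
  have hgap' : absMeanConst * (τ * a) * q ≤ absMean N (τ * a) - absMean N 0 := by
    refine le_trans ?_ hgap
    push_cast
    gcongr
  have hδ : 0 ≤ 1 - b / a := sub_nonneg.2 ((div_le_one ha0).2 hba)
  calc (a - b) * (n * absMeanConst * τ * q)
      = n * ((1 - b / a) * (absMeanConst * (τ * a) * q)) := by field_simp
    _ ≤ n * ((1 - b / a) * (absMean N (τ * a) - absMean N 0)) := by gcongr
    _ ≤ n * (absMean N (τ * a) - absMean N (τ * b)) := by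
        gcongr
        linarith
    _ ≤ 2 * t := hcmp

lemma jointLaw_aggNorm_eq_null {n p : ℕ} (hn : 0 < n) {ε τ : ℝ} (h0 : 0 ≤ ε) (h1 : ε ≤ 1)
    {S T : Finset (Fin p)} (hST : ¬ S ⊆ T) :
    (jointLaw n p ε τ) {ω | aggNorm S (dataMap ω) = aggNorm T (dataMap ω)} = 0 := by
  have := isProbabilityMeasure_jointLaw n p (τ := τ) h0 h1
  have h := jointLaw_real_le (n := n) (τ := τ) h0 h1
    (E := {ω | aggNorm S (dataMap ω) = aggNorm T (dataMap ω)})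
    (measurableSet_eq_fun (by fun_prop) (by fun_prop)) MeasurableSet.univ
    (fun _ _ => Set.mem_univ _) le_rfl fun ℓ _ m _ _ => by
      have := noiseLaw_aggNorm_eq_null hn hST fun i j => ℓ i * m j
      rw [measureReal_def]
      exact le_of_eq ((ENNReal.toReal_eq_zero_iff _).2 (Or.inl this))
  rw [zero_mul] at h
  exact (measureReal_eq_zero_iff (measure_ne_top _ _)).1 (le_antisymm h measureReal_nonneg)

/-- Ties have probability zero, so any maximizing selection is measurable up to null sets. -/
lemma nullMeasurableSet_maximizer_eq {n p N : ℕ} (hn : 0 < n) {ε τ : ℝ} (h0 : 0 ≤ ε) (h1 : ε ≤ 1)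
    {Shat : (Fin n → Fin p → ℝ) → Finset (Fin p)} (hS : IsSparseAggMaximizer N Shat)
    (T : Finset (Fin p)) :
    NullMeasurableSet {ω | Shat (dataMap ω) = T} (jointLaw n p ε τ) := by
  by_cases hT : T.card = N
  swap
  · have : {ω : Omega n p | Shat (dataMap ω) = T} = ∅ := by
      ext ω
      simp only [Set.mem_ofPred_eq, Set.mem_empty_iff_false, iff_false]
      rintro rfl
      exact hT (hS _).1
    rw [this]
    exact MeasurableSet.empty.nullMeasurableSet
  have hM : MeasurableSet {ω : Omega n p | ∀ T' : Finset (Fin p), T'.card = N →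
      aggNorm T' (dataMap ω) ≤ aggNorm T (dataMap ω)} := by
    rw [Set.ofPred_forall]
    refine MeasurableSet.iInter fun T' => ?_
    by_cases h : T'.card = N
    · simp only [h, true_imp_iff]
      exact measurableSet_le (by fun_prop) (by fun_prop)
    · simp [h]
  refine hM.nullMeasurableSet.congr ?_
  have hties : ∀ᵐ ω ∂jointLaw n p ε τ, ∀ S : Finset (Fin p), ¬ S ⊆ T →
      aggNorm S (dataMap ω) ≠ aggNorm T (dataMap ω) := by
    rw [ae_all_iff]
    intro S
    by_cases h : S ⊆ T
    · simp [h]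
    · simp only [h, not_false_eq_true, true_imp_iff]
      rw [ae_iff]
      simpa using jointLaw_aggNorm_eq_null hn h0 h1 h
  filter_upwards [hties] with ω hω
  refine propext ⟨fun h => ?_, fun h => ?_⟩
  · by_contra hne
    have hcard := (hS (dataMap ω)).1
    have hns : ¬ Shat (dataMap ω) ⊆ T := fun hsub =>
      hne (Finset.eq_of_subset_of_card_le hsub (by rw [hT, hcard]))
    exact hω _ hns (le_antisymm (h _ hcard) ((hS (dataMap ω)).2 T hT))
  · intro T' hT'
    have h' : Shat (dataMap ω) = T := h
    rw [← h']
    exact (hS (dataMap ω)).2 T' hT'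

lemma nullMeasurableSet_mem_maximizer {n p N : ℕ} (hn : 0 < n) {ε τ : ℝ} (h0 : 0 ≤ ε) (h1 : ε ≤ 1)
    {Shat : (Fin n → Fin p → ℝ) → Finset (Fin p)} (hS : IsSparseAggMaximizer N Shat) (j : Fin p) :
    NullMeasurableSet {ω | j ∈ Shat (dataMap ω)} (jointLaw n p ε τ) := by
  have : {ω : Omega n p | j ∈ Shat (dataMap ω)}
      = ⋃ T ∈ {T : Finset (Fin p) | j ∈ T}, {ω | Shat (dataMap ω) = T} := by
    ext ω; simp
  rw [this]
  exact NullMeasurableSet.biUnion (Set.to_countable _)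
    fun T _ => nullMeasurableSet_maximizer_eq hn h0 h1 hS T

/-- The symmetric difference of a size-`N` selection and the support, as a sum of indicators. -/
lemma sum_indicator_symmDiff {n p N : ℕ} {Shat : (Fin n → Fin p → ℝ) → Finset (Fin p)}
    (ω : Omega n p) (hN : (Shat (dataMap ω)).card = N) :
    ∑ j, (Set.indicator {ω : Omega n p | ω.2.1 j = 0 ∧ j ∈ Shat (dataMap ω)} (fun _ => (1 : ℝ)) ω
        + Set.indicator {ω : Omega n p | ω.2.1 j ≠ 0 ∧ j ∉ Shat (dataMap ω)} (fun _ => (1 : ℝ)) ω)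
      = N + (suppSet ω.2.1).card - 2 * ((Shat (dataMap ω) ∩ suppSet ω.2.1).card : ℝ) := by
  rw [← hN]
  have e1 : ((Shat (dataMap ω)).card : ℝ) = ∑ j, if j ∈ Shat (dataMap ω) then 1 else 0 := by simp
  have e2 : ((suppSet ω.2.1).card : ℝ) = ∑ j, if j ∈ suppSet ω.2.1 then 1 else 0 := by simp
  have e3 : ((Shat (dataMap ω) ∩ suppSet ω.2.1).card : ℝ)
      = ∑ j, if j ∈ Shat (dataMap ω) ∩ suppSet ω.2.1 then 1 else 0 := by
    rw [Finset.sum_boole, Finset.filter_mem_eq_inter, Finset.univ_inter]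
  rw [e1, e2, e3, Finset.mul_sum, ← Finset.sum_add_distrib, ← Finset.sum_sub_distrib]
  refine Finset.sum_congr rfl fun j _ => ?_
  by_cases h1 : ω.2.1 j = 0 <;> by_cases h2 : j ∈ Shat (dataMap ω) <;>
    (simp [h1, h2, suppSet]; try norm_num)

lemma hammingSig_maximizer_le {n p N : ℕ} (hn : 0 < n) (hN : 0 < N) {ε τ t : ℝ} (h0 : 0 < ε)
    (h1 : ε ≤ 1) (hτ : 0 < τ) (ht : 0 ≤ t) (hpe : 0 < p * ε) (hN1 : p * ε ≤ N)
    (hN2 : (N : ℝ) ≤ p * ε + 1) (hN3 : (N : ℝ) ≤ 2 * (p * ε))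
    {Shat : (Fin n → Fin p → ℝ) → Finset (Fin p)} (hS : IsSparseAggMaximizer N Shat) :
    hammingSig n p ε τ dataMap Shat
      ≤ (p * ε)⁻¹ * (Real.sqrt (p * ε) + 1
        + 2 * (2 * t / (n * absMeanConst * τ * min (τ * Real.sqrt N / 4) 1))
        + 2 * N * (4 / (p * ε) + p ^ N * (2 * Real.exp (-t ^ 2 / (4 * n * N))))) := by
  have := isProbabilityMeasure_jointLaw n p (τ := τ) h0.le h1
  have := isProbabilityMeasure_meanLaw p (τ := τ) h0.le h1
  have hκ := absMeanConst_pos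
  have hN' : (0 : ℝ) < N := by positivity
  set P := jointLaw n p ε τ with hP
  set D := 2 * t / (n * absMeanConst * τ * min (τ * Real.sqrt N / 4) 1) with hD
  have hD0 : 0 ≤ D := by
    have : 0 < min (τ * Real.sqrt N / 4) 1 := lt_min (by positivity) one_pos
    positivity
  let Few : Set (Omega n p) := {ω | ((suppSet ω.2.1).card : ℝ) ≤ p * ε / 2}
  let Bad : Set (Omega n p) := Few ∪ sparseAggBad n p N τ t
  have hFew : MeasurableSet {m : Fin p → ℝ | ((suppSet m).card : ℝ) ≤ p * ε / 2} :=
    measurableSet_le (measurable_card_suppSet p) measurable_const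
  have hmp := measurePreserving_mean n p (τ := τ) h0.le h1
  have hBadm : MeasurableSet Bad :=
    (hmp.measurable hFew).union (measurableSet_sparseAggBad n p N τ t)
  have hBad : P.real Bad ≤ 4 / (p * ε) + p ^ N * (2 * Real.exp (-t ^ 2 / (4 * n * N))) := by
    refine (measureReal_union_le _ _).trans (add_le_add ?_
      (jointLaw_real_sparseAggBad_le h0.le h1 hτ.ne' ht))
    refine le_trans (le_of_eq ?_) (meanLaw_real_card_suppSet_le h0.le h1 hτ.ne' hpe)
    exact hmp.measureReal_preimage hFew.nullMeasurableSet
  have hmem := fun j => nullMeasurableSet_mem_maximizer (τ := τ) hn h0.le h1 hS j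
  have hz : ∀ j : Fin p, MeasurableSet {ω : Omega n p | ω.2.1 j = 0} := fun j =>
    measurableSet_eq_fun (by fun_prop) measurable_const
  have hA1 : ∀ j, NullMeasurableSet {ω : Omega n p | ω.2.1 j = 0 ∧ j ∈ Shat (dataMap ω)} P :=
    fun j => (hz j).nullMeasurableSet.inter (hmem j)
  have hA2 : ∀ j, NullMeasurableSet {ω : Omega n p | ω.2.1 j ≠ 0 ∧ j ∉ Shat (dataMap ω)} P :=
    fun j => (hz j).compl.nullMeasurableSet.inter (hmem j).compl
  have hI : ∀ {A : Set (Omega n p)}, NullMeasurableSet A P →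
      Integrable (A.indicator fun _ => (1 : ℝ)) P := fun hA =>
    (integrable_const _).indicator₀ hA
  have hint : ∀ {A : Set (Omega n p)}, NullMeasurableSet A P →
      ∫ ω, A.indicator (fun _ => (1 : ℝ)) ω ∂P = (P A).toReal := fun hA => by
    rw [integral_indicator₀ hA]; simp [measureReal_def]
  have hsum : ∑ j : Fin p, ((P {ω | ω.2.1 j = 0 ∧ j ∈ Shat (dataMap ω)}).toReal +
      (P {ω | ω.2.1 j ≠ 0 ∧ j ∉ Shat (dataMap ω)}).toReal)
      = ∫ ω, ∑ j, (Set.indicator {ω : Omega n p | ω.2.1 j = 0 ∧ j ∈ Shat (dataMap ω)}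
          (fun _ => (1 : ℝ)) ω
        + Set.indicator {ω : Omega n p | ω.2.1 j ≠ 0 ∧ j ∉ Shat (dataMap ω)}
          (fun _ => (1 : ℝ)) ω) ∂P := by
    rw [integral_finsetSum _ fun j _ => (hI (hA1 j)).fun_add (hI (hA2 j))]
    refine Finset.sum_congr rfl fun j _ => ?_
    rw [integral_add (hI (hA1 j)) (hI (hA2 j)), hint (hA1 j), hint (hA2 j)]
  have hcardI : Integrable (fun m : Fin p → ℝ => |((suppSet m).card : ℝ) - p * ε|)
      (meanLaw p ε τ) :=
    (((memLp_card_suppSet p h0.le h1).integrable (by norm_num)).sub (integrable_const _)).abs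
  have hcardI' : Integrable (fun ω : Omega n p => |((suppSet ω.2.1).card : ℝ) - p * ε|) P :=
    hmp.integrable_comp_of_integrable hcardI
  have hcard : ∫ ω, |((suppSet ω.2.1).card : ℝ) - p * ε| ∂P ≤ Real.sqrt (p * ε) := by
    refine le_trans (le_of_eq ?_) (integral_abs_card_suppSet_sub_le (τ := τ) h0.le h1 hτ.ne' hpe)
    rw [← hmp.map_eq, integral_map hmp.measurable.aemeasurable
      (by rw [hmp.map_eq]; exact hcardI.aestronglyMeasurable)]
  have hBI := hI hBadm.nullMeasurableSet
  have hpt : ∀ ω : Omega n p,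
      ∑ j, (Set.indicator {ω : Omega n p | ω.2.1 j = 0 ∧ j ∈ Shat (dataMap ω)}
          (fun _ => (1 : ℝ)) ω
        + Set.indicator {ω : Omega n p | ω.2.1 j ≠ 0 ∧ j ∉ Shat (dataMap ω)}
          (fun _ => (1 : ℝ)) ω)
      ≤ (|((suppSet ω.2.1).card : ℝ) - p * ε| + (1 + 2 * D))
        + 2 * N * Bad.indicator (fun _ => (1 : ℝ)) ω := by
    intro ω
    have hc := (hS (dataMap ω)).1
    rw [sum_indicator_symmDiff ω hc]
    set M : ℝ := ((suppSet ω.2.1).card : ℝ) with hM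
    have hb0 : (0 : ℝ) ≤ ((Shat (dataMap ω) ∩ suppSet ω.2.1).card : ℝ) := by positivity
    have hMN : M + N - 2 * min M N ≤ |M - p * ε| + 1 := by
      rcases le_total M N with h | h
      · rw [min_eq_left h]
        have := neg_le_abs (M - p * ε)
        linarith
      · rw [min_eq_right h]
        have := le_abs_self (M - p * ε)
        linarith
    by_cases hB : ω ∈ Bad
    · rw [Set.indicator_of_mem hB]
      have := min_le_right M N
      linarith
    · rw [Set.indicator_of_notMem hB]
      rw [Set.mem_union, not_or] at hB
      have hfew : p * ε / 2 < M := not_le.1 hB.1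
      have := card_inter_suppSet_ge hn hN hτ hB.2 (by linarith) hc fun T hT =>
        (hS (dataMap ω)).2 T hT
      linarith
  rw [hammingSig, ← hP, hsum]
  refine mul_le_mul_of_nonneg_left ?_ (by positivity)
  refine (integral_mono (integrable_finsetSum _ fun j _ => (hI (hA1 j)).fun_add (hI (hA2 j)))
    ((hcardI'.fun_add (integrable_const _)).add (hBI.const_mul _)) hpt).trans ?_
  have hsplit : ∫ ω, ((|((suppSet ω.2.1).card : ℝ) - p * ε| + (1 + 2 * D))
        + 2 * N * Bad.indicator (fun _ => (1 : ℝ)) ω) ∂P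
      = (∫ ω, |((suppSet ω.2.1).card : ℝ) - p * ε| ∂P) + (1 + 2 * D) + 2 * N * P.real Bad := by
    rw [integral_add (hcardI'.fun_add (integrable_const _)) (hBI.const_mul _),
      integral_add hcardI' (integrable_const _), integral_const_mul, hint hBadm.nullMeasurableSet]
    simp [measureReal_def]
  refine (le_of_eq hsplit).trans ?_
  have : 2 * N * P.real Bad
      ≤ 2 * N * (4 / (p * ε) + p ^ N * (2 * Real.exp (-t ^ 2 / (4 * n * N)))) := by gcongr
  linarith

lemma tendsto_natCast_rpow_of_neg {a : ℝ} (ha : a < 0) :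
    Tendsto (fun p : ℕ => (p : ℝ) ^ a) atTop (nhds 0) := by
  have h := (tendsto_rpow_neg_atTop (neg_pos.2 ha)).comp
    (tendsto_natCast_atTop_atTop (R := ℝ))
  simpa [Function.comp_def] using h

lemma tendsto_log_mul_natCast_rpow_of_neg {a : ℝ} (ha : a < 0) :
    Tendsto (fun p : ℕ => Real.log p * (p : ℝ) ^ a) atTop (nhds 0) := by
  have h := ((isLittleO_log_rpow_atTop (neg_pos.2 ha)).tendsto_div_nhds_zero).comp
    (tendsto_natCast_atTop_atTop (R := ℝ))
  refine h.congr fun p => ?_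
  simp only [Function.comp_def]
  rw [Real.rpow_neg (Nat.cast_nonneg p), div_inv_eq_mul]

lemma tendsto_natCast_rpow_mul_exp_neg (a : ℝ) {b c : ℝ} (hb : 0 < b) (hc : 0 < c) :
    Tendsto (fun p : ℕ => (p : ℝ) ^ a * Real.exp (-c * (p : ℝ) ^ b)) atTop (nhds 0) := by
  have h := (tendsto_rpow_mul_exp_neg_mul_atTop_nhds_zero (a / b) c hc).comp
    ((tendsto_rpow_atTop hb).comp (tendsto_natCast_atTop_atTop (R := ℝ)))
  refine h.congr fun p => ?_
  simp only [Function.comp_def]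
  rw [← Real.rpow_mul (Nat.cast_nonneg p), mul_div_cancel₀ _ hb.ne']

lemma nDim_bounds {p : ℕ} (hp : 1 ≤ p) {θ : ℝ} (hθ : 0 ≤ θ) :
    (p : ℝ) ^ θ ≤ nDim p θ ∧ (nDim p θ : ℝ) ≤ 2 * (p : ℝ) ^ θ := by
  have h1 : (1 : ℝ) ≤ (p : ℝ) ^ θ := Real.one_le_rpow (by exact_mod_cast hp) hθ
  refine ⟨Nat.le_ceil _, ?_⟩
  have := (Nat.ceil_lt_add_one (by linarith : (0 : ℝ) ≤ (p : ℝ) ^ θ)).le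
  rw [nDim]
  linarith

lemma hammingSig_nonneg (n p : ℕ) {ε : ℝ} (hε : 0 ≤ ε) (τ : ℝ) (D : Omega n p → Fin n → Fin p → ℝ)
    (S : (Fin n → Fin p → ℝ) → Finset (Fin p)) : 0 ≤ hammingSig n p ε τ D S := by
  unfold hammingSig
  positivity

lemma hammingSig_ShatSA_le_rpow {p : ℕ} (hp : 1 ≤ p) {α β θ : ℝ} (hβ : 0 ≤ β) (hθ : 0 ≤ θ)
    (hsep : 8 * Real.log p ≤ (p : ℝ) ^ (θ - 2 * α)) :
    hammingSig (nDim p θ) p ((p : ℝ) ^ (-β)) ((p : ℝ) ^ (-α)) dataMap ShatSA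
      ≤ 8 * (p : ℝ) ^ (2 * β - 1)
        + 8 * ((p : ℝ) ^ (β + θ) * Real.exp (-(1 / 8) * (p : ℝ) ^ (1 - 2 * α - 2 * β)))
        + 2 * (p : ℝ) ^ (β - 1) + 2 * (p : ℝ) ^ (-1 : ℝ) := by
  have hp0 : 0 < p := hp
  have hx1 : (1 : ℝ) ≤ p := by exact_mod_cast hp
  have hx : (0 : ℝ) < p := by linarith
  obtain ⟨hn1, hn2⟩ := nDim_bounds hp hθ
  have hn : 0 < nDim p θ := Nat.ceil_pos.2 (by positivity)
  have hτ : 0 < (p : ℝ) ^ (-α) := by positivity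
  have hε : 0 < (p : ℝ) ^ (-β) := by positivity
  have hε1 : (p : ℝ) ^ (-β) ≤ 1 := Real.rpow_le_one_of_one_le_of_nonpos hx1 (by linarith)
  have hs : 2 * Real.sqrt (2 * Real.log p) ≤ Real.sqrt (nDim p θ) * (p : ℝ) ^ (-α) := by
    have e1 : 2 * Real.sqrt (2 * Real.log p) = Real.sqrt (8 * Real.log p) := by
      rw [show 8 * Real.log p = 2 ^ 2 * (2 * Real.log p) by ring,
        Real.sqrt_mul (by norm_num : (0 : ℝ) ≤ 2 ^ 2), Real.sqrt_sq (by norm_num : (0 : ℝ) ≤ 2)]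
    have e2 : Real.sqrt (nDim p θ) * (p : ℝ) ^ (-α)
        = Real.sqrt (nDim p θ * ((p : ℝ) ^ (-α)) ^ 2) := by
      rw [Real.sqrt_mul (by positivity), Real.sqrt_sq hτ.le]
    rw [e1, e2]
    refine Real.sqrt_le_sqrt (hsep.trans ?_)
    have e3 : (p : ℝ) ^ (θ - 2 * α) = (p : ℝ) ^ θ * ((p : ℝ) ^ (-α)) ^ 2 := by
      rw [← Real.rpow_natCast, ← Real.rpow_mul hx.le, ← Real.rpow_add hx]
      congr 1; push_cast; ring
    rw [e3]
    gcongr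
  refine (hammingSig_ShatSA_le hn hp0 hε hε1 hτ hs).trans ?_
  have hpe : (p : ℝ) * (p : ℝ) ^ (-β) = (p : ℝ) ^ (1 - β) := by
    rw [sub_eq_add_neg, Real.rpow_add hx, Real.rpow_one]
  have hexp : -((p : ℝ) ^ (-α) * ((p : ℝ) * (p : ℝ) ^ (-β) / 2)) ^ 2 / (2 * p)
      = -(1 / 8) * (p : ℝ) ^ (1 - 2 * α - 2 * β) := by
    have e : ((p : ℝ) ^ (-α) * (p : ℝ) ^ (1 - β)) ^ 2 = p * (p : ℝ) ^ (1 - 2 * α - 2 * β) := by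
      rw [← Real.rpow_add hx, ← Real.rpow_natCast, ← Real.rpow_mul hx.le]
      nth_rewrite 2 [← Real.rpow_one (p : ℝ)]
      rw [← Real.rpow_add hx]
      congr 1; push_cast; ring
    rw [hpe, mul_div_assoc', div_pow, e]
    field_simp
    ring
  rw [hexp, hpe]
  set E := Real.exp (-(1 / 8) * (p : ℝ) ^ (1 - 2 * α - 2 * β)) with hE
  have i1 : 2 / (p : ℝ) ^ (-β) = 2 * (p : ℝ) ^ β := by rw [Real.rpow_neg hx.le, div_inv_eq_mul]
  have i2 : ∀ c : ℝ, c / (p : ℝ) ^ (1 - β) = c * (p : ℝ) ^ (β - 1) := fun c => by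
    rw [div_eq_mul_inv, ← Real.rpow_neg hx.le, neg_sub]
  have i3 : (2 : ℝ) / p = 2 * (p : ℝ) ^ (-1 : ℝ) := by rw [Real.rpow_neg_one, div_eq_mul_inv]
  have i4 : (p : ℝ) ^ β * (p : ℝ) ^ (β - 1) = (p : ℝ) ^ (2 * β - 1) := by
    rw [← Real.rpow_add hx]; congr 1; ring
  rw [i1, i2, i2, i3, Real.rpow_add hx β θ, ← i4]
  have : (p : ℝ) ^ β * (nDim p θ * E) ≤ (p : ℝ) ^ β * (2 * (p : ℝ) ^ θ * E) := by gcongr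
  linarith

lemma tendsto_hammingSig_ShatSA {α β θ : ℝ} (hβ0 : 0 ≤ β) (hθ0 : 0 ≤ θ) (hβ : β < 1 / 2)
    (hα : α < θ / 2) (hαβ : 2 * α + 2 * β < 1) :
    Tendsto (fun p : ℕ =>
      hammingSig (nDim p θ) p ((p : ℝ) ^ (-β)) ((p : ℝ) ^ (-α)) dataMap ShatSA)
      atTop (nhds 0) := by
  have hsep : ∀ᶠ p : ℕ in atTop, 8 * Real.log p ≤ (p : ℝ) ^ (θ - 2 * α) := by
    have h := tendsto_log_mul_natCast_rpow_of_neg (a := -(θ - 2 * α)) (by linarith)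
    filter_upwards [h.eventually_le_const (by norm_num : (0 : ℝ) < 1 / 8), eventually_ge_atTop 1]
      with p h1 hp
    have hx : (0 : ℝ) < p := by exact_mod_cast hp
    rw [Real.rpow_neg hx.le, ← div_eq_mul_inv, div_le_iff₀ (by positivity)] at h1
    linarith
  have hlim := ((((tendsto_natCast_rpow_of_neg (a := 2 * β - 1) (by linarith)).const_mul 8).add
    ((tendsto_natCast_rpow_mul_exp_neg (β + θ) (b := 1 - 2 * α - 2 * β) (c := 1 / 8)
      (by linarith) (by norm_num)).const_mul 8)).add
    ((tendsto_natCast_rpow_of_neg (a := β - 1) (by linarith)).const_mul 2)).add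
    ((tendsto_natCast_rpow_of_neg (a := -1) (by norm_num)).const_mul 2)
  simp only [mul_zero, add_zero] at hlim
  refine tendsto_of_tendsto_of_tendsto_of_le_of_le' tendsto_const_nhds hlim
    (Eventually.of_forall fun p => hammingSig_nonneg _ _ (by positivity) _ _ _) ?_
  filter_upwards [hsep, eventually_ge_atTop 1] with p h1 hp
  exact hammingSig_ShatSA_le_rpow hp hβ0 hθ0 h1

lemma hammingSig_maximizer_le_rpow {p : ℕ} (hp : 1 ≤ p) {α β θ : ℝ} (hβ0 : 0 ≤ β) (hβ1 : β ≤ 1)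
    (hθ : 0 ≤ θ) {Shat : (Fin (nDim p θ) → Fin p → ℝ) → Finset (Fin p)}
    (hS : IsSparseAggMaximizer ⌈(p : ℝ) * (p : ℝ) ^ (-β)⌉₊ Shat) :
    hammingSig (nDim p θ) p ((p : ℝ) ^ (-β)) ((p : ℝ) ^ (-α)) dataMap Shat
      ≤ (p : ℝ) ^ ((β - 1) / 2) + 17 * (p : ℝ) ^ (β - 1) + 8 * (p : ℝ) ^ (-1 : ℝ)
        + 8 / absMeanConst * ((8 * Real.log p + 1) * ((p : ℝ) ^ (α - θ / 2)
          + 4 * (p : ℝ) ^ (2 * α - (1 + θ - β) / 2))) := by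
  have hκ := absMeanConst_pos
  have hx1 : (1 : ℝ) ≤ p := by exact_mod_cast hp
  have hx : (0 : ℝ) < p := by linarith
  obtain ⟨hn1, hn2⟩ := nDim_bounds hp hθ
  have hn : 0 < nDim p θ := Nat.ceil_pos.2 (by positivity)
  have hτ : 0 < (p : ℝ) ^ (-α) := by positivity
  have hε : 0 < (p : ℝ) ^ (-β) := by positivity
  have hε1 : (p : ℝ) ^ (-β) ≤ 1 := Real.rpow_le_one_of_one_le_of_nonpos hx1 (by linarith)
  have hpe : (p : ℝ) * (p : ℝ) ^ (-β) = (p : ℝ) ^ (1 - β) := by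
    rw [sub_eq_add_neg, Real.rpow_add hx, Real.rpow_one]
  set N := ⌈(p : ℝ) * (p : ℝ) ^ (-β)⌉₊ with hNdef
  set n := nDim p θ with hndef
  set y := (p : ℝ) * (p : ℝ) ^ (-β) with hy
  have hy1 : 1 ≤ y := by rw [hpe]; exact Real.one_le_rpow hx1 (by linarith)
  have hy0 : 0 < y := by linarith
  have hN : 0 < N := Nat.ceil_pos.2 hy0
  have hN1 : y ≤ N := Nat.le_ceil _
  have hN2 : (N : ℝ) ≤ y + 1 := (Nat.ceil_lt_add_one hy0.le).le
  have hN3 : (N : ℝ) ≤ 2 * y := by linarith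
  have hn' : (0 : ℝ) < n := by positivity
  have hN' : (0 : ℝ) < N := by positivity
  have hlog : 0 ≤ Real.log p := Real.log_nonneg hx1
  set s := Real.sqrt (8 * Real.log p) with hs
  have hs0 : 0 ≤ s := Real.sqrt_nonneg _
  have hss : s ^ 2 = 8 * Real.log p := Real.sq_sqrt (by positivity)
  set r := Real.sqrt n with hr
  have hr0 : 0 < r := Real.sqrt_pos.2 hn'
  have hrr : r ^ 2 = n := Real.sq_sqrt hn'.le
  set u := Real.sqrt N with hu
  have hu0 : 0 < u := Real.sqrt_pos.2 hN'
  set τ := (p : ℝ) ^ (-α) with hτd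
  have h := hammingSig_maximizer_le (t := N * (r * s)) hn hN hε hε1 hτ (by positivity) hy0 hN1 hN2
    hN3 hS
  refine h.trans ?_
  have hexp : (p : ℝ) ^ N * (2 * Real.exp (-(N * (r * s)) ^ 2 / (4 * n * N))) ≤ 2 / p := by
    have e1 : -(N * (r * s)) ^ 2 / (4 * n * N) = -(N * Real.log p + N * Real.log p) := by
      rw [mul_pow, mul_pow, hrr, hss]; field_simp; ring
    have e2 : Real.exp (N * Real.log p) = (p : ℝ) ^ N := by
      rw [mul_comm, Real.exp_mul, Real.exp_log hx, Real.rpow_natCast]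
    have hle : (p : ℝ) ≤ (p : ℝ) ^ N := le_self_pow₀ hx1 hN.ne'
    rw [e1, Real.exp_neg, Real.exp_add, e2]
    have : (p : ℝ) ^ N * (2 * ((p : ℝ) ^ N * (p : ℝ) ^ N)⁻¹) = 2 / (p : ℝ) ^ N := by
      field_simp
    rw [this]
    gcongr
  set q := min (τ * u / 4) 1 with hq
  have hq0 : 0 < q := lt_min (by positivity) one_pos
  have hqinv : q⁻¹ ≤ 1 + 4 / (τ * u) := by
    have hpos : 0 < 4 / (τ * u) := by positivity
    rcases min_choice (τ * u / 4) 1 with h | h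
    · rw [hq, h, inv_div]; linarith
    · rw [hq, h, inv_one]; linarith
  have hsqrt_rpow : ∀ a : ℝ, Real.sqrt ((p : ℝ) ^ a) = (p : ℝ) ^ (a / 2) := fun a => by
    rw [Real.sqrt_eq_rpow, ← Real.rpow_mul hx.le, mul_one_div]
  have hrinv : r⁻¹ * τ⁻¹ ≤ (p : ℝ) ^ (α - θ / 2) := by
    have e : (p : ℝ) ^ (α - θ / 2) = ((p : ℝ) ^ (θ / 2))⁻¹ * τ⁻¹ := by
      rw [hτd, ← Real.rpow_neg hx.le, ← Real.rpow_neg hx.le, ← Real.rpow_add hx]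
      congr 1; ring
    have hrge : (p : ℝ) ^ (θ / 2) ≤ r := by
      rw [← hsqrt_rpow]
      exact Real.sqrt_le_sqrt hn1
    rw [e]
    gcongr
  have huinv : τ⁻¹ * u⁻¹ ≤ (p : ℝ) ^ (α - (1 - β) / 2) := by
    have e : (p : ℝ) ^ (α - (1 - β) / 2) = τ⁻¹ * ((p : ℝ) ^ ((1 - β) / 2))⁻¹ := by
      rw [hτd, ← Real.rpow_neg hx.le, ← Real.rpow_neg hx.le, ← Real.rpow_add hx]
      congr 1; ring
    have huge : (p : ℝ) ^ ((1 - β) / 2) ≤ u := by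
      rw [← hsqrt_rpow, ← hpe]
      exact Real.sqrt_le_sqrt hN1
    rw [e]
    gcongr
  have hs1 : s ≤ 8 * Real.log p + 1 := by
    rw [← hss]; nlinarith [sq_nonneg (s - 1)]
  have hmain : y⁻¹ * (2 * (2 * (N * (r * s)) / (n * absMeanConst * τ * q)))
      ≤ 8 / absMeanConst * ((8 * Real.log p + 1) * ((p : ℝ) ^ (α - θ / 2)
          + 4 * (p : ℝ) ^ (2 * α - (1 + θ - β) / 2))) := by
    have hNy : N / y ≤ 2 := by rw [div_le_iff₀ hy0]; exact hN3
    have e : (p : ℝ) ^ (2 * α - (1 + θ - β) / 2)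
        = (p : ℝ) ^ (α - θ / 2) * (p : ℝ) ^ (α - (1 - β) / 2) := by
      rw [← Real.rpow_add hx]; congr 1; ring
    calc y⁻¹ * (2 * (2 * (N * (r * s)) / (n * absMeanConst * τ * q)))
        = 4 / absMeanConst * ((N / y) * (s * ((r⁻¹ * τ⁻¹) * q⁻¹))) := by
          rw [← hrr]; field_simp; ring
      _ ≤ 4 / absMeanConst * (2 * ((8 * Real.log p + 1) * ((r⁻¹ * τ⁻¹) * (1 + 4 / (τ * u))))) := by
          gcongr
      _ = 8 / absMeanConst * ((8 * Real.log p + 1)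
            * ((r⁻¹ * τ⁻¹) + 4 * ((r⁻¹ * τ⁻¹) * (τ⁻¹ * u⁻¹)))) := by
          field_simp; ring
      _ ≤ _ := by
          rw [e]
          gcongr
  have hyinv : y⁻¹ = (p : ℝ) ^ (β - 1) := by rw [hpe, ← Real.rpow_neg hx.le, neg_sub]
  have hsqrt : y⁻¹ * Real.sqrt y = (p : ℝ) ^ ((β - 1) / 2) := by
    rw [hyinv, hpe, hsqrt_rpow, ← Real.rpow_add hx]
    congr 1; ring
  have hlast : y⁻¹ * (2 * N * (4 / y + p ^ N * (2 * Real.exp (-(N * (r * s)) ^ 2 / (4 * n * N)))))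
      ≤ 16 * (p : ℝ) ^ (β - 1) + 8 * (p : ℝ) ^ (-1 : ℝ) := by
    rw [← hyinv, Real.rpow_neg_one]
    calc _ ≤ y⁻¹ * (2 * (2 * y) * (4 / y + 2 / p)) := by gcongr
      _ = _ := by field_simp; ring
  have hsplit : ∀ a b : ℝ, y⁻¹ * (Real.sqrt y + 1 + a + b)
      = y⁻¹ * Real.sqrt y + y⁻¹ + y⁻¹ * a + y⁻¹ * b := fun a b => by ring
  rw [hsplit, hsqrt]
  linarith

lemma tendsto_hammingSig_maximizer {α β θ : ℝ} (hβ0 : 0 ≤ β) (hβ1 : β < 1) (hθ0 : 0 ≤ θ)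
    (hα : α < θ / 2) (hαβ : 4 * α < 1 + θ - β)
    {Shat : (p : ℕ) → (Fin (nDim p θ) → Fin p → ℝ) → Finset (Fin p)}
    (hS : ∀ p : ℕ, IsSparseAggMaximizer ⌈(p : ℝ) * (p : ℝ) ^ (-β)⌉₊ (Shat p)) :
    Tendsto (fun p : ℕ =>
      hammingSig (nDim p θ) p ((p : ℝ) ^ (-β)) ((p : ℝ) ^ (-α)) dataMap (Shat p))
      atTop (nhds 0) := by
  have hl : ∀ {a : ℝ}, a < 0 →
      Tendsto (fun p : ℕ => (8 * Real.log p + 1) * (p : ℝ) ^ a) atTop (nhds 0) := fun {a} ha => by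
    have h := ((tendsto_log_mul_natCast_rpow_of_neg ha).const_mul 8).add
      (tendsto_natCast_rpow_of_neg ha)
    rw [mul_zero, add_zero] at h
    exact h.congr fun p => by ring
  have hlim := (((tendsto_natCast_rpow_of_neg (a := (β - 1) / 2) (by linarith)).add
    ((tendsto_natCast_rpow_of_neg (a := β - 1) (by linarith)).const_mul 17)).add
    ((tendsto_natCast_rpow_of_neg (a := -1) (by norm_num)).const_mul 8)).add
    (((hl (a := α - θ / 2) (by linarith)).add
      ((hl (a := 2 * α - (1 + θ - β) / 2) (by linarith)).const_mul 4)).const_mul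
        (8 / absMeanConst))
  simp only [mul_zero, add_zero] at hlim
  refine tendsto_of_tendsto_of_tendsto_of_le_of_le' tendsto_const_nhds hlim
    (Eventually.of_forall fun p => hammingSig_nonneg _ _ (by positivity) _ _ _) ?_
  filter_upwards [eventually_ge_atTop 1] with p hp
  refine (hammingSig_maximizer_le_rpow hp hβ0 hβ1.le hθ0 (hS p)).trans (le_of_eq ?_)
  ring

end ARWPaper

open ARWPaper Filter in
/-- statistical upper bound for signal recovery. If `α < η^sig_θ(β)` then
(i) thresholding after Simple Aggregation succeeds when `0 < β < (1-θ)/2`, and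
(ii) Sparse Aggregation with `N = ⌈p ε_p⌉` succeeds when `(1-θ)/2 < β < 1`. -/
theorem signal_recovery_upper_bound
    (α β θ : ℝ) (hα0 : 0 < α) (hα1 : α < 1) (hβ0 : 0 < β) (hβ1 : β < 1)
    (hθ0 : 0 < θ) (hθ1 : θ < 1) (hmain : α < etaSig θ β) :
    (β < (1 - θ) / 2 →
      Tendsto
        (fun p : ℕ =>
          hammingSig (nDim p θ) p ((p : ℝ) ^ (-β)) ((p : ℝ) ^ (-α)) dataMap ShatSA)
        atTop (nhds 0)) ∧
    ((1 - θ) / 2 < β →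
      ∀ Shat : (p : ℕ) → (Fin (nDim p θ) → Fin p → ℝ) → Finset (Fin p),
        (∀ p : ℕ, IsSparseAggMaximizer ⌈(p : ℝ) * (p : ℝ) ^ (-β)⌉₊ (Shat p)) →
        Tendsto
          (fun p : ℕ =>
            hammingSig (nDim p θ) p ((p : ℝ) ^ (-β)) ((p : ℝ) ^ (-α)) dataMap (Shat p))
          atTop (nhds 0)) := by
  have hη : α < θ / 2 ∧ 4 * α < 1 + θ - β := by
    unfold etaSig at hmain
    split_ifs at hmain with h <;> constructor <;> linarith
  exact ⟨fun hβ => tendsto_hammingSig_ShatSA hβ0.le hθ0.le (by linarith) hη.1 (by linarith [hη.1]),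
    fun _ Shat hS => tendsto_hammingSig_maximizer hβ0.le hβ1 hθ0.le hη.1 hη.2 hS⟩
end
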